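/- Weak maximum principle for finite element functions (Theorem 1): For every convex polyhedron Ω ⊂ ℝ³, every quasi-uniformity constant c > 0 and every integer r ≥ 1, there exists a constant C (depending only on Ω, c and r) such that for every h > 0, every tetrahedral partition 𝔗 of Ω with mesh size h and quasi-uniformity constant c, and every discrete harmonic function u_h ∈ S_h, one has sup_{x ∈ Ω} |u_h(x)| ≤ C · sup_{x ∈ ∂Ω} |u_h(x)|. -/

import Mathlib

open MeasureTheory Metric Set
open scoped RealInnerProductSpace ENNReal NNReal

noncomputable section

/-- Three-dimensional Euclidean space. -/
abbrev E3 : Type := EuclideanSpace ℝ (Fin 3)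

/-- A convex polyhedron: a bounded convex open set which is the interior of the
convex hull of a finite set of points. -/
def IsConvexPolyhedron (Ω : Set E3) : Prop :=
  IsOpen Ω ∧ Bornology.IsBounded Ω ∧ Convex ℝ Ω ∧
    ∃ S : Finset E3, Ω = interior (convexHull ℝ (S : Set E3))

/-- The closed tetrahedron with vertices `v 0, v 1, v 2, v 3`. -/
def tet (v : Fin 4 → E3) : Set E3 := convexHull ℝ (Set.range v)

/-- A quasi-uniform conforming tetrahedral partition of `Ω` with mesh size `h`
and quasi-uniformity constant `c`, recorded by the vertex tuples of its tetrahedra. -/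
def IsTetPartition (Ω : Set E3) (T : Finset (Fin 4 → E3)) (h c : ℝ) : Prop :=
  (∀ v ∈ T, AffineIndependent ℝ v) ∧
  (⋃ v ∈ T, tet v) = closure Ω ∧
  (∀ v ∈ T, ∀ w ∈ T, tet v ≠ tet w → interior (tet v) ∩ interior (tet w) = ∅) ∧
  (∀ v ∈ T, ∀ w ∈ T, tet v ≠ tet w →
    tet v ∩ tet w = ∅ ∨ tet v ∩ tet w = convexHull ℝ (Set.range v ∩ Set.range w)) ∧
  (∀ v ∈ T, Metric.diam (tet v) ≤ h) ∧
  (∀ v ∈ T, ∃ x : E3, Metric.closedBall x (c * h) ⊆ tet v)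

/-- The finite element space `S_h` of continuous piecewise polynomials of degree `≤ r`. -/
def MemSh (Ω : Set E3) (T : Finset (Fin 4 → E3)) (r : ℕ) (u : E3 → ℝ) : Prop :=
  ContinuousOn u (closure Ω) ∧
  ∀ v ∈ T, ∃ p : MvPolynomial (Fin 3) ℝ,
    p.totalDegree ≤ r ∧ ∀ x ∈ tet v, u x = MvPolynomial.eval (fun i => x i) p

/-- The subspace `S̊_h` of finite element functions vanishing on the boundary. -/
def MemSh0 (Ω : Set E3) (T : Finset (Fin 4 → E3)) (r : ℕ) (u : E3 → ℝ) : Prop :=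
  MemSh Ω T r u ∧ ∀ x ∈ frontier Ω, u x = 0

/-- The Laplacian, as the trace of the Hessian. -/
def lap (v : E3 → ℝ) (x : E3) : ℝ :=
  ∑ i : Fin 3,
    fderiv ℝ (fun y => fderiv ℝ v y (EuclideanSpace.single i 1)) x (EuclideanSpace.single i 1)

/-- The `L^p(A)` norm. -/
def LpN (A : Set E3) (p : ℝ) (w : E3 → ℝ) : ℝ := (∫ x in A, |w x| ^ p) ^ (1 / p)

/-- The `W^{1,p}(A)` norm. -/
def W1pN (A : Set E3) (p : ℝ) (w : E3 → ℝ) : ℝ :=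
  (∫ x in A, (|w x| ^ p + ‖gradient w x‖ ^ p)) ^ (1 / p)

/-- The `W^{2,p}(A)` norm. -/
def W2pN (A : Set E3) (p : ℝ) (w : E3 → ℝ) : ℝ :=
  (∫ x in A, (|w x| ^ p + ‖gradient w x‖ ^ p + ‖iteratedFDeriv ℝ 2 w x‖ ^ p)) ^ (1 / p)

theorem ryser (r : ℕ) (A : Fin r → Fin r → ℝ) :
    ∑ S : Finset (Fin r), (-1 : ℝ) ^ (r + S.card) * ∏ k, ∑ i ∈ S, A k i
      = ∑ σ : Equiv.Perm (Fin r), ∏ k, A k (σ k) := by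
  have h1 : ∀ S : Finset (Fin r), (-1 : ℝ) ^ (r + S.card) * ∏ k, ∑ i ∈ S, A k i
      = ∑ f : Fin r → Fin r, if (∀ k, f k ∈ S) then (-1 : ℝ) ^ (r + S.card) * ∏ k, A k (f k) else 0 := by
    intro S
    rw [Finset.prod_univ_sum, Finset.mul_sum, ← Finset.sum_filter]
    apply Finset.sum_congr _ (fun _ _ => rfl)
    ext f; simp [Fintype.mem_piFinset]
  simp_rw [h1]
  rw [Finset.sum_comm]
  have h2 : ∀ f : Fin r → Fin r, (∑ S : Finset (Fin r),
      if (∀ k, f k ∈ S) then (-1 : ℝ) ^ (r + S.card) * ∏ k, A k (f k) else 0)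
      = if Function.Bijective f then ∏ k, A k (f k) else 0 := by
    intro f
    have h3 : (∑ S : Finset (Fin r), if (∀ k, f k ∈ S) then (-1 : ℝ) ^ (r + S.card) else 0)
        = if Function.Bijective f then 1 else 0 := by
      rw [← Finset.sum_filter]
      have h4 : (∑ S ∈ Finset.univ.filter (fun S : Finset (Fin r) => ∀ k, f k ∈ S),
          (-1 : ℝ) ^ (r + S.card)) = ∑ R ∈ ((Finset.univ.image f)ᶜ).powerset, (-1 : ℝ) ^ R.card := by
        apply Finset.sum_nbij' (fun S => Sᶜ) (fun R => Rᶜ)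
        · intro S hS
          simp only [Finset.mem_filter, Finset.mem_univ, true_and] at hS
          simp only [Finset.mem_powerset]
          apply Finset.compl_subset_compl.2
          intro x hx
          simp only [Finset.mem_image, Finset.mem_univ, true_and] at hx
          obtain ⟨k, rfl⟩ := hx; exact hS k
        · intro R hR
          simp only [Finset.mem_powerset] at hR
          simp only [Finset.mem_filter, Finset.mem_univ, true_and, Finset.mem_compl]
          intro k hk
          have := hR hk
          simp at this
        · intro S _; simp
        · intro S _; simp
        · intro S _
          have h5 := Finset.card_add_card_compl S
          simp only [Fintype.card_fin] at h5
          have : r + S.card = Sᶜ.card + 2 * S.card := by omega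
          rw [this, pow_add, pow_mul]; norm_num
      rw [h4]
      have h6 := Finset.sum_powerset_neg_one_pow_card (x := (Finset.univ.image f)ᶜ)
      have h7 : (∑ R ∈ ((Finset.univ.image f)ᶜ).powerset, (-1 : ℝ) ^ R.card)
        = (((∑ R ∈ ((Finset.univ.image f)ᶜ).powerset, (-1 : ℤ) ^ R.card) : ℤ) : ℝ) := by
        push_cast; rfl
      rw [h7, h6]
      have h8 : (Finset.univ.image f)ᶜ = ∅ ↔ Function.Bijective f := by
        rw [Finset.compl_eq_empty_iff]
        constructor
        · intro h
          have hs : Function.Surjective f := fun y => by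
            have := Finset.mem_univ y
            rw [← h] at this
            obtain ⟨x, _, hx⟩ := Finset.mem_image.1 this
            exact ⟨x, hx⟩
          exact ⟨Finite.injective_iff_surjective.2 hs, hs⟩
        · intro hb
          apply Finset.eq_univ_iff_forall.2
          intro y
          obtain ⟨x, hx⟩ := hb.2 y
          exact Finset.mem_image.2 ⟨x, Finset.mem_univ _, hx⟩
      by_cases hb : Function.Bijective f
      · rw [if_pos (h8.2 hb), if_pos hb]; norm_num
      · have : ¬ ((Finset.univ.image f)ᶜ = ∅) := fun h => hb (h8.1 h)
        simp only [this, hb, if_false]; norm_num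
    calc _ = (∑ S : Finset (Fin r), if (∀ k, f k ∈ S) then (-1 : ℝ) ^ (r + S.card) else 0) * ∏ k, A k (f k) := by
            rw [Finset.sum_mul]; apply Finset.sum_congr rfl; intro S _; split_ifs <;> simp
      _ = _ := by rw [h3]; split_ifs <;> simp
  simp_rw [h2]
  rw [← Finset.sum_filter]
  symm
  apply Finset.sum_bij (fun (σ : Equiv.Perm (Fin r)) _ => (σ : Fin r → Fin r))
  · intro σ _; exact Finset.mem_filter.2 ⟨Finset.mem_univ _, σ.bijective⟩
  · intro σ _ τ _ h; exact DFunLike.coe_injective h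
  · intro f hf
    simp only [Finset.mem_filter, Finset.mem_univ, true_and] at hf
    exact ⟨Equiv.ofBijective f hf, Finset.mem_univ _, rfl⟩
  · intro σ _; rfl

/-- products of `r` affine functions -/
def prodAff (r : ℕ) (l : Fin r → (E3 →ᵃ[ℝ] ℝ)) : E3 → ℝ := fun x => ∏ k, l k x

/-- polynomial functions of degree at most `r` -/
def PP (r : ℕ) : Submodule ℝ (E3 → ℝ) := Submodule.span ℝ (Set.range (prodAff r))

/-- polarization coefficients -/
def cf (r : ℕ) (u : E3 → ℝ) (a : Fin r → E3) : ℝ :=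
  ((r.factorial : ℝ))⁻¹ * ∑ S : Finset (Fin r), (-1 : ℝ) ^ (r + S.card) * (S.card : ℝ) ^ r *
    u ((S.card : ℝ)⁻¹ • ∑ i ∈ S, a i)

theorem cf_add (r : ℕ) (u w : E3 → ℝ) (a) : cf r (u + w) a = cf r u a + cf r w a := by
  simp [cf, mul_add, Finset.sum_add_distrib]

theorem cf_smul (r : ℕ) (t : ℝ) (u : E3 → ℝ) (a) : cf r (t • u) a = t * cf r u a := by
  simp only [cf, Pi.smul_apply, smul_eq_mul, Finset.mul_sum]
  apply Finset.sum_congr rfl; intros; ring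

theorem cf_sub (r : ℕ) (u w : E3 → ℝ) (a) : cf r (u - w) a = cf r u a - cf r w a := by
  simp [cf, mul_sub, Finset.sum_sub_distrib]

theorem aff_centroid (l : E3 →ᵃ[ℝ] ℝ) {ι : Type*} (S : Finset ι) (t : ι → ℝ) (a : ι → E3)
    (ht : ∑ i ∈ S, t i = 1) : l (∑ i ∈ S, t i • a i) = ∑ i ∈ S, t i * l (a i) := by
  have h : ∀ x, l x = l.linear x + l 0 := fun x => by
    have := l.map_vadd 0 x
    simpa using this
  rw [h, map_sum]
  conv_rhs => arg 2; ext i; rw [h, mul_add]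
  rw [Finset.sum_add_distrib, ← Finset.sum_mul, ht]; simp

theorem cf_prodAff (r : ℕ) (hr : 1 ≤ r) (l : Fin r → (E3 →ᵃ[ℝ] ℝ)) (a : Fin r → E3) :
    cf r (prodAff r l) a = ((r.factorial : ℝ))⁻¹ * ∑ σ : Equiv.Perm (Fin r), ∏ k, l k (a (σ k)) := by
  rw [cf, ← ryser r (fun k i => l k (a i))]
  congr 1
  apply Finset.sum_congr rfl
  intro S _
  rw [mul_assoc]
  congr 1
  by_cases hS : S.card = 0
  · have : S = ∅ := Finset.card_eq_zero.1 hS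
    subst this
    have : 0 < r := hr
    simp [Finset.prod_const, this.ne']
  · have hS' : (S.card : ℝ) ≠ 0 := by exact_mod_cast hS
    have : (S.card : ℝ) ^ r = ∏ _k : Fin r, (S.card : ℝ) := by simp
    rw [this, prodAff, ← Finset.prod_mul_distrib]
    apply Finset.prod_congr rfl
    intro k _
    rw [Finset.smul_sum, aff_centroid (l k) S (fun _ => (S.card : ℝ)⁻¹) a
      (by simp [hS']), Finset.mul_sum]
    apply Finset.sum_congr rfl; intros; field_simp

theorem cf_repr (r : ℕ) (hr : 1 ≤ r) (p : E3 → ℝ) (hp : p ∈ PP r) {ι : Type*} [Fintype ι] [DecidableEq ι]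
    (v : ι → E3) (t : ι → ℝ) (ht : ∑ a, t a = 1) :
    p (∑ a, t a • v a) = ∑ ω : Fin r → ι, cf r p (v ∘ ω) * ∏ k, t (ω k) := by
  induction hp using Submodule.span_induction with
  | mem x hx =>
    obtain ⟨l, rfl⟩ := hx
    simp_rw [cf_prodAff r hr]
    have h1 : ∀ σ : Equiv.Perm (Fin r), ∑ ω : Fin r → ι, (∏ k, l k (v (ω (σ k)))) * ∏ k, t (ω k)
        = ∏ k, l k (∑ a, t a • v a) := by
      intro σ
      have h2 : ∀ ω : Fin r → ι, (∏ k, l k (v (ω (σ k)))) * ∏ k, t (ω k)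
          = ∏ k, (t ((ω ∘ σ) k) * l k (v ((ω ∘ σ) k))) := by
        intro ω
        rw [Finset.prod_mul_distrib, mul_comm]
        congr 1
        exact (Equiv.prod_comp σ (fun k => t (ω k))).symm
      simp_rw [h2]
      rw [Equiv.sum_comp (Equiv.arrowCongr σ.symm (Equiv.refl ι))
        (fun ω : Fin r → ι => ∏ k, (t (ω k) * l k (v (ω k)))) |> fun h => (by
          simpa [Equiv.arrowCongr, Function.comp_def] using h :
          ∑ ω : Fin r → ι, ∏ k, (t ((ω ∘ σ) k) * l k (v ((ω ∘ σ) k))) = ∑ ω : Fin r → ι, ∏ k, (t (ω k) * l k (v (ω k))))]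
      rw [← Fintype.piFinset_univ, ← Finset.prod_univ_sum (fun _ => Finset.univ) (fun k a => t a * l k (v a))]
      apply Finset.prod_congr rfl
      intro k _
      rw [aff_centroid (l k) Finset.univ t v ht]
    have h3 : (r.factorial : ℝ) ≠ 0 := by exact_mod_cast r.factorial_ne_zero
    calc prodAff r l (∑ a, t a • v a)
        = (r.factorial : ℝ)⁻¹ * ∑ σ : Equiv.Perm (Fin r), ∏ k, l k (∑ a, t a • v a) := by
          simp [prodAff, Fintype.card_perm, h3]
      _ = (r.factorial : ℝ)⁻¹ * ∑ σ : Equiv.Perm (Fin r), ∑ ω : Fin r → ι, (∏ k, l k (v (ω (σ k)))) * ∏ k, t (ω k) := by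
          simp_rw [h1]
      _ = _ := by
          rw [Finset.sum_comm, Finset.mul_sum]
          apply Finset.sum_congr rfl
          intro ω _
          rw [mul_assoc, Finset.sum_mul]; rfl
  | zero => simp [cf]
  | add x y _ _ hx hy => 
    simp only [cf_add, add_mul, Finset.sum_add_distrib, Pi.add_apply, hx, hy]
  | smul c x _ hx =>
    simp only [cf_smul, mul_assoc, ← Finset.mul_sum, Pi.smul_apply, hx, smul_eq_mul]

theorem PP_of_mv (r : ℕ) (p : MvPolynomial (Fin 3) ℝ) (hp : p.totalDegree ≤ r) :
    (fun x : E3 => MvPolynomial.eval (fun i => x i) p) ∈ PP r := by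
  have mono : ∀ (r : ℕ) (d : Fin 3 →₀ ℕ), d.degree ≤ r →
      ∃ l, (fun x : E3 => d.prod fun i e => x i ^ e) = prodAff r l := by
    intro r
    induction r with
    | zero =>
      intro d hd
      have : d = 0 := (Finsupp.degree_eq_zero_iff d).1 (by omega)
      subst this
      exact ⟨fun _ => 0, by ext x; simp [prodAff]⟩
    | succ n ih =>
      intro d hd
      by_cases h0 : d = 0
      · subst h0
        exact ⟨fun _ => AffineMap.const ℝ E3 1, by ext x; simp [prodAff]⟩
      · obtain ⟨j, hj⟩ : ∃ j, d j ≠ 0 := by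
          by_contra hcon; push Not at hcon; exact h0 (Finsupp.ext hcon)
        have hd' : d = (d - Finsupp.single j 1) + Finsupp.single j 1 := by
          rw [tsub_add_cancel_of_le]
          rw [Finsupp.single_le_iff]; omega
        obtain ⟨l, hl⟩ := ih (d - Finsupp.single j 1) (by
          have := congrArg Finsupp.degree hd'
          rw [map_add, Finsupp.degree_single] at this; omega)
        refine ⟨Fin.cons ((EuclideanSpace.proj j : E3 →L[ℝ] ℝ).toLinearMap.toAffineMap) l, ?_⟩
        ext x
        have h2 := congrFun hl x
        simp only [prodAff, Fin.prod_univ_succ, Fin.cons_zero, Fin.cons_succ] at h2 ⊢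
        rw [← h2]
        conv_lhs => rw [hd']
        rw [Finsupp.prod_add_index' (by simp) (by intros; rw [pow_add])]
        simp [mul_comm]
  have : (fun x : E3 => MvPolynomial.eval (fun i => x i) p)
      = ∑ d ∈ p.support, p.coeff d • (fun x : E3 => d.prod fun i e => x i ^ e) := by
    ext x
    rw [MvPolynomial.eval_eq]
    simp [Finsupp.prod]
  rw [this]
  apply Submodule.sum_mem
  intro d hd
  apply Submodule.smul_mem
  obtain ⟨l, hl⟩ := mono r d ((MvPolynomial.le_totalDegree hd).trans hp)
  rw [hl]
  exact Submodule.subset_span ⟨l, rfl⟩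

theorem mv_of_PP (r : ℕ) (f : E3 → ℝ) (hf : f ∈ PP r) :
    ∃ p : MvPolynomial (Fin 3) ℝ, p.totalDegree ≤ r ∧ ∀ x : E3, f x = MvPolynomial.eval (fun i => x i) p := by
  induction hf using Submodule.span_induction with
  | mem x hx =>
    obtain ⟨l, rfl⟩ := hx
    refine ⟨∏ k, (MvPolynomial.C (l k 0) + ∑ j, MvPolynomial.C ((l k).linear (EuclideanSpace.single j 1)) * MvPolynomial.X j), ?_, ?_⟩
    · refine (MvPolynomial.totalDegree_finsetProd _ _).trans ?_
      refine (Finset.sum_le_card_nsmul _ _ 1 ?_).trans (by simp)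
      intro k _
      refine (MvPolynomial.totalDegree_add _ _).trans (max_le (by simp) ?_)
      refine (MvPolynomial.totalDegree_finsetSum_le ?_)
      intro j _
      refine (MvPolynomial.totalDegree_mul _ _).trans (by simp)
    · intro x
      simp only [prodAff, map_prod, map_add, MvPolynomial.eval_C, map_sum, map_mul, MvPolynomial.eval_X]
      apply Finset.prod_congr rfl
      intro k _
      have h : l k x = (l k).linear x + l k 0 := by
        have := (l k).map_vadd 0 x
        simpa using this
      have hx : x = ∑ j, x j • (EuclideanSpace.single j 1 : E3) := by
        ext i; simp [Pi.single_apply]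
      rw [h, add_comm]
      congr 1
      conv_lhs => rw [hx, map_sum]
      simp [mul_comm]
  | zero => exact ⟨0, by simp, by simp⟩
  | add x y _ _ hx hy =>
    obtain ⟨p, hp, hp'⟩ := hx; obtain ⟨q, hq, hq'⟩ := hy
    exact ⟨p + q, (MvPolynomial.totalDegree_add _ _).trans (max_le hp hq), fun x => by simp [hp', hq']⟩
  | smul c x _ hx =>
    obtain ⟨p, hp, hp'⟩ := hx
    exact ⟨c • p, (MvPolynomial.totalDegree_smul_le _ _).trans hp, fun x => by simp [hp', MvPolynomial.smul_eval]⟩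

/-- derivative data -/
theorem PP_deriv (r : ℕ) (f : E3 → ℝ) (hf : f ∈ PP r) :
    ContDiff ℝ 1 f ∧ ∀ e : E3, (fun x => fderiv ℝ f x e) ∈ PP r := by
  induction hf using Submodule.span_induction with
  | mem x hx =>
    obtain ⟨l, rfl⟩ := hx
    have hl : ∀ k, ContDiff ℝ 1 (l k) := fun k => by
      have h : (l k : E3 → ℝ) = fun x => (l k).linear.toContinuousLinearMap x + l k 0 := by
        ext x
        have := (l k).map_vadd 0 x
        simpa using this
      rw [h]
      exact (ContinuousLinearMap.contDiff _).add contDiff_const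
    have hcd : ContDiff ℝ 1 (prodAff r l) := contDiff_prod (fun k _ => hl k)
    refine ⟨hcd, fun e => ?_⟩
    have h1 : (fun x => fderiv ℝ (prodAff r l) x e)
        = ∑ k, prodAff r (Function.update l k (AffineMap.const ℝ E3 ((l k).linear e))) := by
      ext x
      have hd : ∀ k, HasFDerivAt (l k) ((l k).linear.toContinuousLinearMap) x := fun k => by
        have h : (l k : E3 → ℝ) = fun x => (l k).linear.toContinuousLinearMap x + l k 0 := by
          ext x
          have := (l k).map_vadd 0 x
          simpa using this
        rw [h]
        exact (ContinuousLinearMap.hasFDerivAt _).add_const _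
      have := HasFDerivAt.finsetProd (u := Finset.univ) (fun k _ => hd k)
      have h2 : fderiv ℝ (prodAff r l) x = _ := this.fderiv
      rw [h2]
      simp only [_root_.sum_apply, _root_.smul_apply, Finset.sum_apply, smul_eq_mul]
      apply Finset.sum_congr rfl
      intro k _
      rw [prodAff, ← Finset.prod_erase_mul _ _ (Finset.mem_univ k)]
      simp only [Function.update_self, AffineMap.const_apply, LinearMap.coe_toContinuousLinearMap']
      congr 1
      apply Finset.prod_congr rfl
      intro j hj
      rw [Function.update_of_ne (Finset.ne_of_mem_erase hj)]
    rw [h1]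
    exact Submodule.sum_mem _ (fun k _ => Submodule.subset_span ⟨_, rfl⟩)
  | zero => exact ⟨contDiff_const, fun e => by
      have : (fun x => fderiv ℝ (0 : E3 → ℝ) x e) = 0 := by ext x; simp
      rw [this]; exact Submodule.zero_mem _⟩
  | add x y _ _ hx hy =>
    refine ⟨hx.1.add hy.1, fun e => ?_⟩
    have : (fun z => fderiv ℝ (x + y) z e) = (fun z => fderiv ℝ x z e) + (fun z => fderiv ℝ y z e) := by
      ext z
      rw [fderiv_add (hx.1.differentiable one_ne_zero z) (hy.1.differentiable one_ne_zero z)]; rfl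
    rw [this]; exact Submodule.add_mem _ (hx.2 e) (hy.2 e)
  | smul c x _ hx =>
    refine ⟨contDiff_const.smul hx.1, fun e => ?_⟩
    have : (fun z => fderiv ℝ (c • x) z e) = c • (fun z => fderiv ℝ x z e) := by
      ext z
      rw [fderiv_const_smul (hx.1.differentiable one_ne_zero z)]; rfl
    rw [this]; exact Submodule.smul_mem _ _ (hx.2 e)

/-- barycentric basis -/
def bas (v : Fin 4 → E3) (hv : AffineIndependent ℝ v) : AffineBasis (Fin 4) ℝ E3 :=
  ⟨v, hv, (hv.affineSpan_eq_top_iff_card_eq_finrank_add_one).2 (by simp)⟩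

open Classical in
/-- barycentric coordinates -/
def lam (v : Fin 4 → E3) (a : Fin 4) : E3 →ᵃ[ℝ] ℝ :=
  if hv : AffineIndependent ℝ v then (bas v hv).coord a else 0

theorem lam_eq {v : Fin 4 → E3} (hv : AffineIndependent ℝ v) (a : Fin 4) :
    lam v a = (bas v hv).coord a := by simp [lam, hv]

theorem lam_sum {v : Fin 4 → E3} (hv : AffineIndependent ℝ v) (x : E3) : ∑ a, lam v a x = 1 := by
  simp_rw [lam_eq hv]; exact (bas v hv).sum_coord_apply_eq_one x

theorem lam_comb {v : Fin 4 → E3} (hv : AffineIndependent ℝ v) (x : E3) :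
    ∑ a, lam v a x • v a = x := by
  simp_rw [lam_eq hv]; exact (bas v hv).linear_combination_coord_eq_self x

theorem lam_vertex {v : Fin 4 → E3} (hv : AffineIndependent ℝ v) (a b : Fin 4) :
    lam v a (v b) = if a = b then 1 else 0 := by
  rw [lam_eq hv]; exact (bas v hv).coord_apply a b

theorem mem_tet_iff {v : Fin 4 → E3} (hv : AffineIndependent ℝ v) (x : E3) :
    x ∈ tet v ↔ ∀ a, 0 ≤ lam v a x := by
  have h := (bas v hv).convexHull_eq_nonneg_coord
  simp_rw [lam_eq hv]
  change x ∈ convexHull ℝ (Set.range (bas v hv)) ↔ _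
  rw [h]; rfl

theorem lam_le_one {v : Fin 4 → E3} (hv : AffineIndependent ℝ v) {x : E3} (hx : x ∈ tet v) (a : Fin 4) :
    lam v a x ≤ 1 := by
  rw [← lam_sum hv x]
  exact Finset.single_le_sum (f := fun a => lam v a x) (fun b _ => (mem_tet_iff hv x).1 hx b) (Finset.mem_univ a)

theorem aff_apply (l : E3 →ᵃ[ℝ] ℝ) (x y : E3) : l (x + y) = l x + l.linear y := by
  have := l.map_vadd x y
  simp only [vadd_eq_add] at this
  rw [add_comm x y, this, add_comm]

/-- quasi-uniform element -/
def Elt (h c : ℝ) (v : Fin 4 → E3) : Prop :=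
  AffineIndependent ℝ v ∧ Metric.diam (tet v) ≤ h ∧ ∃ x : E3, Metric.closedBall x (c * h) ⊆ tet v

theorem tet_compact (v : Fin 4 → E3) : IsCompact (tet v) :=
  (Set.finite_range v).isCompact_convexHull (𝕜 := ℝ)

theorem tet_convex (v : Fin 4 → E3) : Convex ℝ (tet v) := convex_convexHull ℝ _

theorem vert_mem (v : Fin 4 → E3) (a : Fin 4) : v a ∈ tet v := subset_convexHull ℝ _ ⟨a, rfl⟩

theorem tet_dist {h c : ℝ} {v : Fin 4 → E3} (H : Elt h c v) {x y : E3} (hx : x ∈ tet v) (hy : y ∈ tet v) :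
    ‖x - y‖ ≤ h := by
  rw [← dist_eq_norm]
  exact (Metric.dist_le_diam_of_mem (tet_compact v).isBounded hx hy).trans H.2.1

theorem lam_lin {h c : ℝ} (hh : 0 < h) (hc : 0 < c) {v : Fin 4 → E3} (H : Elt h c v) (a : Fin 4) (e : E3) :
    |(lam v a).linear e| ≤ ‖e‖ / (c * h) := by
  obtain ⟨hv, _, x, hx⟩ := H
  have hch : 0 < c * h := mul_pos hc hh
  by_cases he : e = 0
  · simp [he]
  have he' : 0 < ‖e‖ := norm_pos_iff.2 he
  have key : ∀ t : ℝ, |t| * ‖e‖ = c * h → t * (lam v a).linear e ≤ 1 := by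
    intro t ht
    have h1 : x + t • e ∈ tet v := hx (by simp [mem_closedBall, dist_eq_norm, norm_smul, ht])
    have h0 : x ∈ tet v := hx (mem_closedBall_self hch.le)
    have := lam_le_one hv h1 a
    rw [aff_apply] at this
    have h2 := (mem_tet_iff hv x).1 h0 a
    simp only [map_smul, smul_eq_mul] at this
    linarith
  have h1 := key (c * h / ‖e‖) (by rw [abs_of_pos (by positivity)]; field_simp)
  have h2 := key (-(c * h / ‖e‖)) (by rw [abs_neg, abs_of_pos (by positivity)]; field_simp)
  rw [abs_le, le_div_iff₀ hch]
  constructor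
  · have : -1 ≤ c * h / ‖e‖ * (lam v a).linear e := by linarith
    rw [div_mul_eq_mul_div, le_div_iff₀ he'] at this
    rw [neg_le, le_div_iff₀ hch]; linarith
  · rw [div_mul_eq_mul_div, div_le_iff₀ he'] at h1
    linarith

theorem grad_inner (f : E3 → ℝ) (x e : E3) : ⟪gradient f x, e⟫ = fderiv ℝ f x e := by
  simp [gradient]

theorem grad_norm_le (f : E3 → ℝ) (x : E3) (C : ℝ) (hC : 0 ≤ C) (H : ∀ e, |fderiv ℝ f x e| ≤ C * ‖e‖) :
    ‖gradient f x‖ ≤ C := by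
  have : ‖gradient f x‖ = ‖fderiv ℝ f x‖ := by simp [gradient]
  rw [this]
  exact ContinuousLinearMap.opNorm_le_bound _ hC (fun e => by simpa using H e)

/-- Bernstein form -/
def bern (r : ℕ) (v : Fin 4 → E3) (Cf : (Fin r → Fin 4) → ℝ) (x : E3) : ℝ :=
  ∑ ω : Fin r → Fin 4, Cf ω * ∏ k, lam v (ω k) x

theorem bern_PP (r : ℕ) (v : Fin 4 → E3) (Cf : (Fin r → Fin 4) → ℝ) : bern r v Cf ∈ PP r := by
  have : bern r v Cf = ∑ ω : Fin r → Fin 4, Cf ω • prodAff r (fun k => lam v (ω k)) := by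
    ext x; simp [bern, prodAff]
  rw [this]
  exact Submodule.sum_mem _ fun ω _ => Submodule.smul_mem _ _ (Submodule.subset_span ⟨_, rfl⟩)

theorem PP_bern (r : ℕ) (hr : 1 ≤ r) {v : Fin 4 → E3} (hv : AffineIndependent ℝ v) (p : E3 → ℝ) (hp : p ∈ PP r) :
    p = bern r v (fun ω => cf r p (v ∘ ω)) := by
  ext x
  have := cf_repr r hr p hp v (fun a => lam v a x) (lam_sum hv x)
  rw [lam_comb hv] at this
  exact this

theorem prod_lam_sum (r : ℕ) (v : Fin 4 → E3) (x : E3) (c : Fin r → Fin 4 → ℝ) :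
    ∑ ω : Fin r → Fin 4, (∏ k, c k (ω k)) * ∏ k, lam v (ω k) x = ∏ k, ∑ a, c k a * lam v a x := by
  rw [Finset.prod_univ_sum, Fintype.piFinset_univ]
  simp_rw [Finset.prod_mul_distrib]

theorem bern_const (r : ℕ) {v : Fin 4 → E3} (hv : AffineIndependent ℝ v) (m : ℝ) (x : E3) :
    bern r v (fun _ => m) x = m := by
  have := prod_lam_sum r v x (fun _ _ => 1)
  simp only [Finset.prod_const_one, one_mul, lam_sum hv] at this
  simp [bern, ← Finset.mul_sum, this]

theorem bern_first (r : ℕ) (hr : 0 < r) {v : Fin 4 → E3} (hv : AffineIndependent ℝ v) (φ : Fin 4 → ℝ) (x : E3) :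
    bern r v (fun ω => φ (ω ⟨0, hr⟩)) x = ∑ a, φ a * lam v a x := by
  have := prod_lam_sum r v x (fun k a => if k = ⟨0, hr⟩ then φ a else 1)
  have h1 : ∀ ω : Fin r → Fin 4, (∏ k, if k = ⟨0, hr⟩ then φ (ω k) else 1) = φ (ω ⟨0, hr⟩) := by
    intro ω
    rw [Finset.prod_eq_single (⟨0, hr⟩ : Fin r)]
    · simp
    · intro b _ hb; simp [hb]
    · simp
  have h2 : (∏ k : Fin r, ∑ a, (if k = ⟨0, hr⟩ then φ a else 1) * lam v a x) = ∑ a, φ a * lam v a x := by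
    rw [Finset.prod_eq_single (⟨0, hr⟩ : Fin r)]
    · simp
    · intro b _ hb; simp [hb, lam_sum hv]
    · simp
  simp_rw [h1] at this
  rw [h2] at this
  exact this

theorem bern_bound (r : ℕ) {v : Fin 4 → E3} (hv : AffineIndependent ℝ v) (Cf : (Fin r → Fin 4) → ℝ)
    (M : ℝ) (hM : ∀ ω, |Cf ω| ≤ M) {x : E3} (hx : x ∈ tet v) : |bern r v Cf x| ≤ M := by
  have h0 := (mem_tet_iff hv x).1 hx
  rw [← bern_const r hv M x, bern, bern]
  refine (Finset.abs_sum_le_sum_abs _ _).trans (Finset.sum_le_sum fun ω _ => ?_)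
  rw [abs_mul, abs_of_nonneg (Finset.prod_nonneg fun k _ => h0 (ω k))]
  exact mul_le_mul_of_nonneg_right (hM ω) (Finset.prod_nonneg fun k _ => h0 (ω k))

theorem aff_hasFDerivAt (l : E3 →ᵃ[ℝ] ℝ) (x : E3) : HasFDerivAt l l.linear.toContinuousLinearMap x := by
  have h : (l : E3 → ℝ) = fun x => l.linear.toContinuousLinearMap x + l 0 := by
    ext x
    have := l.map_vadd 0 x
    simpa using this
  rw [h]
  exact (ContinuousLinearMap.hasFDerivAt _).add_const _

theorem prodAff_deriv_bound (r : ℕ) (l : Fin r → E3 →ᵃ[ℝ] ℝ) (x e : E3) (L : ℝ) 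
    (h0 : ∀ k, 0 ≤ l k x) (h1 : ∀ k, l k x ≤ 1) (hL : ∀ k, |(l k).linear e| ≤ L) :
    |fderiv ℝ (prodAff r l) x e| ≤ r * L := by
  have := HasFDerivAt.finsetProd (u := Finset.univ) (fun k _ => aff_hasFDerivAt (l k) x)
  have h2 : fderiv ℝ (prodAff r l) x = _ := this.fderiv
  rw [h2]
  simp only [_root_.sum_apply, _root_.smul_apply, smul_eq_mul]
  refine (Finset.abs_sum_le_sum_abs _ _).trans ?_
  refine (Finset.sum_le_card_nsmul _ _ L ?_).trans (by simp)
  intro k _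
  rw [abs_mul]
  have h3 : |∏ j ∈ Finset.univ.erase k, l j x| ≤ 1 := by
    rw [abs_of_nonneg (Finset.prod_nonneg fun j _ => h0 j)]
    exact Finset.prod_le_one (fun j _ => h0 j) (fun j _ => h1 j)
  calc _ ≤ 1 * L := by
        apply mul_le_mul h3 _ (abs_nonneg _) zero_le_one
        simpa using hL k
    _ = L := one_mul _

theorem PP_diff {r : ℕ} {p : E3 → ℝ} (hp : p ∈ PP r) : Differentiable ℝ p :=
  (PP_deriv r p hp).1.differentiable one_ne_zero

/-- gradient bound of Bernstein form -/
theorem bern_grad (r : ℕ) {h c : ℝ} (hh : 0 < h) (hc : 0 < c) {v : Fin 4 → E3} (H : Elt h c v)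
    (Cf : (Fin r → Fin 4) → ℝ) (M : ℝ) (hM0 : 0 ≤ M) (hM : ∀ ω, |Cf ω| ≤ M) {x : E3} (hx : x ∈ tet v) :
    ‖gradient (bern r v Cf) x‖ ≤ (4 ^ r * r / c) * M / h := by
  apply grad_norm_le
  · positivity
  intro e
  have h1 : bern r v Cf = fun x => ∑ ω : Fin r → Fin 4, Cf ω * prodAff r (fun k => lam v (ω k)) x := by
    ext x; simp [bern, prodAff]
  have hd : ∀ ω : Fin r → Fin 4, DifferentiableAt ℝ (prodAff r (fun k => lam v (ω k))) x := fun ω =>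
    PP_diff (Submodule.subset_span ⟨_, rfl⟩) x
  rw [h1, fderiv_fun_sum (fun ω _ => (hd ω).const_mul (Cf ω))]
  simp only [_root_.sum_apply]
  refine (Finset.abs_sum_le_sum_abs _ _).trans ?_
  refine (Finset.sum_le_card_nsmul _ _ (M * (r * (‖e‖ / (c * h)))) ?_).trans ?_
  · intro ω _
    rw [fderiv_const_mul (hd ω)]
    simp only [_root_.smul_apply, smul_eq_mul, abs_mul]
    apply mul_le_mul (hM ω) _ (abs_nonneg _) hM0
    exact prodAff_deriv_bound r _ x e _ (fun k => (mem_tet_iff H.1 x).1 hx _) (fun k => lam_le_one H.1 hx _)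
      (fun k => lam_lin hh hc H _ e)
  · simp only [Finset.card_univ, Fintype.card_fun, Fintype.card_fin, nsmul_eq_mul]
    apply le_of_eq
    push_cast
    field_simp

/-- constant bounding polarization coefficients -/
def CR (r : ℕ) : ℝ := ((r.factorial : ℝ))⁻¹ * ∑ S : Finset (Fin r), (S.card : ℝ) ^ r

theorem CR_nonneg (r : ℕ) : 0 ≤ CR r := by unfold CR; positivity

theorem cf_bound (r : ℕ) (hr : 1 ≤ r) (u : E3 → ℝ) (a : Fin r → E3) (M : ℝ)
    (hM : ∀ x ∈ convexHull ℝ (Set.range a), |u x| ≤ M) : |cf r u a| ≤ CR r * M := by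
  rw [cf, CR, abs_mul, abs_of_nonneg (by positivity : (0:ℝ) ≤ (r.factorial : ℝ)⁻¹), mul_assoc]
  apply mul_le_mul_of_nonneg_left _ (by positivity)
  rw [Finset.sum_mul]
  refine (Finset.abs_sum_le_sum_abs _ _).trans (Finset.sum_le_sum fun S _ => ?_)
  rw [abs_mul, abs_mul, abs_pow, abs_neg, abs_one, one_pow, one_mul, abs_of_nonneg (by positivity : (0:ℝ) ≤ (S.card:ℝ)^r)]
  by_cases hS : S.card = 0
  · have : r ≠ 0 := by omega
    simp [hS, this]
  · apply mul_le_mul_of_nonneg_left _ (by positivity)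
    apply hM
    rw [Finset.smul_sum]
    have hS' : (S.card : ℝ) ≠ 0 := by exact_mod_cast hS
    exact (convex_convexHull ℝ _).sum_mem (fun i _ => by positivity) (by simp [hS'])
      (fun i _ => subset_convexHull ℝ _ ⟨i, rfl⟩)

theorem cf_congr (r : ℕ) (hr : 1 ≤ r) (u w : E3 → ℝ) (a : Fin r → E3)
    (h : ∀ x ∈ convexHull ℝ (Set.range a), u x = w x) : cf r u a = cf r w a := by
  have := cf_bound r hr (u - w) a 0 (fun x hx => by simp [h x hx])
  rw [cf_sub, mul_zero] at this
  have := abs_nonpos_iff.1 this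
  linarith

theorem const_prodAff (r : ℕ) (hr : 1 ≤ r) (m : ℝ) : (fun _ => m : E3 → ℝ) =
    prodAff r (fun k => if k = ⟨0, hr⟩ then AffineMap.const ℝ E3 m else AffineMap.const ℝ E3 1) := by
  ext x
  rw [prodAff, Finset.prod_eq_single (⟨0, hr⟩ : Fin r)]
  · simp
  · intro b _ hb; simp [hb]
  · simp

theorem const_PP (r : ℕ) (hr : 1 ≤ r) (m : ℝ) : (fun _ => m : E3 → ℝ) ∈ PP r :=
  Submodule.subset_span ⟨_, (const_prodAff r hr m).symm⟩

theorem cf_const (r : ℕ) (hr : 1 ≤ r) (m : ℝ) (a : Fin r → E3) : cf r (fun _ => m) a = m := by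
  rw [const_prodAff r hr m, cf_prodAff r hr]
  have : ∀ σ : Equiv.Perm (Fin r), ∏ k, (if k = ⟨0, hr⟩ then AffineMap.const ℝ E3 m else AffineMap.const ℝ E3 1) (a (σ k)) = m := by
    intro σ
    rw [Finset.prod_eq_single (⟨0, hr⟩ : Fin r)]
    · simp
    · intro b _ hb; simp [hb]
    · simp
  simp_rw [this]
  have h3 : (r.factorial : ℝ) ≠ 0 := by exact_mod_cast r.factorial_ne_zero
  simp [Fintype.card_perm, h3]

/-- inverse estimate constant -/
def Ci (r : ℕ) (c : ℝ) : ℝ := 4 ^ r * r / c * CR r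

theorem Ci_nonneg (r : ℕ) {c : ℝ} (hc : 0 < c) : 0 ≤ Ci r c := by
  unfold Ci; have := CR_nonneg r; positivity

theorem sub_hull (r : ℕ) (v : Fin 4 → E3) (ω : Fin r → Fin 4) :
    convexHull ℝ (Set.range (v ∘ ω)) ⊆ tet v :=
  convexHull_mono (Set.range_comp_subset_range ω v)

theorem inv_est (r : ℕ) (hr : 1 ≤ r) {h c : ℝ} (hh : 0 < h) (hc : 0 < c) {v : Fin 4 → E3} (H : Elt h c v)
    {p : E3 → ℝ} (hp : p ∈ PP r) (M : ℝ) (hM : ∀ x ∈ tet v, |p x| ≤ M) {x : E3} (hx : x ∈ tet v) :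
    ‖gradient p x‖ ≤ Ci r c * M / h := by
  have hM0 : 0 ≤ M := (abs_nonneg _).trans (hM x hx)
  have := bern_grad r hh hc H (fun ω => cf r p (v ∘ ω)) (CR r * M) (mul_nonneg (CR_nonneg r) hM0)
    (fun ω => cf_bound r hr p _ M (fun x hx => hM x (sub_hull r v ω hx))) hx
  rw [← PP_bern r hr H.1 p hp] at this
  refine this.trans (le_of_eq ?_)
  rw [Ci]; ring

theorem mean_val {r : ℕ} {p : E3 → ℝ} (hp : p ∈ PP r) {s : Set E3} (hs : Convex ℝ s) (m : ℝ)
    (hm : ∀ x ∈ s, ‖gradient p x‖ ≤ m) {x y : E3} (hx : x ∈ s) (hy : y ∈ s) :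
    |p y - p x| ≤ m * ‖y - x‖ := by
  have := hs.norm_image_sub_le_of_norm_fderiv_le (𝕜 := ℝ) (f := p) (fun x _ => PP_diff hp x)
    (fun x hx => by
      have h1 : ‖gradient p x‖ = ‖fderiv ℝ p x‖ := by simp [gradient]
      rw [← h1]; exact hm x hx) hx hy
  simpa using this

theorem vol_pos {h c : ℝ} (hh : 0 < h) (hc : 0 < c) {v : Fin 4 → E3} (H : Elt h c v) :
    (c * h) ^ 3 ≤ volume.real (tet v) := by
  obtain ⟨x, hx⟩ := H.2.2
  have h1 : volume.real (closedBall x (c * h)) ≤ volume.real (tet v) :=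
    measureReal_mono hx (tet_compact v).measure_lt_top.ne
  refine le_trans ?_ h1
  have hch : 0 < c * h := mul_pos hc hh
  rw [measureReal_def, EuclideanSpace.volume_closedBall_fin_three]
  rw [ENNReal.toReal_mul, ENNReal.toReal_pow, ENNReal.toReal_ofReal hch.le, ENNReal.toReal_ofReal (by positivity)]
  have := Real.pi_gt_three
  have h3 : 0 < (c*h)^3 := by positivity
  nlinarith

theorem sup_avg (r : ℕ) (hr : 1 ≤ r) {h c : ℝ} (hh : 0 < h) (hc : 0 < c) {v : Fin 4 → E3} (H : Elt h c v)
    {p : E3 → ℝ} (hp : p ∈ PP r) {x : E3} (hx : x ∈ tet v) :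
    p x ^ 2 * volume.real (tet v) ≤ (32 * (Ci r c + 1) ^ 3) * ∫ y in tet v, p y ^ 2 := by
  have hpc : Continuous p := (PP_diff hp).continuous
  obtain ⟨z, hz, hzm⟩ := (tet_compact v).exists_isMaxOn ⟨x, hx⟩ (hpc.abs.continuousOn)
  set M := |p z| with hM
  have hzm' : ∀ y ∈ tet v, |p y| ≤ M := fun y hy => hzm hy
  have hC := Ci_nonneg r hc
  set t : ℝ := 1 / (2 * (Ci r c + 1)) with ht
  have ht0 : 0 < t := by positivity
  have ht1 : t ≤ 1 := by rw [ht, div_le_one (by positivity)]; linarith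
  have hM0 : 0 ≤ M := abs_nonneg _
  set K' := AffineMap.homothety z t '' tet v with hK'
  have hsub : K' ⊆ tet v := by
    rintro _ ⟨y, hy, rfl⟩
    rw [AffineMap.homothety_eq_lineMap]
    exact (tet_convex v).lineMap_mem hz hy ⟨ht0.le, ht1⟩
  have hlow : ∀ y ∈ K', M ^ 2 / 4 ≤ p y ^ 2 := by
    intro y hy
    have hyt := hsub hy
    obtain ⟨w, hw, rfl⟩ := hy
    have h1 := mean_val hp (tet_convex v) _ (fun x hx => inv_est r hr hh hc H hp M hzm' hx) hz hyt
    have h2 : ‖(AffineMap.homothety z t) w - z‖ ≤ t * h := by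
      have : (AffineMap.homothety z t) w - z = t • (w - z) := by simp [AffineMap.homothety_apply]
      rw [this, norm_smul, Real.norm_of_nonneg ht0.le]
      exact mul_le_mul_of_nonneg_left (tet_dist H hw hz) ht0.le
    have h3 : Ci r c * M / h * ‖(AffineMap.homothety z t) w - z‖ ≤ M / 2 := by
      calc _ ≤ Ci r c * M / h * (t * h) := by gcongr
        _ = Ci r c * t * M := by field_simp
        _ ≤ 1 / 2 * M := by
            gcongr
            rw [ht, mul_one_div, div_le_iff₀ (by positivity)]; linarith
        _ = M / 2 := by ring
    have h4 : M / 2 ≤ |p ((AffineMap.homothety z t) w)| := by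
      have := abs_sub_abs_le_abs_sub (p z) (p ((AffineMap.homothety z t) w))
      rw [abs_sub_comm] at this
      linarith
    calc M ^ 2 / 4 = (M / 2) ^ 2 := by ring
      _ ≤ |p ((AffineMap.homothety z t) w)| ^ 2 := by gcongr
      _ = _ := sq_abs _
  have hvol : volume.real K' = t ^ 3 * volume.real (tet v) := by
    rw [measureReal_def, hK', Measure.addHaar_image_homothety, ENNReal.toReal_mul, measureReal_def]
    simp only [finrank_euclideanSpace, Fintype.card_fin]
    rw [abs_of_pos (by positivity), ENNReal.toReal_ofReal (by positivity)]
  have hint : IntegrableOn (fun y => p y ^ 2) (tet v) :=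
    (hpc.pow 2).continuousOn.integrableOn_compact (tet_compact v)
  have hK'c : IsCompact K' := (tet_compact v).image (AffineMap.homothety_continuous z t)
  have h5 : M ^ 2 / 4 * volume.real K' ≤ ∫ y in tet v, p y ^ 2 := by
    calc M ^ 2 / 4 * volume.real K' = ∫ y in K', M ^ 2 / 4 := by simp [mul_comm]
      _ ≤ ∫ y in K', p y ^ 2 := by
          apply setIntegral_mono_on
          · exact (continuous_const.continuousOn).integrableOn_compact hK'c
          · exact hint.mono_set hsub
          · exact hK'c.measurableSet
          · exact hlow
      _ ≤ _ := setIntegral_mono_set hint (Filter.Eventually.of_forall fun y => sq_nonneg _)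
          (Filter.Eventually.of_forall hsub)
  have h6 : p x ^ 2 ≤ M ^ 2 := by rw [← sq_abs]; gcongr; exact hzm' x hx
  calc p x ^ 2 * volume.real (tet v) ≤ M ^ 2 * volume.real (tet v) := by gcongr
    _ = (32 * (Ci r c + 1) ^ 3) * (M ^ 2 / 4 * volume.real K') := by
        rw [hvol, ht]; field_simp; ring
    _ ≤ _ := by gcongr

theorem grad_norm_sq (f : E3 → ℝ) (x : E3) :
    ‖gradient f x‖ ^ 2 = ∑ j, (fderiv ℝ f x (EuclideanSpace.single j 1)) ^ 2 := by
  rw [EuclideanSpace.norm_sq_eq]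
  apply Finset.sum_congr rfl
  intro j _
  rw [← grad_inner, Real.norm_eq_abs, sq_abs, EuclideanSpace.inner_single_right]
  simp

theorem grad_cont {r : ℕ} {p : E3 → ℝ} (hp : p ∈ PP r) : Continuous (gradient p) := by
  have := ((PP_deriv r p hp).1.continuous_fderiv one_ne_zero)
  exact (LinearIsometryEquiv.continuous _).comp this

theorem sup_avg_grad (r : ℕ) (hr : 1 ≤ r) {h c : ℝ} (hh : 0 < h) (hc : 0 < c) {v : Fin 4 → E3} (H : Elt h c v)
    {p : E3 → ℝ} (hp : p ∈ PP r) {x : E3} (hx : x ∈ tet v) :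
    ‖gradient p x‖ ^ 2 * volume.real (tet v) ≤ (32 * (Ci r c + 1) ^ 3) * ∫ y in tet v, ‖gradient p y‖ ^ 2 := by
  have h1 := fun j => sup_avg r hr hh hc H ((PP_deriv r p hp).2 (EuclideanSpace.single j 1)) hx
  simp_rw [grad_norm_sq]
  rw [integral_finsetSum, Finset.sum_mul, Finset.mul_sum]
  · exact Finset.sum_le_sum fun j _ => h1 j
  · intro j _
    exact (((PP_diff ((PP_deriv r p hp).2 (EuclideanSpace.single j 1))).continuous).pow 2).continuousOn.integrableOn_compact (tet_compact v)

theorem bern_grad_lin (r : ℕ) (v : Fin 4 → E3) (C1 C2 : (Fin r → Fin 4) → ℝ) (t : ℝ) (x : E3) :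
    gradient (bern r v (fun ω => C1 ω + t * C2 ω)) x = gradient (bern r v C1) x + t • gradient (bern r v C2) x := by
  have h1 : bern r v (fun ω => C1 ω + t * C2 ω) = fun y => bern r v C1 y + t * bern r v C2 y := by
    ext y
    simp only [bern, add_mul, Finset.sum_add_distrib, Finset.mul_sum, mul_assoc]
  have hd1 := PP_diff (bern_PP r v C1) x
  have hd2 := PP_diff (bern_PP r v C2) x
  rw [h1]
  apply ext_inner_right ℝ
  intro e
  rw [inner_add_left, inner_smul_left, grad_inner, grad_inner, grad_inner]
  rw [fderiv_fun_add hd1 (hd2.const_mul t), fderiv_const_mul hd2]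
  simp

/-- gradient of barycentric coordinate -/
def glam (v : Fin 4 → E3) (a : Fin 4) : E3 := gradient (lam v a) 0

theorem glam_inner (v : Fin 4 → E3) (a : Fin 4) (e : E3) : ⟪glam v a, e⟫ = (lam v a).linear e := by
  rw [glam, grad_inner, (aff_hasFDerivAt (lam v a) 0).fderiv]; simp

theorem glam_norm {h c : ℝ} (hh : 0 < h) (hc : 0 < c) {v : Fin 4 → E3} (H : Elt h c v) (a : Fin 4) :
    ‖glam v a‖ ≤ 1 / (c * h) := by
  apply grad_norm_le
  · positivity
  · intro e
    rw [(aff_hasFDerivAt (lam v a) 0).fderiv]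
    refine (lam_lin hh hc H a e).trans (le_of_eq ?_); ring

theorem bern_first_grad (r : ℕ) (hr : 0 < r) {v : Fin 4 → E3} (hv : AffineIndependent ℝ v) (φ : Fin 4 → ℝ) (x : E3) :
    gradient (bern r v (fun ω => φ (ω ⟨0, hr⟩))) x = ∑ a, φ a • glam v a := by
  have : bern r v (fun ω => φ (ω ⟨0, hr⟩)) = fun x => ∑ a, φ a * lam v a x := by
    ext x; exact bern_first r hr hv φ x
  rw [this]
  apply ext_inner_right ℝ
  intro e
  rw [grad_inner, sum_inner]
  have h1 : HasFDerivAt (fun x => ∑ a, φ a * lam v a x) (∑ a, φ a • (lam v a).linear.toContinuousLinearMap) x :=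
    HasFDerivAt.fun_sum fun a _ => (aff_hasFDerivAt (lam v a) x).const_mul (φ a)
  rw [h1.fderiv]
  simp [inner_smul_left, glam_inner]

theorem glam_sum {v : Fin 4 → E3} (hv : AffineIndependent ℝ v) : ∑ a, glam v a = 0 := by
  apply ext_inner_right ℝ
  intro e
  rw [sum_inner]
  simp_rw [glam_inner]
  have h1 := lam_sum hv (0 + e)
  have h2 := lam_sum hv 0
  simp_rw [aff_apply, Finset.sum_add_distrib] at h1
  simp; linarith

theorem glam_repr {v : Fin 4 → E3} (hv : AffineIndependent ℝ v) (G x : E3) :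
    ∑ a, ⟪G, v a - x⟫ • glam v a = G := by
  apply ext_inner_right ℝ
  intro e
  rw [sum_inner]
  simp_rw [inner_smul_left, glam_inner]
  have h0 : ∑ a, (lam v a).linear e = 0 := by
    have := congrArg (fun z => ⟪z, e⟫) (glam_sum hv)
    simpa [sum_inner, glam_inner] using this
  have h1 : ∑ a, (lam v a).linear e • v a = e := by
    have h1 := lam_comb hv (0 + e)
    have h2 := lam_comb hv 0
    simp_rw [aff_apply, add_smul, Finset.sum_add_distrib] at h1
    rw [h2] at h1; simpa using h1
  have h2 : ∑ a, (lam v a).linear e • (v a - x) = e := by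
    simp_rw [smul_sub, Finset.sum_sub_distrib, h1, ← Finset.sum_smul, h0]; simp
  conv_rhs => rw [← h2]
  rw [inner_sum]
  apply Finset.sum_congr rfl
  intro a _
  rw [inner_smul_right]; simp [mul_comm]

/-- key local superapproximation -/
theorem key_local (r : ℕ) (hr : 1 ≤ r) {h c : ℝ} (hh : 0 < h) (hc : 0 < c) {v : Fin 4 → E3} (H : Elt h c v)
    {p : E3 → ℝ} (hp : p ∈ PP r) (φ : Fin 4 → ℝ) (o m : ℝ) {x : E3} (hx : x ∈ tet v)
    (ho : ∀ a, |φ a - ∑ b, φ b * lam v b x| ≤ o) (hm : ∀ y ∈ tet v, ‖gradient p y‖ ≤ m) :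
    ‖gradient (bern r v (fun ω => cf r p (v ∘ ω) * φ (ω ⟨0, hr⟩))) x
      - (∑ b, φ b * lam v b x) • gradient p x - p x • ∑ a, φ a • glam v a‖ ≤ Ci r c * o * m := by
  set φ1 := ∑ b, φ b * lam v b x with hφ1
  have hm0 : 0 ≤ m := (norm_nonneg _).trans (hm x hx)
  have ho0 : 0 ≤ o := (abs_nonneg _).trans (ho 0)
  have hcf : ∀ ω : Fin r → Fin 4, |cf r p (v ∘ ω) - p x| ≤ CR r * (m * h) := by
    intro ω
    have h1 : cf r (p - fun _ => p x) (v ∘ ω) = cf r p (v ∘ ω) - p x := by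
      rw [cf_sub, cf_const r hr]
    rw [← h1]
    apply cf_bound r hr
    intro y hy
    have hy' := sub_hull r v ω hy
    refine (mean_val hp (tet_convex v) m hm hx hy').trans ?_
    exact mul_le_mul_of_nonneg_left (tet_dist H hy' hx) hm0
  -- R as Bernstein form
  have hR := bern_grad r hh hc H (fun ω => (cf r p (v ∘ ω) - p x) * (φ (ω ⟨0, hr⟩) - φ1)) (CR r * (m * h) * o)
    (by have := CR_nonneg r; positivity)
    (fun ω => by rw [abs_mul]; exact mul_le_mul (hcf ω) (ho _) (abs_nonneg _) (by have := CR_nonneg r; positivity)) hx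
  have e1 : gradient (bern r v (fun ω => cf r p (v ∘ ω) * φ (ω ⟨0, hr⟩))) x
      = gradient (bern r v (fun ω => (cf r p (v ∘ ω) - p x) * (φ (ω ⟨0, hr⟩) - φ1))) x
        + φ1 • gradient p x + p x • ∑ a, φ a • glam v a := by
    have e2 : (fun ω : Fin r → Fin 4 => cf r p (v ∘ ω) * φ (ω ⟨0, hr⟩))
      = fun ω => (fun ω => (fun ω => (cf r p (v ∘ ω) - p x) * (φ (ω ⟨0, hr⟩) - φ1)) ω + φ1 * ((fun ω => cf r p (v ∘ ω) + (-p x) * (fun _ => 1) ω) ω)) ω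
          + p x * (fun ω => φ (ω ⟨0, hr⟩)) ω := by
      ext ω; ring
    rw [e2, bern_grad_lin, bern_grad_lin, bern_grad_lin, bern_first_grad r hr H.1, ← PP_bern r hr H.1 p hp]
    have : gradient (bern r v (fun _ => 1)) x = 0 := by
      have h1 : bern r v (fun _ => 1) = fun _ => 1 := by ext y; exact bern_const r H.1 1 y
      rw [h1]; simp [gradient]
    rw [this]; simp
  have e3 : gradient (bern r v (fun ω => cf r p (v ∘ ω) * φ (ω ⟨0, hr⟩))) x
      - φ1 • gradient p x - p x • ∑ a, φ a • glam v a = gradient (bern r v (fun ω => (cf r p (v ∘ ω) - p x) * (φ (ω ⟨0, hr⟩) - φ1))) x := by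
    rw [e1]; abel
  rw [e3]
  refine hR.trans (le_of_eq ?_)
  rw [Ci]; field_simp

open Classical in
/-- global finite element function from coefficients -/
def glob (r : ℕ) (T : Finset (Fin 4 → E3)) (Cf : (Fin r → E3) → ℝ) (x : E3) : ℝ :=
  if H : ∃ v ∈ T, x ∈ tet v then bern r H.choose (fun ω => Cf (H.choose ∘ ω)) x else 0

/-- weight of a point -/
def tau (v : Fin 4 → E3) (x p : E3) : ℝ := ∑ a, (if v a = p then (1 : ℝ) else 0) * lam v a x

theorem bern_tau (r : ℕ) (v : Fin 4 → E3) (Cf : (Fin r → E3) → ℝ) (x : E3) (F : Finset E3) (hF : ∀ a, v a ∈ F) :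
    bern r v (fun ω => Cf (v ∘ ω)) x = ∑ P ∈ Fintype.piFinset (fun _ : Fin r => F), Cf P * ∏ k, tau v x (P k) := by
  have h1 : ∀ P : Fin r → E3, ∏ k, tau v x (P k) = ∑ ω : Fin r → Fin 4, (if v ∘ ω = P then 1 else 0) * ∏ k, lam v (ω k) x := by
    intro P
    unfold tau
    rw [← prod_lam_sum r v x (fun k a => if v a = P k then 1 else 0)]
    apply Finset.sum_congr rfl
    intro ω _
    congr 1
    rw [Finset.prod_ite_zero]
    simp [funext_iff]
  simp_rw [h1, Finset.mul_sum]
  rw [Finset.sum_comm, bern]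
  apply Finset.sum_congr rfl
  intro ω _
  rw [Finset.sum_eq_single (v ∘ ω)]
  · simp
  · intro P _ hP; simp [hP.symm]
  · intro h; exact absurd (Fintype.mem_piFinset.2 fun k => hF (ω k)) h

theorem tau_vertex {v : Fin 4 → E3} (hv : AffineIndependent ℝ v) (a : Fin 4) (p : E3) :
    tau v (v a) p = if v a = p then 1 else 0 := by
  simp [tau, lam_vertex hv]

theorem tau_convex (v w : Fin 4 → E3) (p : E3) : Convex ℝ {x | tau v x p = tau w x p} := by
  intro x hx y hy s t hs ht hst
  have h : ∀ v : Fin 4 → E3, tau v (s • x + t • y) p = s * tau v x p + t * tau v y p := by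
    intro v
    simp only [tau]
    rw [Finset.mul_sum, Finset.mul_sum, ← Finset.sum_add_distrib]
    apply Finset.sum_congr rfl
    intro a _
    have := aff_centroid (lam v a) (Finset.univ : Finset (Fin 2)) ![s, t] ![x, y] (by simpa using hst)
    simp at this
    rw [this]; ring
  simp only [Set.mem_ofPred_eq] at *
  rw [h, h, hx, hy]

theorem bern_agree (r : ℕ) {Ω : Set E3} {T : Finset (Fin 4 → E3)} {h c : ℝ} (hP : IsTetPartition Ω T h c)
    (hinj : Set.InjOn tet (T : Set (Fin 4 → E3))) (Cf : (Fin r → E3) → ℝ) {v w : Fin 4 → E3} (hv : v ∈ T) (hw : w ∈ T)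
    {x : E3} (hxv : x ∈ tet v) (hxw : x ∈ tet w) :
    bern r v (fun ω => Cf (v ∘ ω)) x = bern r w (fun ω => Cf (w ∘ ω)) x := by
  by_cases hvw : tet v = tet w
  · rw [hinj hv hw hvw]
  have hx : x ∈ convexHull ℝ (Set.range v ∩ Set.range w) := by
    rcases hP.2.2.2.1 v hv w hw hvw with h0 | h0
    · have hh : x ∈ tet v ∩ tet w := ⟨hxv, hxw⟩
      rw [h0] at hh; exact absurd hh (Set.notMem_empty _)
    · rw [← h0]; exact ⟨hxv, hxw⟩
  have htau : ∀ p, tau v x p = tau w x p := by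
    intro p
    have : convexHull ℝ (Set.range v ∩ Set.range w) ⊆ {x | tau v x p = tau w x p} := by
      apply convexHull_min _ (tau_convex v w p)
      rintro z ⟨⟨a, rfl⟩, ⟨b, hb⟩⟩
      simp only [Set.mem_ofPred_eq]
      rw [tau_vertex (hP.1 v hv), ← hb, tau_vertex (hP.1 w hw)]
    exact this hx
  classical
  rw [bern_tau r v Cf x (Finset.univ.image v ∪ Finset.univ.image w) (by intro a; simp),
    bern_tau r w Cf x (Finset.univ.image v ∪ Finset.univ.image w) (by intro a; simp)]
  simp_rw [htau]

theorem glob_eq (r : ℕ) {Ω : Set E3} {T : Finset (Fin 4 → E3)} {h c : ℝ} (hP : IsTetPartition Ω T h c)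
    (hinj : Set.InjOn tet (T : Set (Fin 4 → E3))) (Cf : (Fin r → E3) → ℝ) {v : Fin 4 → E3} (hv : v ∈ T)
    {x : E3} (hxv : x ∈ tet v) : glob r T Cf x = bern r v (fun ω => Cf (v ∘ ω)) x := by
  have H : ∃ v ∈ T, x ∈ tet v := ⟨v, hv, hxv⟩
  rw [glob, dif_pos H]
  exact bern_agree r hP hinj Cf H.choose_spec.1 hv H.choose_spec.2 hxv

theorem tet_sub {Ω : Set E3} {T : Finset (Fin 4 → E3)} {h c : ℝ} (hP : IsTetPartition Ω T h c) {v} (hv : v ∈ T) :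
    tet v ⊆ closure Ω := by
  rw [← hP.2.1]; exact Set.subset_biUnion_of_mem (u := tet) hv

theorem cont_of_tets {Ω : Set E3} {T : Finset (Fin 4 → E3)} {h c : ℝ} (hP : IsTetPartition Ω T h c) (f : E3 → ℝ)
    (hf : ∀ v ∈ T, ContinuousOn f (tet v)) : ContinuousOn f (closure Ω) := by
  have h1 : (⋃ v : T, tet v.1) = closure Ω := by
    rw [← hP.2.1]; ext x; simp
  rw [← h1]
  exact (locallyFinite_of_finite _).continuousOn_iUnion (fun v => (tet_compact v.1).isClosed) (fun v => hf v.1 v.2)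

theorem glob_MemSh (r : ℕ) {Ω : Set E3} {T : Finset (Fin 4 → E3)} {h c : ℝ} (hP : IsTetPartition Ω T h c)
    (hinj : Set.InjOn tet (T : Set (Fin 4 → E3))) (Cf : (Fin r → E3) → ℝ) : MemSh Ω T r (glob r T Cf) := by
  constructor
  · apply cont_of_tets hP
    intro v hv
    apply (PP_diff (bern_PP r v (fun ω => Cf (v ∘ ω)))).continuous.continuousOn.congr
    intro x hx
    exact glob_eq r hP hinj Cf hv hx
  · intro v hv
    obtain ⟨p, hp, hp'⟩ := mv_of_PP r _ (bern_PP r v (fun ω => Cf (v ∘ ω)))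
    exact ⟨p, hp, fun x hx => by rw [glob_eq r hP hinj Cf hv hx, hp']⟩

/-- faces of frontier points lie in the frontier -/
theorem face_frontier (r : ℕ) {Ω : Set E3} (hO : IsOpen Ω) (hC : Convex ℝ Ω) {v : Fin 4 → E3} (hv : AffineIndependent ℝ v)
    (hsub : tet v ⊆ closure Ω) {x : E3} (hx : x ∈ tet v) (hxf : x ∈ frontier Ω) (ω : Fin r → Fin 4)
    (hω : ∏ k, lam v (ω k) x ≠ 0) : convexHull ℝ (Set.range (v ∘ ω)) ⊆ frontier Ω := by
  have hxO : x ∉ Ω := fun h => by rw [hO.frontier_eq] at hxf; exact hxf.2 h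
  obtain ⟨f, hf⟩ := geometric_hahn_banach_open_point hC hO hxO
  have hcl : ∀ y ∈ closure Ω, f y ≤ f x := by
    intro y hy
    exact closure_minimal (fun z hz => (hf z hz).le) (isClosed_le f.continuous continuous_const) hy
  have h0 := (mem_tet_iff hv x).1 hx
  have heq : ∀ a, lam v a x ≠ 0 → f (v a) = f x := by
    have h1 : ∑ a, lam v a x * (f x - f (v a)) = 0 := by
      simp_rw [mul_sub, Finset.sum_sub_distrib, ← Finset.sum_mul, lam_sum hv]
      have : f (∑ a, lam v a x • v a) = ∑ a, lam v a x * f (v a) := by simp [map_sum]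
      rw [← this, lam_comb hv]; ring
    have h2 := (Finset.sum_eq_zero_iff_of_nonneg (fun a _ => mul_nonneg (h0 a) (sub_nonneg.2 (hcl _ (hsub (vert_mem v a)))))).1 h1
    intro a ha
    have := h2 a (Finset.mem_univ _)
    rcases mul_eq_zero.1 this with h3 | h3
    · exact absurd h3 ha
    · linarith
  have hconv : convexHull ℝ (Set.range (v ∘ ω)) ⊆ {y | f y = f x} := by
    apply convexHull_min
    · rintro _ ⟨k, rfl⟩
      exact heq _ (Finset.prod_ne_zero_iff.1 hω k (Finset.mem_univ _))
    · exact convex_hyperplane (LinearMap.isLinear f.toLinearMap) _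
  intro y hy
  rw [hO.frontier_eq]
  refine ⟨hsub (sub_hull r v ω hy), fun hyO => ?_⟩
  have h1 := hf y hyO
  have h2 : f y = f x := hconv hy
  linarith

/-- finite element set-up -/
theorem fe_setup (r : ℕ) (hr : 1 ≤ r) {Ω : Set E3} (hO : IsOpen Ω) (hC : Convex ℝ Ω) {T : Finset (Fin 4 → E3)} {h c : ℝ}
    (hh : 0 < h) (hc : 0 < c) (hP : IsTetPartition Ω T h c)
    (hinj : Set.InjOn tet (T : Set (Fin 4 → E3))) (u : E3 → ℝ) (hu : MemSh Ω T r u) (δ : ℝ) (hδ0 : 0 ≤ δ)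
    (hδ : ∀ x ∈ frontier Ω, |u x| ≤ δ) (φ : E3 → ℝ) :
    ∃ w χ : E3 → ℝ, MemSh0 Ω T r χ ∧ ContinuousOn w (closure Ω) ∧ (∀ x ∈ frontier Ω, w x = 0) ∧
      (∀ x ∈ closure Ω, |u x - w x| ≤ CR r * δ) ∧
      ∀ v ∈ T, ∃ pu ∈ PP r, ∃ pw ∈ PP r, (∀ x ∈ tet v, u x = pu x) ∧ (∀ x ∈ tet v, w x = pw x) ∧
        (∀ x ∈ tet v, χ x = bern r v (fun ω => cf r pw (v ∘ ω) * φ (v (ω ⟨0, hr⟩))) x) ∧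
        (∀ x ∈ tet v, ‖gradient (fun y => pu y - pw y) x‖ ≤ Ci r c * δ / h) ∧
        ((∃ a, v a ∈ frontier Ω) ∨ pu = pw) := by
  classical
  set B : (Fin r → E3) → Prop := fun a => convexHull ℝ (Set.range a) ⊆ frontier Ω with hB
  set Cw : (Fin r → E3) → ℝ := fun a => if B a then cf r u a else 0 with hCw
  have hCwb : ∀ a, |Cw a| ≤ CR r * δ := by
    intro a
    simp only [hCw]
    split_ifs with hb
    · exact cf_bound r hr u a δ (fun x hx => hδ x (hb hx))
    · simpa using mul_nonneg (CR_nonneg r) hδ0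
  set w : E3 → ℝ := fun x => u x - glob r T Cw x with hw
  have hPP : ∀ v ∈ T, ∃ pu ∈ PP r, ∀ x ∈ tet v, u x = pu x := by
    intro v hv
    obtain ⟨p, hp, hp'⟩ := hu.2 v hv
    exact ⟨_, PP_of_mv r p hp, hp'⟩
  have hfr : ∀ x ∈ frontier Ω, ∃ v ∈ T, x ∈ tet v := by
    intro x hx
    have : x ∈ ⋃ v ∈ T, tet v := by rw [hP.2.1]; exact hx.1
    simpa using this
  have hw0 : ∀ x ∈ frontier Ω, w x = 0 := by
    intro x hx
    obtain ⟨v, hv, hxv⟩ := hfr x hx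
    obtain ⟨pu, hpu, hpu'⟩ := hPP v hv
    simp only [hw]
    rw [glob_eq r hP hinj Cw hv hxv, hpu' x hxv, PP_bern r hr (hP.1 v hv) pu hpu, bern, bern,
      ← Finset.sum_sub_distrib]
    apply Finset.sum_eq_zero
    intro ω _
    by_cases h0 : ∏ k, lam v (ω k) x = 0
    · rw [h0]; ring
    · have hb : B (v ∘ ω) := face_frontier r hO hC (hP.1 v hv) (tet_sub hP hv) hxv hx ω h0
      simp only [hCw, hb, if_true]
      rw [cf_congr r hr u pu (v ∘ ω) (fun y hy => hpu' y (sub_hull r v ω hy))]; ring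
  set Cx : (Fin r → E3) → ℝ := fun a => cf r w a * φ (a ⟨0, hr⟩) with hCx
  refine ⟨w, glob r T Cx, ⟨glob_MemSh r hP hinj Cx, ?_⟩, hu.1.sub (glob_MemSh r hP hinj Cw).1, hw0, ?_, ?_⟩
  · intro x hx
    obtain ⟨v, hv, hxv⟩ := hfr x hx
    rw [glob_eq r hP hinj Cx hv hxv, bern]
    apply Finset.sum_eq_zero
    intro ω _
    by_cases h0 : ∏ k, lam v (ω k) x = 0
    · rw [h0]; ring
    · have hb : B (v ∘ ω) := face_frontier r hO hC (hP.1 v hv) (tet_sub hP hv) hxv hx ω h0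
      have : cf r w (v ∘ ω) = 0 := by
        rw [cf_congr r hr w (fun _ => 0) (v ∘ ω) (fun y hy => hw0 y (hb hy)), cf_const r hr]
      simp [hCx, this]
  · intro x hx
    rw [← hP.2.1] at hx
    simp only [mem_iUnion] at hx
    obtain ⟨v, hv, hxv⟩ := hx
    simp only [hw, sub_sub_cancel]
    rw [glob_eq r hP hinj Cw hv hxv]
    exact bern_bound r (hP.1 v hv) _ _ (fun ω => hCwb _) hxv
  · intro v hv
    obtain ⟨pu, hpu, hpu'⟩ := hPP v hv
    have hE : Elt h c v := ⟨hP.1 v hv, hP.2.2.2.2.1 v hv, hP.2.2.2.2.2 v hv⟩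
    set pb := bern r v (fun ω => Cw (v ∘ ω)) with hpb
    have hpw : ∀ x ∈ tet v, w x = (pu - pb) x := by
      intro x hx
      simp only [hw, Pi.sub_apply]
      rw [glob_eq r hP hinj Cw hv hx, hpu' x hx]
    refine ⟨pu, hpu, pu - pb, Submodule.sub_mem _ hpu (bern_PP r v _), hpu', hpw, ?_, ?_, ?_⟩
    · intro x hx
      rw [glob_eq r hP hinj Cx hv hx]
      congr 1
      ext ω
      simp only [hCx, Function.comp]
      congr 1
      exact cf_congr r hr _ _ _ (fun y hy => hpw y (sub_hull r v ω hy))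
    · intro x hx
      have : (fun y => pu y - (pu - pb) y) = pb := by ext y; simp
      rw [this]
      refine (bern_grad r hh hc hE _ (CR r * δ) (mul_nonneg (CR_nonneg r) hδ0) (fun ω => hCwb _) hx).trans (le_of_eq ?_)
      rw [Ci]; ring
    · by_cases hf : ∃ a, v a ∈ frontier Ω
      · exact Or.inl hf
      · right
        have : pb = 0 := by
          ext x
          simp only [hpb, bern, Pi.zero_apply]
          apply Finset.sum_eq_zero
          intro ω _
          have : ¬ B (v ∘ ω) := fun hb => hf ⟨ω ⟨0, hr⟩, hb (subset_convexHull ℝ _ ⟨⟨0, hr⟩, rfl⟩)⟩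
          simp [hCw, this]
        rw [this, sub_zero]

theorem glue_lip {ι : Type*} [Finite ι] (V : E3 → ℝ) (hV : Continuous V) (F : ι → Set E3) (hF : ∀ i, IsClosed (F i))
    (hcov : ∀ x, ∃ i, x ∈ F i) (L : ℝ≥0) (hL : ∀ i, LipschitzOnWith L V (F i)) : LipschitzWith L V := by
  apply LipschitzWith.of_dist_le_mul
  intro y x
  rw [dist_eq_norm, dist_eq_norm]
  set γ : ℝ → E3 := fun t => x + t • (y - x) with hγ
  have hγc : Continuous γ := by fun_prop
  set f : ℝ → ℝ := fun t => V (γ t) - V x with hf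
  have hfc : Continuous f := (hV.comp hγc).sub continuous_const
  have hdist : ∀ s t : ℝ, s ≤ t → dist (γ t) (γ s) = (t - s) * ‖y - x‖ := by
    intro s t hst
    rw [dist_eq_norm]
    have : γ t - γ s = (t - s) • (y - x) := by simp only [hγ]; module
    rw [this, norm_smul, Real.norm_of_nonneg (by linarith)]
  have key : ∀ ε > 0, ‖f 1‖ ≤ (L * ‖y - x‖ + ε) * 1 := by
    intro ε hε
    refine image_norm_le_of_liminf_right_slope_norm_lt_deriv_boundary (a := 0) (b := 1) (f' := fun _ => L * ‖y - x‖)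
      (B := fun t => (L * ‖y - x‖ + ε) * t) (B' := fun _ => L * ‖y - x‖ + ε) hfc.continuousOn ?_ ?_ (by fun_prop) ?_ ?_
      (x := 1) (by simp)
    · intro t _ r hr
      have h1 : ∃ i, ∃ᶠ z in nhdsWithin t (Ioi t), γ z ∈ F i := by
        by_contra hcon
        push Not at hcon
        have hcon' : ∀ i, ∀ᶠ z in nhdsWithin t (Ioi t), γ z ∉ F i := fun i => by
          have := hcon i
          simpa using this
        have h2 := Filter.eventually_all.2 hcon'
        obtain ⟨z, hz⟩ := h2.exists
        obtain ⟨i, hi⟩ := hcov (γ z)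
        exact hz i hi
      obtain ⟨i, hi⟩ := h1
      have ht : γ t ∈ F i :=
        (hF i).mem_of_frequently_of_tendsto hi ((hγc.tendsto t).mono_left nhdsWithin_le_nhds)
      refine (hi.and_eventually self_mem_nhdsWithin).mono ?_
      rintro z ⟨hz, hzt⟩
      have hzt' : t < z := hzt
      refine lt_of_le_of_lt ?_ hr
      rw [slope_def_field, div_le_iff₀ (by linarith)]
      have h3 := (hL i).dist_le_mul _ hz _ ht
      rw [hdist t z hzt'.le, Real.dist_eq] at h3
      have h4 : ‖f z‖ - ‖f t‖ ≤ ‖f z - f t‖ := norm_sub_norm_le _ _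
      have h5 : f z - f t = V (γ z) - V (γ t) := by simp only [hf]; ring
      rw [h5, Real.norm_eq_abs (V (γ z) - V (γ t))] at h4
      simp only [Function.comp]
      linarith
    · simp [hf, hγ]
    · intro t _
      simpa using ((hasDerivAt_id t).const_mul (L * ‖y - x‖ + ε)).hasDerivWithinAt
    · intro t _ _
      linarith
  have h1 : f 1 = V y - V x := by simp [hf, hγ]
  rw [← h1]
  apply le_of_forall_pos_le_add
  intro ε hε
  have := key ε hε
  linarith

theorem ae_int {Ω : Set E3} (hC : Convex ℝ Ω) (T : Finset (Fin 4 → E3)) :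
    ∀ᵐ x : E3, x ∉ frontier Ω ∧ ∀ v ∈ T, x ∉ frontier (tet v) := by
  have h1 : ∀ᵐ x : E3, x ∉ frontier Ω := measure_eq_zero_iff_ae_notMem.1 (hC.addHaar_frontier volume)
  have h2 : ∀ᵐ x : E3, ∀ v ∈ T, x ∉ frontier (tet v) := by
    rw [Filter.eventually_all_finset]
    intro v _
    exact measure_eq_zero_iff_ae_notMem.1 ((tet_convex v).addHaar_frontier volume)
  filter_upwards [h1, h2] with x a b using ⟨a, b⟩

theorem int_of_not_frontier {v : Fin 4 → E3} {x : E3} (hx : x ∈ tet v) (h : x ∉ frontier (tet v)) : x ∈ interior (tet v) := by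
  by_contra hcon
  exact h ⟨subset_closure hx, hcon⟩

theorem tet_aedisj {Ω : Set E3} {T : Finset (Fin 4 → E3)} {h c : ℝ} (hP : IsTetPartition Ω T h c)
    {v w : Fin 4 → E3} (hv : v ∈ T) (hw : w ∈ T) (hne : tet v ≠ tet w) : volume (tet v ∩ tet w) = 0 := by
  have h1 := hP.2.2.1 v hv w hw hne
  apply measure_mono_null (t := frontier (tet v) ∪ frontier (tet w))
  · rintro x ⟨hx1, hx2⟩
    by_contra hcon
    rw [Set.mem_union, not_or] at hcon
    have : x ∈ interior (tet v) ∩ interior (tet w) :=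
      ⟨int_of_not_frontier hx1 hcon.1, int_of_not_frontier hx2 hcon.2⟩
    rw [h1] at this; exact this
  · exact measure_union_null ((tet_convex v).addHaar_frontier volume) ((tet_convex w).addHaar_frontier volume)

theorem ae_closure {Ω : Set E3} (hO : IsOpen Ω) (hC : Convex ℝ Ω) : (Ω : Set E3) =ᵐ[volume] closure Ω := by
  have h0 : volume (frontier Ω) = 0 := hC.addHaar_frontier volume
  rw [hO.frontier_eq] at h0
  exact (ae_eq_set.2 ⟨by rw [Set.sdiff_eq_empty.2 subset_closure]; simp, h0⟩)

theorem integral_split {Ω : Set E3} (hO : IsOpen Ω) (hC : Convex ℝ Ω) {T : Finset (Fin 4 → E3)} {h c : ℝ} (hP : IsTetPartition Ω T h c)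
    (hinj : Set.InjOn tet (T : Set (Fin 4 → E3))) (F : E3 → ℝ) (hF : ∀ v ∈ T, IntegrableOn F (tet v)) :
    IntegrableOn F Ω ∧ ∫ x in Ω, F x = ∑ v ∈ T, ∫ x in tet v, F x := by
  have hcl : (⋃ v : T, tet v.1) = closure Ω := by
    rw [← hP.2.1]; ext x; simp
  have hint : IntegrableOn F (⋃ v : T, tet v.1) := by
    rw [integrableOn_finite_iUnion]
    exact fun v => hF v.1 v.2
  refine ⟨(hint.mono_set (by rw [hcl]; exact subset_closure)), ?_⟩
  have hd : Pairwise (Function.onFun (AEDisjoint volume) (fun v : T => tet v.1)) := by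
    intro v w hvw
    exact tet_aedisj hP v.2 w.2 (fun h => hvw (Subtype.ext (hinj v.2 w.2 h)))
  have hm : ∀ v : T, NullMeasurableSet (tet v.1) volume := fun v => (tet_compact v.1).measurableSet.nullMeasurableSet
  have h1 := integral_iUnion_ae (μ := volume) (f := F) hm hd hint
  rw [tsum_fintype] at h1
  rw [setIntegral_congr_set (ae_closure hO hC), ← hcl, h1]
  exact Finset.sum_coe_sort T (fun v => ∫ x in tet v, F x)

theorem grad_congr_int {v : Fin 4 → E3} {w p : E3 → ℝ} (hw : ∀ x ∈ tet v, w x = p x) {x : E3} (hx : x ∈ interior (tet v)) :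
    fderiv ℝ w x = fderiv ℝ p x ∧ gradient w x = gradient p x := by
  have h1 : w =ᶠ[nhds x] p := by
    filter_upwards [isOpen_interior.mem_nhds hx] with y hy using hw y (interior_subset hy)
  exact ⟨h1.fderiv_eq, by simp [gradient, h1.fderiv_eq]⟩

/-- integration by parts -/
theorem ibp (r : ℕ) {Ω : Set E3} (hO : IsOpen Ω) (hC : Convex ℝ Ω) (hB : Bornology.IsBounded Ω) {T : Finset (Fin 4 → E3)} {h c : ℝ}
    (hP : IsTetPartition Ω T h c) (w : E3 → ℝ) (hwc : ContinuousOn w (closure Ω)) (hw0 : ∀ x ∈ frontier Ω, w x = 0)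
    (hwp : ∀ v ∈ T, ∃ p ∈ PP r, ∀ x ∈ tet v, w x = p x) (g gd : E3 → ℝ) (K : ℝ≥0) (hg : LipschitzOnWith K g (closure Ω))
    (e : E3) (hgd : ∀ x ∈ Ω, HasLineDerivAt ℝ g (gd x) x e) :
    ∫ x in Ω, 2 * w x * fderiv ℝ w x e * g x = - ∫ x in Ω, gd x * w x ^ 2 := by
  classical
  set V : E3 → ℝ := (closure Ω).indicator (fun x => w x ^ 2) with hV
  have hV1 : ∀ x ∈ closure Ω, V x = w x ^ 2 := fun x hx => Set.indicator_of_mem hx _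
  have hV0 : ∀ x ∉ Ω, V x = 0 := by
    intro x hx
    by_cases hcl : x ∈ closure Ω
    · rw [hV1 x hcl, hw0 x (by rw [hO.frontier_eq]; exact ⟨hcl, hx⟩)]; simp
    · exact Set.indicator_of_notMem hcl _
  have hVc : Continuous V := by
    rw [← continuousOn_univ]
    have : (univ : Set E3) = closure Ω ∪ Ωᶜ := by
      symm; rw [Set.eq_univ_iff_forall]; intro x
      by_cases hx : x ∈ Ω
      · exact Or.inl (subset_closure hx)
      · exact Or.inr hx
    rw [this]
    apply ContinuousOn.union_of_isClosed _ _ isClosed_closure hO.isClosed_compl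
    · exact (hwc.pow 2).congr hV1
    · exact (continuousOn_const (c := (0:ℝ))).congr (fun x hx => hV0 x hx)
  have hlipT : ∀ v : T, ∃ L : ℝ≥0, LipschitzOnWith L V (tet v.1) := by
    intro v
    obtain ⟨p, hp, hp'⟩ := hwp v.1 v.2
    obtain ⟨L, hL⟩ := (((PP_deriv r p hp).1.pow 2).contDiffOn (s := tet v.1)).exists_lipschitzOnWith one_ne_zero (tet_convex v.1) (tet_compact v.1)
    refine ⟨L, fun x hx y hy => ?_⟩
    rw [hV1 x (tet_sub hP v.2 hx), hp' x hx, hV1 y (tet_sub hP v.2 hy), hp' y hy]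
    exact hL hx hy
  choose L hL using hlipT
  have hVlip : LipschitzWith (∑ v, L v) V := by
    apply glue_lip V hVc (fun i : Option T => i.elim Ωᶜ (fun v => tet v.1))
    · intro i
      cases i with
      | none => exact hO.isClosed_compl
      | some v => exact (tet_compact v.1).isClosed
    · intro x
      by_cases hx : x ∈ Ω
      · have : x ∈ ⋃ v ∈ T, tet v := by rw [hP.2.1]; exact subset_closure hx
        simp only [mem_iUnion] at this
        obtain ⟨v, hv, hxv⟩ := this
        exact ⟨some ⟨v, hv⟩, hxv⟩
      · exact ⟨none, hx⟩
    · intro i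
      cases i with
      | none =>
        apply LipschitzOnWith.of_dist_le_mul
        intro x hx y hy
        rw [hV0 x hx, hV0 y hy, dist_self]; positivity
      | some v => exact (hL v).weaken (Finset.single_le_sum (f := L) (fun _ _ => by positivity) (Finset.mem_univ v))
  have hVs : HasCompactSupport V := by
    apply HasCompactSupport.intro (K := closure Ω) hB.isCompact_closure
    intro x hx
    exact hV0 x (fun h => hx (subset_closure h))
  obtain ⟨g', hg', hgg'⟩ := hg.extend_real
  have main := hg'.integral_lineDeriv_mul_eq (μ := volume) hVlip hVs e
  have e1 : ∫ x, lineDeriv ℝ g' x e * V x = ∫ x in Ω, gd x * w x ^ 2 := by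
    rw [← integral_indicator hO.measurableSet]
    apply integral_congr_ae
    apply Filter.Eventually.of_forall
    intro x
    by_cases hx : x ∈ Ω
    · simp only [hx, Set.indicator_of_mem, hV1 x (subset_closure hx)]
      congr 1
      have h1 : HasLineDerivAt ℝ g' (gd x) x e := by
        apply (hgd x hx).congr_of_eventuallyEq
        filter_upwards [hO.mem_nhds hx] with y hy using (hgg' (subset_closure hy)).symm
      exact h1.lineDeriv
    · simp [hx, hV0 x hx]
  have e2 : ∫ x, lineDeriv ℝ V x (-e) * g' x = - ∫ x in Ω, 2 * w x * fderiv ℝ w x e * g x := by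
    rw [← integral_neg, ← integral_indicator hO.measurableSet]
    apply integral_congr_ae
    filter_upwards [ae_int hC T] with x hx
    by_cases hxO : x ∈ Ω
    · simp only [hxO, Set.indicator_of_mem, ← hgg' (subset_closure hxO)]
      have : x ∈ ⋃ v ∈ T, tet v := by rw [hP.2.1]; exact subset_closure hxO
      simp only [mem_iUnion] at this
      obtain ⟨v, hv, hxv⟩ := this
      obtain ⟨p, hp, hp'⟩ := hwp v hv
      have hxi := int_of_not_frontier hxv (hx.2 v hv)
      rw [(grad_congr_int hp' hxi).1, hp' x hxv]
      have h1 : HasLineDerivAt ℝ V (-(2 * p x * fderiv ℝ p x e)) x (-e) := by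
        have h2 : HasLineDerivAt ℝ (fun y => p y ^ 2) (-(2 * p x * fderiv ℝ p x e)) x (-e) := by
          have := (((PP_diff hp x).hasFDerivAt).pow 2).hasLineDerivAt (-e)
          have e3 : ((2 • p x ^ (2 - 1)) • fderiv ℝ p x) (-e) = -(2 * p x * fderiv ℝ p x e) := by
            simp [mul_assoc]
          rw [e3] at this
          exact this
        apply h2.congr_of_eventuallyEq
        filter_upwards [isOpen_interior.mem_nhds hxi] with y hy
        rw [hV1 y (tet_sub hP hv (interior_subset hy)), hp' y (interior_subset hy)]
      rw [h1.lineDeriv]; ring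
    · have hxc : x ∉ closure Ω := fun h => hx.1 (by rw [hO.frontier_eq]; exact ⟨h, hxO⟩)
      simp only [hxO, not_false_eq_true, Set.indicator_of_notMem]
      have h1 : HasLineDerivAt ℝ V 0 x (-e) := by
        have h2 : HasLineDerivAt ℝ (fun _ : E3 => (0:ℝ)) 0 x (-e) := by
          simpa using (hasFDerivAt_const (0:ℝ) x).hasLineDerivAt (-e)
        apply h2.congr_of_eventuallyEq
        filter_upwards [isClosed_closure.isOpen_compl.mem_nhds hxc] with y hy
        exact hV0 y (fun h => hy (subset_closure h))
      rw [h1.lineDeriv]; ring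
  rw [e1, e2] at main
  rw [main, neg_neg]

theorem pw1 {X Y : ℝ} (hY : 0 < Y) (hXY : Y ≤ X) {W : ℝ} (hW : W * X ^ 3 = X ^ 4 - Y ^ 4) :
    0 ≤ W ∧ W * X / 2 ≤ X ^ 2 - Y ^ 2 ∧ X ^ 2 - Y ^ 2 ≤ W * X ∧ W / 4 ≤ X - Y ∧ X - Y ≤ W ∧
    W * X ^ 4 ≤ X ^ 5 - Y ^ 5 ∧ X ^ 5 - Y ^ 5 ≤ 5 / 4 * (W * X ^ 4) ∧ X ^ 6 - Y ^ 6 ≤ 3 / 2 * (W * X ^ 5) ∧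
    X ^ 9 - Y ^ 9 ≤ 9 / 4 * (W * X ^ 8) ∧ W * X ^ 9 ≤ X ^ 10 - Y ^ 10 ∧ X ^ 10 - Y ^ 10 ≤ 5 / 2 * (W * X ^ 9) := by
  have hX : 0 < X := hY.trans_le hXY
  obtain ⟨u, hu⟩ : ∃ u, u = Y / X := ⟨_, rfl⟩
  have hYu : Y = u * X := by rw [hu]; field_simp
  have hu0 : 0 < u := by rw [hu]; positivity
  have hu1 : u ≤ 1 := by rw [hu, div_le_one hX]; exact hXY
  have hW' : W = X * (1 - u ^ 4) := by
    have h3 : X ^ 3 ≠ 0 := by positivity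
    apply mul_right_cancel₀ h3
    rw [hW, hYu]; ring
  subst hYu hW'
  have a1 : 0 ≤ 1 - u := by linarith
  have hu2 : u^2 ≤ 1 := by nlinarith
  have hu3 : u^3 ≤ 1 := pow_le_one₀ hu0.le hu1
  have hu4 : u^4 ≤ 1 := pow_le_one₀ hu0.le hu1
  have key : ∀ (k : ℕ) (P : ℝ), 0 ≤ P → 0 ≤ X ^ k * P := fun k P hP => by positivity
  have pu : ∀ k : ℕ, 0 ≤ u ^ k := fun k => by positivity
  refine ⟨by nlinarith, ?_, ?_, ?_, ?_, ?_, ?_, ?_, ?_, ?_, ?_⟩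
  · have := key 2 ((1-u^2) * (1-u^2)) (by nlinarith)
    linarith
  · have := key 2 (u^2 * (1-u^2)) (by apply mul_nonneg (pu 2); linarith)
    linarith
  · have := key 1 ((1-u) * ((1-u) + (1-u^2) + (1-u^3))) (by apply mul_nonneg a1; linarith)
    linarith
  · have := key 1 (u * (1-u^3)) (by apply mul_nonneg hu0.le; linarith)
    linarith
  · have := key 5 (u^4 * (1-u)) (mul_nonneg (pu 4) a1)
    linarith
  · have := key 5 ((1-u)^2 * (1+2*u+3*u^2+4*u^3)) (by positivity)
    linarith
  · have := key 6 ((1-u^2)^2 * (1+2*u^2)) (by positivity)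
    linarith
  · have := key 9 ((1-u)^2 * (5 + 10*u+15*u^2+20*u^3 + 16*u^4+12*u^5+8*u^6+4*u^7)) (by positivity)
    linarith
  · have := key 10 (u^4 * (1-u^6)) (mul_nonneg (pu 4) (by have := pow_le_one₀ (n := 6) hu0.le hu1; linarith))
    linarith
  · have := key 10 ((1-u^2)^2 * (3+6*u^2+4*u^4+2*u^6)) (by positivity)
    linarith

def wX (z : E3) (s : ℝ) (x : E3) : ℝ := (‖x - z‖ ^ 2 + s ^ 2) ^ (-(1/4) : ℝ)
def wU (z : E3) (s Z : ℝ) (x : E3) : ℝ := wX z s x ^ 2 + Z * wX z s x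
def wUg (z : E3) (s Z : ℝ) (x : E3) : E3 := (-(wX z s x ^ 6 + Z / 2 * wX z s x ^ 5)) • (x - z)
def wUh (z : E3) (s Z : ℝ) (x e : E3) : ℝ :=
  -(wX z s x ^ 6 + Z / 2 * wX z s x ^ 5) * ‖e‖ ^ 2 + (3 * wX z s x ^ 10 + 5 / 4 * Z * wX z s x ^ 9) * ⟪x - z, e⟫ ^ 2

theorem wq_pos (z : E3) {s : ℝ} (hs : 0 < s) (x : E3) : 0 < ‖x - z‖ ^ 2 + s ^ 2 := by positivity

theorem wX_pos (z : E3) {s : ℝ} (hs : 0 < s) (x : E3) : 0 < wX z s x := Real.rpow_pos_of_pos (wq_pos z hs x) _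

theorem wX_four (z : E3) {s : ℝ} (hs : 0 < s) (x : E3) : (‖x - z‖ ^ 2 + s ^ 2) * wX z s x ^ 4 = 1 := by
  have h := wq_pos z hs x
  have : wX z s x ^ 4 = (‖x - z‖ ^ 2 + s ^ 2)⁻¹ := by
    unfold wX
    rw [← Real.rpow_natCast, ← Real.rpow_mul h.le]
    norm_num [Real.rpow_neg_one]
  rw [this, mul_inv_cancel₀ h.ne']

theorem wX_deriv (z : E3) {s : ℝ} (hs : 0 < s) (x e : E3) (t : ℝ) :
    HasDerivAt (fun t : ℝ => wX z s (x + t • e)) (-(1/2) * wX z s (x + t • e) ^ 5 * ⟪x + t • e - z, e⟫) t := by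
  have hl : HasDerivAt (fun t : ℝ => x + t • e - z) e t := by
    simpa using (((hasDerivAt_id t).smul_const e).const_add x).sub_const z
  have hq : HasDerivAt (fun t : ℝ => ‖x + t • e - z‖ ^ 2 + s ^ 2) (2 * ⟪x + t • e - z, e⟫) t :=
    (hl.norm_sq).add_const _
  have h := wq_pos z hs (x + t • e)
  have h1 := hq.rpow_const (p := -(1/4)) (Or.inl h.ne')
  have h4 := wX_four z hs (x + t • e)
  have e1 : (‖x + t • e - z‖ ^ 2 + s ^ 2) ^ (-(1/4) - 1 : ℝ) = wX z s (x + t • e) ^ 5 := by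
    rw [Real.rpow_sub h, Real.rpow_one, div_eq_iff h.ne']
    change wX z s (x + t • e) = _
    linear_combination (- wX z s (x + t • e)) * h4
  rw [e1] at h1
  exact h1.congr_deriv (by ring)

theorem wU_deriv (z : E3) {s : ℝ} (hs : 0 < s) (Z : ℝ) (x e : E3) (t : ℝ) :
    HasDerivAt (fun t : ℝ => wU z s Z (x + t • e)) ⟪wUg z s Z (x + t • e), e⟫ t := by
  have h := wX_deriv z hs x e t
  have := (h.pow 2).add (h.const_mul Z)
  refine HasDerivAt.congr_deriv (f' := _) this ?_
  unfold wUg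
  rw [real_inner_smul_left]; push_cast; ring

theorem wU_deriv2 (z : E3) {s : ℝ} (hs : 0 < s) (Z : ℝ) (x e : E3) (t : ℝ) :
    HasDerivAt (fun t : ℝ => ⟪wUg z s Z (x + t • e), e⟫) (wUh z s Z (x + t • e) e) t := by
  have h := wX_deriv z hs x e t
  have hl : HasDerivAt (fun t : ℝ => ⟪x + t • e - z, e⟫) (‖e‖ ^ 2) t := by
    have hl : HasDerivAt (fun t : ℝ => x + t • e - z) e t := by
      simpa using (((hasDerivAt_id t).smul_const e).const_add x).sub_const z
    have := hl.inner ℝ (hasDerivAt_const t e)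
    simpa using this
  have := (((h.pow 6).add ((h.pow 5).const_mul (Z/2))).neg).mul hl
  unfold wUg wUh
  simp only [real_inner_smul_left]
  refine HasDerivAt.congr_deriv (f' := _) this ?_
  simp only [Pi.neg_apply, Pi.add_apply, Pi.pow_apply]
  push_cast; ring

theorem wX_contDiff (z : E3) {s : ℝ} (hs : 0 < s) : ContDiff ℝ 2 (wX z s) := by
  unfold wX
  apply ContDiff.rpow_const_of_ne
  · exact (((contDiff_id.sub contDiff_const).norm_sq ℝ)).add contDiff_const
  · intro x; exact (wq_pos z hs x).ne'

theorem wU_contDiff (z : E3) {s : ℝ} (hs : 0 < s) (Z : ℝ) : ContDiff ℝ 2 (wU z s Z) := by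
  have := wX_contDiff z hs
  unfold wU
  fun_prop

theorem wUg_contDiff (z : E3) {s : ℝ} (hs : 0 < s) (Z : ℝ) : ContDiff ℝ 2 (wUg z s Z) := by
  have := wX_contDiff z hs
  unfold wUg
  fun_prop

theorem wUh_cont (z : E3) {s : ℝ} (hs : 0 < s) (Z : ℝ) (e : E3) : Continuous (fun x => wUh z s Z x e) := by
  have := (wX_contDiff z hs).continuous
  unfold wUh
  fun_prop

def ej (j : Fin 3) : E3 := EuclideanSpace.single j 1

theorem ej_norm (j : Fin 3) : ‖ej j‖ = 1 := by simp [ej]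

theorem ej_sum (x : E3) : ∑ j, ⟪x, ej j⟫ ^ 2 = ‖x‖ ^ 2 := by
  rw [EuclideanSpace.norm_sq_eq]
  simp [ej, EuclideanSpace.inner_single_right]

theorem wU_lap (z : E3) {s : ℝ} (hs : 0 < s) (Z : ℝ) (x : E3) :
    ∑ j, wUh z s Z x (ej j) = - (Z / 4 * wX z s x ^ 5 + s ^ 2 * (3 * wX z s x ^ 10 + 5 / 4 * Z * wX z s x ^ 9)) := by
  unfold wUh
  rw [Finset.sum_add_distrib, ← Finset.mul_sum, ← Finset.mul_sum, ej_sum]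
  simp only [ej_norm]
  have h4 := wX_four z hs x
  simp only [Finset.sum_const, Finset.card_univ, Fintype.card_fin, one_pow, nsmul_eq_mul]
  push_cast
  linear_combination (3 * wX z s x ^ 6 + 5 / 4 * Z * wX z s x ^ 5) * h4

def wZ (D : ℝ) : ℝ := D ^ (-(1/2) : ℝ)
def wf (x0 n : E3) (D s : ℝ) (x : E3) : ℝ := wU x0 s (wZ D) x - wU (x0 + (2 * D) • n) s (wZ D) x
def wfg (x0 n : E3) (D s : ℝ) (x : E3) : E3 := wUg x0 s (wZ D) x - wUg (x0 + (2 * D) • n) s (wZ D) x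
def wfh (x0 n : E3) (D s : ℝ) (x e : E3) : ℝ := wUh x0 s (wZ D) x e - wUh (x0 + (2 * D) • n) s (wZ D) x e
def wl (x0 n : E3) (D : ℝ) (x : E3) : ℝ := D - ⟪n, x - x0⟫
def wγ (x0 n : E3) (D s : ℝ) (x : E3) : ℝ := wX x0 s x ^ 4 + wX (x0 + (2 * D) • n) s x ^ 2 / wl x0 n D x

theorem wZ_pos {D : ℝ} (hD : 0 < D) : 0 < wZ D := Real.rpow_pos_of_pos hD _
theorem wZ_two {D : ℝ} (hD : 0 < D) : D * wZ D ^ 2 = 1 := by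
  have : wZ D ^ 2 = D⁻¹ := by
    unfold wZ
    rw [← Real.rpow_natCast, ← Real.rpow_mul hD.le]
    norm_num [Real.rpow_neg_one]
  rw [this, mul_inv_cancel₀ hD.ne']

theorem wQ_eq (x0 n : E3) (hn : ‖n‖ = 1) (D : ℝ) (x : E3) :
    ‖x - (x0 + (2 * D) • n)‖ ^ 2 = ‖x - x0‖ ^ 2 + 4 * D * wl x0 n D x := by
  have : x - (x0 + (2 * D) • n) = (x - x0) - (2 * D) • n := by abel
  rw [this, norm_sub_sq_real, norm_smul, real_inner_smul_right, hn, real_inner_comm, wl, Real.norm_eq_abs, mul_one, sq_abs]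
  ring

theorem wQ_ge (x0 n : E3) (hn : ‖n‖ = 1) (D : ℝ) (x : E3) :
    (wl x0 n D x + D) ^ 2 ≤ ‖x - (x0 + (2 * D) • n)‖ ^ 2 := by
  have h1 : ⟪n, x - (x0 + (2 * D) • n)⟫ = -(wl x0 n D x + D) := by
    have : x - (x0 + (2 * D) • n) = (x - x0) - (2 * D) • n := by abel
    rw [this, inner_sub_right, real_inner_smul_right, real_inner_self_eq_norm_sq, hn, wl]; ring
  have h2 := abs_real_inner_le_norm n (x - (x0 + (2 * D) • n))
  rw [h1, hn, one_mul, abs_neg] at h2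
  exact sq_le_sq.2 (by rwa [abs_of_nonneg (norm_nonneg _)])

theorem wcore (x0 n : E3) (hn : ‖n‖ = 1) {D s : ℝ} (hs : 0 < s) (hD : s ≤ D) (x : E3) (hl : s ≤ wl x0 n D x)
    {X Y Z W ℓ : ℝ} (hX : X = wX x0 s x) (hY : Y = wX (x0 + (2 * D) • n) s x) (hZ : Z = wZ D) (hℓ : ℓ = wl x0 n D x)
    (hW : W = 4 * D * ℓ * X * Y ^ 4) :
    0 < X ∧ 0 < Y ∧ Y ≤ X ∧ 0 < Z ∧ Y ≤ Z ∧ 0 < W ∧ W * X ^ 3 = X ^ 4 - Y ^ 4 ∧ s ^ 2 * X ^ 4 ≤ 1 ∧ s * X ^ 2 ≤ 1 ∧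
    ‖x - x0‖ * X ^ 2 ≤ 1 ∧ ‖x - (x0 + (2 * D) • n)‖ * Y ^ 2 ≤ 1 := by
  have hDp : 0 < D := hs.trans_le hD
  have hlp : 0 < ℓ := by rw [hℓ]; exact hs.trans_le hl
  have hXp : 0 < X := hX ▸ wX_pos _ hs _
  have hYp : 0 < Y := hY ▸ wX_pos _ hs _
  have hZp : 0 < Z := hZ ▸ wZ_pos hDp
  have hX4 := wX_four x0 hs x
  have hY4 := wX_four (x0 + (2 * D) • n) hs x
  have hZ2 := wZ_two hDp
  have hQg := wQ_ge x0 n hn D x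
  rw [wQ_eq x0 n hn] at hY4 hQg
  rw [← hX] at hX4
  rw [← hY, ← hℓ] at hY4
  rw [← hℓ] at hQg
  rw [← hZ] at hZ2
  have hQ := wQ_eq x0 n hn D x
  rw [← hℓ] at hQ
  set q := ‖x - x0‖ ^ 2 with hq
  have hq0 : 0 ≤ q := by positivity
  have hV : X ^ 4 - Y ^ 4 = 4 * D * ℓ * X ^ 4 * Y ^ 4 := by
    linear_combination (Y^4) * hX4 - X^4 * hY4
  have hVp : 0 < 4 * D * ℓ * X ^ 4 * Y ^ 4 := by positivity
  have hYX : Y ≤ X := by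
    have : Y ^ 4 ≤ X ^ 4 := by linarith
    exact (pow_le_pow_iff_left₀ hYp.le hXp.le (by norm_num)).1 this
  have hYZ : Y ≤ Z := by
    have : Y ^ 4 ≤ Z ^ 4 := by
      have h1 : D ^ 2 * Z ^ 4 = 1 := by
        have : D ^ 2 * Z ^ 4 = (D * Z ^ 2) ^ 2 := by ring
        rw [this, hZ2, one_pow]
      have h2 : D ^ 2 ≤ q + 4 * D * ℓ + s ^ 2 := by nlinarith
      have h3 : D ^ 2 * Y ^ 4 ≤ D ^ 2 * Z ^ 4 := by
        rw [h1, ← hY4]; gcongr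
      exact le_of_mul_le_mul_left h3 (by positivity)
    exact (pow_le_pow_iff_left₀ hYp.le hZp.le (by norm_num)).1 this
  have hs4 : s ^ 2 * X ^ 4 ≤ 1 := by
    rw [← hX4]; gcongr; linarith
  have sq1 : ∀ a : ℝ, 0 ≤ a → a ^ 2 ≤ 1 → a ≤ 1 := fun a ha h => by nlinarith
  refine ⟨hXp, hYp, hYX, hZp, hYZ, by rw [hW]; positivity, by rw [hV, hW]; ring, hs4, ?_, ?_, ?_⟩
  · apply sq1 _ (by positivity); calc (s * X ^ 2) ^ 2 = s ^ 2 * X ^ 4 := by ring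
      _ ≤ 1 := hs4
  · apply sq1 _ (by positivity); calc (‖x - x0‖ * X ^ 2) ^ 2 = q * X ^ 4 := by rw [hq]; ring
      _ ≤ 1 := by rw [← hX4]; gcongr; nlinarith
  · apply sq1 _ (by positivity)
    calc (‖x - (x0 + (2 * D) • n)‖ * Y ^ 2) ^ 2 = ‖x - (x0 + (2 * D) • n)‖ ^ 2 * Y ^ 4 := by ring
      _ = (q + 4 * D * ℓ) * Y ^ 4 := by rw [hQ]
      _ ≤ 1 := by rw [← hY4]; exact mul_le_mul_of_nonneg_right (by nlinarith) (by positivity)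

theorem wf_deriv (x0 n : E3) {D s : ℝ} (hs : 0 < s) (x e : E3) (t : ℝ) :
    HasDerivAt (fun t : ℝ => wf x0 n D s (x + t • e)) ⟪wfg x0 n D s (x + t • e), e⟫ t := by
  refine ((wU_deriv x0 hs (wZ D) x e t).sub (wU_deriv (x0 + (2 * D) • n) hs (wZ D) x e t)).congr_deriv ?_
  rw [wfg, inner_sub_left]

theorem wf_deriv2 (x0 n : E3) {D s : ℝ} (hs : 0 < s) (x e : E3) (t : ℝ) :
    HasDerivAt (fun t : ℝ => ⟪wfg x0 n D s (x + t • e), e⟫) (wfh x0 n D s (x + t • e) e) t := by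
  have := (wU_deriv2 x0 hs (wZ D) x e t).sub (wU_deriv2 (x0 + (2 * D) • n) hs (wZ D) x e t)
  unfold wfg wfh
  simp only [inner_sub_left]
  exact this

theorem wf_bounds (x0 n : E3) (hn : ‖n‖ = 1) {D s : ℝ} (hs : 0 < s) (hD : s ≤ D) (x : E3) (hl : s ≤ wl x0 n D x)
    {X Y Z W ℓ : ℝ} (hX : X = wX x0 s x) (hY : Y = wX (x0 + (2 * D) • n) s x) (hZ : Z = wZ D) (hℓ : ℓ = wl x0 n D x)
    (hW : W = 4 * D * ℓ * X * Y ^ 4) :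
    W * (X + Z) ≤ 4 * wf x0 n D s x ∧ wf x0 n D s x ≤ W * (X + Z) := by
  obtain ⟨hXp, hYp, hYX, hZp, hYZ, hWp, hWX, -, -, -, -⟩ := wcore x0 n hn hs hD x hl hX hY hZ hℓ hW
  obtain ⟨-, a1, a2, a3, a4, -⟩ := pw1 hYp hYX hWX
  have hf : wf x0 n D s x = X ^ 2 - Y ^ 2 + Z * (X - Y) := by
    rw [wf, wU, wU, ← hX, ← hY, ← hZ]; ring
  rw [hf]
  have b1 := mul_le_mul_of_nonneg_left a3 hZp.le
  have b2 := mul_le_mul_of_nonneg_left a4 hZp.le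
  have : 0 < W * X := by positivity
  constructor <;> nlinarith

theorem wf_pos (x0 n : E3) (hn : ‖n‖ = 1) {D s : ℝ} (hs : 0 < s) (hD : s ≤ D) (x : E3) (hl : s ≤ wl x0 n D x) : 0 < wf x0 n D s x := by
  obtain ⟨hXp, hYp, hYX, hZp, hYZ, hWp, -⟩ := wcore x0 n hn hs hD x hl rfl rfl rfl rfl rfl
  have := (wf_bounds x0 n hn hs hD x hl rfl rfl rfl rfl rfl).1
  have h2 := mul_pos hWp (add_pos hXp hZp)
  linarith

theorem wfg_bound (x0 n : E3) (hn : ‖n‖ = 1) {D s : ℝ} (hs : 0 < s) (hD : s ≤ D) (x : E3) (hl : s ≤ wl x0 n D x) :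
    ‖wfg x0 n D s x‖ ≤ 8 / s * wf x0 n D s x := by
  obtain ⟨X, hX⟩ : ∃ X, X = wX x0 s x := ⟨_, rfl⟩
  obtain ⟨Y, hY⟩ : ∃ Y, Y = wX (x0 + (2 * D) • n) s x := ⟨_, rfl⟩
  obtain ⟨Z, hZ⟩ : ∃ Z, Z = wZ D := ⟨_, rfl⟩
  obtain ⟨ℓ, hℓ⟩ : ∃ ℓ, ℓ = wl x0 n D x := ⟨_, rfl⟩
  obtain ⟨W, hW⟩ : ∃ W, W = 4 * D * ℓ * X * Y ^ 4 := ⟨_, rfl⟩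
  obtain ⟨hXp, hYp, hYX, hZp, hYZ, hWp, hWX, hs4, hs2, hx2, hy2⟩ := wcore x0 n hn hs hD x hl hX hY hZ hℓ hW
  obtain ⟨-, -, -, -, -, -, b5, b6, -, -⟩ := pw1 hYp hYX hWX
  obtain ⟨f1, -⟩ := wf_bounds x0 n hn hs hD x hl hX hY hZ hℓ hW
  have hDp : 0 < D := hs.trans_le hD
  have hlp : s ≤ ℓ := by rw [hℓ]; exact hl
  have hl0 : 0 < ℓ := hs.trans_le hlp
  have hg : wfg x0 n D s x = (-((X ^ 6 - Y ^ 6) + Z / 2 * (X ^ 5 - Y ^ 5))) • (x - x0) - ((Y ^ 6 + Z / 2 * Y ^ 5) * (2 * D)) • n := by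
    rw [wfg, wUg, wUg, ← hX, ← hY, ← hZ]; module
  have h1 : ‖wfg x0 n D s x‖ ≤ ((X ^ 6 - Y ^ 6) + Z / 2 * (X ^ 5 - Y ^ 5)) * ‖x - x0‖ + (Y ^ 6 + Z / 2 * Y ^ 5) * (2 * D) := by
    rw [hg]
    refine (norm_sub_le _ _).trans ?_
    rw [norm_smul, norm_smul, hn, mul_one, norm_neg, Real.norm_of_nonneg, Real.norm_of_nonneg]
    · positivity
    · have := pow_le_pow_left₀ hYp.le hYX 6
      have := pow_le_pow_left₀ hYp.le hYX 5
      have : 0 ≤ Z / 2 * (X ^ 5 - Y ^ 5) := mul_nonneg (by positivity) (by linarith)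
      linarith
  have h2 : (X ^ 6 - Y ^ 6) + Z / 2 * (X ^ 5 - Y ^ 5) ≤ 3 / 2 * (W * (X + Z) * X ^ 4) := by
    have := mul_le_mul_of_nonneg_left b5 (a := Z / 2) (by positivity)
    have : 0 < Z * W * X ^ 4 := by positivity
    nlinarith
  have h3 : ((X ^ 6 - Y ^ 6) + Z / 2 * (X ^ 5 - Y ^ 5)) * ‖x - x0‖ * s ≤ 3 / 2 * (W * (X + Z)) := by
    calc _ ≤ 3 / 2 * (W * (X + Z) * X ^ 4) * ‖x - x0‖ * s := by gcongr
      _ = 3 / 2 * (W * (X + Z)) * (‖x - x0‖ * X ^ 2) * (s * X ^ 2) := by ring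
      _ ≤ 3 / 2 * (W * (X + Z)) * 1 * 1 := by gcongr
      _ = _ := by ring
  have h4 : (Y ^ 6 + Z / 2 * Y ^ 5) * (2 * D) * s ≤ 1 / 2 * (W * (X + Z)) := by
    have e1 : W * (X + Z) = 4 * D * ℓ * Y ^ 4 * (X ^ 2 + Z * X) := by rw [hW]; ring
    have e2 : (Y ^ 6 + Z / 2 * Y ^ 5) * (2 * D) * s = 1 / 2 * (4 * D * s * Y ^ 4 * (Y ^ 2 + Z / 2 * Y)) := by ring
    rw [e1, e2]
    gcongr
    linarith
  have h5 : ‖wfg x0 n D s x‖ * s ≤ 2 * (W * (X + Z)) := by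
    calc _ ≤ _ := mul_le_mul_of_nonneg_right h1 hs.le
      _ ≤ _ := by linarith
  rw [div_mul_eq_mul_div, le_div_iff₀ hs]
  linarith

theorem wγ_pos (x0 n : E3) (D : ℝ) {s : ℝ} (hs : 0 < s) (x : E3) (hl : s ≤ wl x0 n D x) : 0 < wγ x0 n D s x := by
  have h1 := wX_pos x0 hs x
  have h2 := wX_pos (x0 + (2 * D) • n) hs x
  have h3 : 0 < wl x0 n D x := hs.trans_le hl
  unfold wγ; positivity

set_option maxHeartbeats 800000 in
theorem wfh_bound (x0 n : E3) (hn : ‖n‖ = 1) {D s : ℝ} (hs : 0 < s) (hD : s ≤ D) (x : E3) (hl : s ≤ wl x0 n D x) (e : E3) :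
    |wfh x0 n D s x e| ≤ 36 * (wf x0 n D s x * wγ x0 n D s x * ‖e‖ ^ 2) := by
  obtain ⟨X, hX⟩ : ∃ X, X = wX x0 s x := ⟨_, rfl⟩
  obtain ⟨Y, hY⟩ : ∃ Y, Y = wX (x0 + (2 * D) • n) s x := ⟨_, rfl⟩
  obtain ⟨Z, hZ⟩ : ∃ Z, Z = wZ D := ⟨_, rfl⟩
  obtain ⟨ℓ, hℓ⟩ : ∃ ℓ, ℓ = wl x0 n D x := ⟨_, rfl⟩
  obtain ⟨W, hW⟩ : ∃ W, W = 4 * D * ℓ * X * Y ^ 4 := ⟨_, rfl⟩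
  obtain ⟨hXp, hYp, hYX, hZp, hYZ, hWp, hWX, hs4, hs2, hx2, hy2⟩ := wcore x0 n hn hs hD x hl hX hY hZ hℓ hW
  obtain ⟨-, -, -, -, -, -, b5, b6, b9, -, b10⟩ := pw1 hYp hYX hWX
  obtain ⟨f1, -⟩ := wf_bounds x0 n hn hs hD x hl hX hY hZ hℓ hW
  have hγp := wγ_pos x0 n D hs x hl
  have hγ : wγ x0 n D s x = X ^ 4 + Y ^ 2 / ℓ := by rw [wγ, hX, hY, hℓ]
  have hDp : 0 < D := hs.trans_le hD
  have hlp : s ≤ ℓ := by rw [hℓ]; exact hl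
  have hl0 : 0 < ℓ := hs.trans_le hlp
  set y := x - x0 with hy
  set y' := x - (x0 + (2 * D) • n) with hy'
  set E := ‖e‖ with hE
  have hE0 : 0 ≤ E := norm_nonneg _
  have hp6 : 0 ≤ X ^ 6 - Y ^ 6 := by have := pow_le_pow_left₀ hYp.le hYX 6; linarith
  have hp5 : 0 ≤ X ^ 5 - Y ^ 5 := by have := pow_le_pow_left₀ hYp.le hYX 5; linarith
  have hp10 : 0 ≤ X ^ 10 - Y ^ 10 := by have := pow_le_pow_left₀ hYp.le hYX 10; linarith
  have hp9 : 0 ≤ X ^ 9 - Y ^ 9 := by have := pow_le_pow_left₀ hYp.le hYX 9; linarith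
  have hdec : wfh x0 n D s x e = -((X ^ 6 - Y ^ 6) + Z / 2 * (X ^ 5 - Y ^ 5)) * E ^ 2
      + (3 * (X ^ 10 - Y ^ 10) + 5 / 4 * Z * (X ^ 9 - Y ^ 9)) * ⟪y, e⟫ ^ 2
      + (3 * Y ^ 10 + 5 / 4 * Z * Y ^ 9) * (⟪y, e⟫ ^ 2 - ⟪y', e⟫ ^ 2) := by
    rw [wfh, wUh, wUh, ← hX, ← hY, ← hZ]; ring
  have t1 : ((X ^ 6 - Y ^ 6) + Z / 2 * (X ^ 5 - Y ^ 5)) * E ^ 2 ≤ 3 / 2 * (W * (X + Z) * X ^ 4) * E ^ 2 := by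
    have := mul_le_mul_of_nonneg_left b5 (a := Z / 2) (by positivity)
    have : 0 < Z * W * X ^ 4 := by positivity
    apply mul_le_mul_of_nonneg_right _ (by positivity)
    linarith
  have hye : ⟪y, e⟫ ^ 2 * X ^ 4 ≤ E ^ 2 := by
    have h1 : ⟪y, e⟫ ^ 2 ≤ (‖y‖ * E) ^ 2 := sq_le_sq.2 (by rw [abs_of_nonneg (a := ‖y‖ * E) (by positivity)]; exact abs_real_inner_le_norm _ _)
    calc ⟪y, e⟫ ^ 2 * X ^ 4 ≤ (‖y‖ * E) ^ 2 * X ^ 4 := by gcongr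
      _ = (‖y‖ * X ^ 2) ^ 2 * E ^ 2 := by ring
      _ ≤ 1 ^ 2 * E ^ 2 := by gcongr
      _ = E ^ 2 := by ring
  have t2 : (3 * (X ^ 10 - Y ^ 10) + 5 / 4 * Z * (X ^ 9 - Y ^ 9)) * ⟪y, e⟫ ^ 2 ≤ 15 / 2 * (W * (X + Z) * X ^ 4) * E ^ 2 := by
    have h1 : 3 * (X ^ 10 - Y ^ 10) + 5 / 4 * Z * (X ^ 9 - Y ^ 9) ≤ 15 / 2 * (W * (X + Z) * X ^ 8) := by
      have := mul_le_mul_of_nonneg_left b9 (a := 5 / 4 * Z) (by positivity)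
      have : 0 < Z * W * X ^ 8 := by positivity
      linarith
    calc _ ≤ 15 / 2 * (W * (X + Z) * X ^ 8) * ⟪y, e⟫ ^ 2 := by gcongr
      _ = 15 / 2 * (W * (X + Z) * X ^ 4) * (⟪y, e⟫ ^ 2 * X ^ 4) := by ring
      _ ≤ _ := by gcongr
  have hdif : |⟪y, e⟫ ^ 2 - ⟪y', e⟫ ^ 2| * Y ^ 2 ≤ 4 * D * E ^ 2 := by
    have h1 : ⟪y, e⟫ ^ 2 - ⟪y', e⟫ ^ 2 = (2 * D * ⟪n, e⟫) * ⟪y + y', e⟫ := by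
      have : y' = y - (2 * D) • n := by rw [hy, hy']; abel
      rw [this, inner_add_left, inner_sub_left y, real_inner_smul_left]; ring
    have h2 : |⟪n, e⟫| ≤ E := by have := abs_real_inner_le_norm n e; rwa [hn, one_mul] at this
    have h3 : |⟪y + y', e⟫| * Y ^ 2 ≤ 2 * E := by
      calc _ ≤ ‖y + y'‖ * E * Y ^ 2 := by gcongr; exact abs_real_inner_le_norm _ _
        _ ≤ (‖y‖ + ‖y'‖) * E * Y ^ 2 := by gcongr; exact norm_add_le _ _
        _ = (‖y‖ * Y ^ 2 + ‖y'‖ * Y ^ 2) * E := by ring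
        _ ≤ (‖y‖ * X ^ 2 + 1) * E := by gcongr
        _ ≤ (1 + 1) * E := by gcongr
        _ = 2 * E := by ring
    rw [h1, abs_mul, abs_mul, abs_of_pos (show 0 < 2 * D by positivity)]
    calc 2 * D * |⟪n, e⟫| * |⟪y + y', e⟫| * Y ^ 2 = 2 * D * |⟪n, e⟫| * (|⟪y + y', e⟫| * Y ^ 2) := by ring
      _ ≤ 2 * D * E * (2 * E) := by gcongr
      _ = _ := by ring
  have t3 : (3 * Y ^ 10 + 5 / 4 * Z * Y ^ 9) * |⟪y, e⟫ ^ 2 - ⟪y', e⟫ ^ 2| ≤ 3 * (W * (X + Z) * (Y ^ 2 / ℓ)) * E ^ 2 := by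
    have e1 : 3 * (W * (X + Z) * (Y ^ 2 / ℓ)) * E ^ 2 = 3 * (4 * D * E ^ 2) * (X ^ 2 + Z * X) * Y ^ 6 := by
      rw [hW]; field_simp
    rw [e1]
    calc (3 * Y ^ 10 + 5 / 4 * Z * Y ^ 9) * |⟪y, e⟫ ^ 2 - ⟪y', e⟫ ^ 2|
        = (3 * Y ^ 2 + 5 / 4 * (Z * Y)) * Y ^ 6 * (|⟪y, e⟫ ^ 2 - ⟪y', e⟫ ^ 2| * Y ^ 2) := by ring
      _ ≤ (3 * X ^ 2 + 3 * (Z * X)) * Y ^ 6 * (4 * D * E ^ 2) := by gcongr; norm_num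
      _ = _ := by ring
  have a0 : 0 ≤ ((X ^ 6 - Y ^ 6) + Z / 2 * (X ^ 5 - Y ^ 5)) * E ^ 2 := by positivity
  have a1 : 0 ≤ (3 * (X ^ 10 - Y ^ 10) + 5 / 4 * Z * (X ^ 9 - Y ^ 9)) * ⟪y, e⟫ ^ 2 := by positivity
  have h1 : |wfh x0 n D s x e| ≤ 9 * (W * (X + Z)) * (X ^ 4 + Y ^ 2 / ℓ) * E ^ 2 := by
    have h2 : |wfh x0 n D s x e| ≤ ((X ^ 6 - Y ^ 6) + Z / 2 * (X ^ 5 - Y ^ 5)) * E ^ 2 + (3 * (X ^ 10 - Y ^ 10) + 5 / 4 * Z * (X ^ 9 - Y ^ 9)) * ⟪y, e⟫ ^ 2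
        + (3 * Y ^ 10 + 5 / 4 * Z * Y ^ 9) * |⟪y, e⟫ ^ 2 - ⟪y', e⟫ ^ 2| := by
      rw [hdec]
      refine (abs_add_le _ _).trans ?_
      rw [abs_mul (3 * Y ^ 10 + 5 / 4 * Z * Y ^ 9), abs_of_pos (show 0 < 3 * Y ^ 10 + 5 / 4 * Z * Y ^ 9 by positivity)]
      gcongr
      refine (abs_add_le _ _).trans ?_
      rw [neg_mul, abs_neg, abs_of_nonneg a0, abs_of_nonneg a1]
    have : 0 ≤ W * (X + Z) * (Y ^ 2 / ℓ) * E ^ 2 := by positivity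
    linarith
  rw [← hγ] at h1
  calc _ ≤ _ := h1
    _ = 9 * (W * (X + Z) * (wγ x0 n D s x * E ^ 2)) := by ring
    _ ≤ 9 * (4 * wf x0 n D s x * (wγ x0 n D s x * E ^ 2)) := by gcongr
    _ = _ := by ring

theorem wf_lap (x0 n : E3) (hn : ‖n‖ = 1) {D s : ℝ} (hs : 0 < s) (hD : s ≤ D) (x : E3) (hl : s ≤ wl x0 n D x) :
    s ^ 2 * wγ x0 n D s x ^ 2 * wf x0 n D s x ≤ 24 * (- ∑ j, wfh x0 n D s x (ej j)) := by
  obtain ⟨X, hX⟩ : ∃ X, X = wX x0 s x := ⟨_, rfl⟩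
  obtain ⟨Y, hY⟩ : ∃ Y, Y = wX (x0 + (2 * D) • n) s x := ⟨_, rfl⟩
  obtain ⟨Z, hZ⟩ : ∃ Z, Z = wZ D := ⟨_, rfl⟩
  obtain ⟨ℓ, hℓ⟩ : ∃ ℓ, ℓ = wl x0 n D x := ⟨_, rfl⟩
  obtain ⟨W, hW⟩ : ∃ W, W = 4 * D * ℓ * X * Y ^ 4 := ⟨_, rfl⟩
  obtain ⟨hXp, hYp, hYX, hZp, hYZ, hWp, hWX, hs4, hs2, hx2, hy2⟩ := wcore x0 n hn hs hD x hl hX hY hZ hℓ hW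
  obtain ⟨-, -, -, -, -, b5, -, -, -, b10, -⟩ := pw1 hYp hYX hWX
  obtain ⟨-, f2⟩ := wf_bounds x0 n hn hs hD x hl hX hY hZ hℓ hW
  have hγ : wγ x0 n D s x = X ^ 4 + Y ^ 2 / ℓ := by rw [wγ, hX, hY, hℓ]
  have hDp : 0 < D := hs.trans_le hD
  have hlp : s ≤ ℓ := by rw [hℓ]; exact hl
  have hl0 : 0 < ℓ := hs.trans_le hlp
  have hp9 : 0 ≤ X ^ 9 - Y ^ 9 := by have := pow_le_pow_left₀ hYp.le hYX 9; linarith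
  have hL : - ∑ j, wfh x0 n D s x (ej j) = Z / 4 * (X ^ 5 - Y ^ 5) + s ^ 2 * (3 * (X ^ 10 - Y ^ 10) + 5 / 4 * Z * (X ^ 9 - Y ^ 9)) := by
    simp only [wfh]
    rw [Finset.sum_sub_distrib, wU_lap x0 hs, wU_lap _ hs, ← hX, ← hY, ← hZ]; ring
  have h1 : Z / 4 * (W * X ^ 4) + s ^ 2 * (3 * (W * X ^ 9)) ≤ - ∑ j, wfh x0 n D s x (ej j) := by
    rw [hL]
    have h3 : 0 ≤ 5 / 4 * Z * (X ^ 9 - Y ^ 9) := by positivity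
    gcongr
    linarith
  have h2 : s ^ 2 * wγ x0 n D s x ^ 2 ≤ 2 * s ^ 2 * X ^ 8 + 2 * Y ^ 4 := by
    rw [hγ]
    have h3 : s ^ 2 * (Y ^ 2 / ℓ) ^ 2 ≤ Y ^ 4 := by
      rw [div_pow, mul_div_assoc', div_le_iff₀ (by positivity)]
      calc s ^ 2 * (Y ^ 2) ^ 2 ≤ ℓ ^ 2 * (Y ^ 2) ^ 2 := by gcongr
        _ = _ := by ring
    have h4 : (X ^ 4 + Y ^ 2 / ℓ) ^ 2 ≤ 2 * (X ^ 4) ^ 2 + 2 * (Y ^ 2 / ℓ) ^ 2 := by nlinarith [sq_nonneg (X ^ 4 - Y ^ 2 / ℓ)]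
    have := mul_le_mul_of_nonneg_left h4 (sq_nonneg s)
    nlinarith
  have hf0 := wf_pos x0 n hn hs hD x hl
  calc _ ≤ (2 * s ^ 2 * X ^ 8 + 2 * Y ^ 4) * (W * (X + Z)) := by gcongr
    _ = 2 * W * (s ^ 2 * X ^ 9 + (s ^ 2 * X ^ 4) * (X ^ 4 * Z) + Y ^ 3 * Y * X + Y ^ 4 * Z) := by ring
    _ ≤ 2 * W * (s ^ 2 * X ^ 9 + 1 * (X ^ 4 * Z) + X ^ 3 * Z * X + X ^ 4 * Z) := by gcongr
    _ ≤ 24 * (Z / 4 * (W * X ^ 4) + s ^ 2 * (3 * (W * X ^ 9))) := by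
      have : 0 < s ^ 2 * W * X ^ 9 := by positivity
      linarith
    _ ≤ _ := by gcongr

theorem wf_near (x0 n : E3) (hn : ‖n‖ = 1) {D s : ℝ} (hs : 0 < s) (hD : s ≤ D) (x : E3) (hl : s ≤ wl x0 n D x) (hx : ‖x - x0‖ ≤ s / 2) :
    1 / (8 * s) ≤ wf x0 n D s x ∧ 1 / 2 ≤ s ^ 2 * wγ x0 n D s x := by
  obtain ⟨X, hX⟩ : ∃ X, X = wX x0 s x := ⟨_, rfl⟩
  obtain ⟨Y, hY⟩ : ∃ Y, Y = wX (x0 + (2 * D) • n) s x := ⟨_, rfl⟩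
  obtain ⟨Z, hZ⟩ : ∃ Z, Z = wZ D := ⟨_, rfl⟩
  obtain ⟨ℓ, hℓ⟩ : ∃ ℓ, ℓ = wl x0 n D x := ⟨_, rfl⟩
  obtain ⟨W, hW⟩ : ∃ W, W = 4 * D * ℓ * X * Y ^ 4 := ⟨_, rfl⟩
  obtain ⟨hXp, hYp, hYX, hZp, hYZ, hWp, hWX, hs4, hs2, hx2, hy2⟩ := wcore x0 n hn hs hD x hl hX hY hZ hℓ hW
  obtain ⟨f1, -⟩ := wf_bounds x0 n hn hs hD x hl hX hY hZ hℓ hW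
  have hγ : wγ x0 n D s x = X ^ 4 + Y ^ 2 / ℓ := by rw [wγ, hX, hY, hℓ]
  have hDp : 0 < D := hs.trans_le hD
  have hlp : s ≤ ℓ := by rw [hℓ]; exact hl
  have hl0 : 0 < ℓ := hs.trans_le hlp
  have hX4 := wX_four x0 hs x
  have hY4 := wX_four (x0 + (2 * D) • n) hs x
  rw [wQ_eq x0 n hn] at hY4
  rw [← hX] at hX4
  rw [← hY, ← hℓ] at hY4
  have hx' : ‖x - x0‖ ^ 2 ≤ s ^ 2 / 4 := by
    have := pow_le_pow_left₀ (norm_nonneg _) hx 2; linarith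
  have hX4l : 4 / 5 ≤ s ^ 2 * X ^ 4 := by
    have : 1 ≤ (5 / 4 * s ^ 2) * X ^ 4 := by
      rw [← hX4]; gcongr; linarith
    linarith
  have hX2l : 4 / 5 ≤ s * X ^ 2 := by
    have e : s ^ 2 * X ^ 4 = (s * X ^ 2) ^ 2 := by ring
    rw [e] at hX4l
    exact hX4l.trans (pow_le_of_le_one (by positivity) hs2 (by norm_num))
  constructor
  · have hY4l : 4 / 21 ≤ D * ℓ * Y ^ 4 := by
      have h1 : s ^ 2 ≤ D * ℓ := by nlinarith
      have : 1 ≤ (21 / 4 * (D * ℓ)) * Y ^ 4 := by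
        rw [← hY4]; gcongr; linarith
      linarith
    rw [div_le_iff₀ (by positivity)]
    have h2 : 4 * (D * ℓ * Y ^ 4) * X ^ 2 ≤ 4 * wf x0 n D s x := by
      refine le_trans ?_ f1
      rw [hW]
      have : 0 ≤ 4 * D * ℓ * X * Y ^ 4 * Z := by positivity
      linarith
    have h3 : 4 / 21 * (4 / 5) ≤ (D * ℓ * Y ^ 4) * (s * X ^ 2) := by gcongr
    have h4 : (D * ℓ * Y ^ 4) * (s * X ^ 2) ≤ wf x0 n D s x * s := by
      have := mul_le_mul_of_nonneg_right h2 hs.le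
      linarith
    linarith
  · rw [hγ]
    have : 0 ≤ s ^ 2 * (Y ^ 2 / ℓ) := by positivity
    linarith

theorem wX_comp (z : E3) {s : ℝ} (hs : 0 < s) {x ξ : E3} (h : ‖ξ - x‖ ≤ s) : wX z s ξ ^ 2 ≤ 2 * wX z s x ^ 2 := by
  have h1 := wX_four z hs x
  have h2 := wX_four z hs ξ
  have p1 := wX_pos z hs x
  have p2 := wX_pos z hs ξ
  have h3 : ‖x - z‖ ≤ ‖ξ - z‖ + s := by
    have : x - z = (ξ - z) - (ξ - x) := by abel
    rw [this]; exact (norm_sub_le _ _).trans (by linarith)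
  have h4 : ‖x - z‖ ^ 2 ≤ (‖ξ - z‖ + s) ^ 2 := pow_le_pow_left₀ (norm_nonneg _) h3 2
  have h5 : ‖x - z‖ ^ 2 + s ^ 2 ≤ 4 * (‖ξ - z‖ ^ 2 + s ^ 2) := by nlinarith [sq_nonneg (‖ξ - z‖ - s), sq_nonneg ‖ξ - z‖]
  have h6 : wX z s ξ ^ 4 ≤ 4 * wX z s x ^ 4 := by
    calc wX z s ξ ^ 4 = ((‖x - z‖ ^ 2 + s ^ 2) * wX z s x ^ 4) * wX z s ξ ^ 4 := by rw [h1, one_mul]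
      _ ≤ (4 * (‖ξ - z‖ ^ 2 + s ^ 2) * wX z s x ^ 4) * wX z s ξ ^ 4 := by gcongr
      _ = 4 * wX z s x ^ 4 * ((‖ξ - z‖ ^ 2 + s ^ 2) * wX z s ξ ^ 4) := by ring
      _ = _ := by rw [h2, mul_one]
  apply (pow_le_pow_iff_left₀ (by positivity) (by positivity) (n := 2) (by norm_num)).1
  calc (wX z s ξ ^ 2) ^ 2 = wX z s ξ ^ 4 := by ring
    _ ≤ _ := h6
    _ = _ := by ring

theorem wγ_comp (x0 n : E3) (hn : ‖n‖ = 1) {D s : ℝ} (hs : 0 < s) {x ξ : E3} (h : ‖ξ - x‖ ≤ s)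
    (hx : s ≤ wl x0 n D x) (hξ : s ≤ wl x0 n D ξ) : wγ x0 n D s ξ ≤ 4 * wγ x0 n D s x := by
  have a1 := wX_comp x0 hs h
  have a2 := wX_comp (x0 + (2 * D) • n) hs h
  have l1 : wl x0 n D x ≤ 2 * wl x0 n D ξ := by
    have e1 : wl x0 n D x = wl x0 n D ξ + ⟪n, ξ - x⟫ := by
      have : ξ - x = (ξ - x0) - (x - x0) := by abel
      rw [wl, wl, this, inner_sub_right n (ξ - x0)]; ring
    have e2 := (abs_le.1 (abs_real_inner_le_norm n (ξ - x))).2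
    rw [hn, one_mul] at e2
    linarith
  have p1 : 0 < wl x0 n D x := hs.trans_le hx
  have p2 : 0 < wl x0 n D ξ := hs.trans_le hξ
  unfold wγ
  rw [mul_add]
  apply add_le_add
  · calc wX x0 s ξ ^ 4 = (wX x0 s ξ ^ 2) ^ 2 := by ring
      _ ≤ (2 * wX x0 s x ^ 2) ^ 2 := by gcongr
      _ = _ := by ring
  · rw [mul_div_assoc', div_le_div_iff₀ p2 p1]
    calc _ ≤ 2 * wX (x0 + (2 * D) • n) s x ^ 2 * (2 * wl x0 n D ξ) := by gcongr
      _ = _ := by ring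

theorem wl_seg (x0 n : E3) (D : ℝ) {s : ℝ} {x a : E3} (hx : s ≤ wl x0 n D x) (ha : s ≤ wl x0 n D a) {t : ℝ} (ht : t ∈ Icc (0:ℝ) 1) :
    s ≤ wl x0 n D (x + t • (a - x)) := by
  have e1 : wl x0 n D (x + t • (a - x)) = (1 - t) * wl x0 n D x + t * wl x0 n D a := by
    have h1 : x + t • (a - x) - x0 = (1 - t) • (x - x0) + t • (a - x0) := by module
    rw [wl, wl, wl, h1, inner_add_right, real_inner_smul_right, real_inner_smul_right]; ring
  rw [e1]
  obtain ⟨t0, t1⟩ := ht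
  nlinarith

theorem mvt01 {ψ ψ' : ℝ → ℝ} (h : ∀ t, HasDerivAt ψ (ψ' t) t) {C : ℝ} (hC : ∀ t ∈ Icc (0:ℝ) 1, |ψ' t| ≤ C) {t : ℝ} (ht : t ∈ Icc (0:ℝ) 1) :
    |ψ t - ψ 0| ≤ C := by
  have := (convex_Icc (0:ℝ) 1).norm_image_sub_le_of_norm_hasDerivWithin_le (f := ψ) (f' := ψ') (C := C) (fun t _ => (h t).hasDerivWithinAt)
    (fun t ht => hC t ht) (left_mem_Icc.2 zero_le_one) ht
  rw [Real.norm_eq_abs, Real.norm_eq_abs, sub_zero, abs_of_nonneg ht.1] at this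
  have h0 : 0 ≤ C := (abs_nonneg _).trans (hC t ht)
  nlinarith [ht.2]

theorem wf_taylor (x0 n : E3) (hn : ‖n‖ = 1) {D s : ℝ} (hs : 0 < s) (hD : s ≤ D) {x a : E3} (hx : s ≤ wl x0 n D x) (ha : s ≤ wl x0 n D a)
    (h : ‖a - x‖ ≤ s / 16) :
    |wf x0 n D s a - wf x0 n D s x| ≤ 16 / s * ‖a - x‖ * wf x0 n D s x ∧
    |wf x0 n D s a - wf x0 n D s x - ⟪wfg x0 n D s x, a - x⟫| ≤ 288 * (wf x0 n D s x * wγ x0 n D s x * ‖a - x‖ ^ 2) := by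
  set e := a - x with he
  set f := wf x0 n D s with hf
  set ψ : ℝ → ℝ := fun t => f (x + t • e) with hψ
  have hψd : ∀ t, HasDerivAt ψ ⟪wfg x0 n D s (x + t • e), e⟫ t := fun t => wf_deriv x0 n hs x e t
  have hψd2 : ∀ t, HasDerivAt (fun t : ℝ => ⟪wfg x0 n D s (x + t • e), e⟫) (wfh x0 n D s (x + t • e) e) t := fun t => wf_deriv2 x0 n hs x e t
  have hseg : ∀ t ∈ Icc (0:ℝ) 1, s ≤ wl x0 n D (x + t • e) := fun t ht => wl_seg x0 n D hx ha ht
  have hfp : ∀ t ∈ Icc (0:ℝ) 1, 0 < ψ t := fun t ht => wf_pos x0 n hn hs hD _ (hseg t ht)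
  have hd1 : ∀ t ∈ Icc (0:ℝ) 1, |⟪wfg x0 n D s (x + t • e), e⟫| ≤ 8 / s * ‖e‖ * ψ t := by
    intro t ht
    have := wfg_bound x0 n hn hs hD _ (hseg t ht)
    calc _ ≤ ‖wfg x0 n D s (x + t • e)‖ * ‖e‖ := abs_real_inner_le_norm _ _
      _ ≤ (8 / s * f (x + t • e)) * ‖e‖ := by gcongr
      _ = _ := by simp only [hψ]; ring
  have hψ0 : ψ 0 = f x := by simp [hψ]
  have hψ1 : ψ 1 = f a := by simp [hψ, he]
  have hψc : Continuous ψ := continuous_iff_continuousAt.2 fun t => (hψd t).continuousAt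
  obtain ⟨T, hT, hmax⟩ := (isCompact_Icc (a := (0:ℝ)) (b := 1)).exists_isMaxOn ⟨0, by simp⟩ hψc.continuousOn
  have hmax' : ∀ t ∈ Icc (0:ℝ) 1, ψ t ≤ ψ T := hmax
  have hk : 8 / s * ‖e‖ ≤ 1 / 2 := by
    rw [div_mul_eq_mul_div, div_le_iff₀ hs]; linarith
  have hM : ψ T ≤ 2 * f x := by
    have := mvt01 hψd (C := 1 / 2 * ψ T) (fun t ht => (hd1 t ht).trans (by
      have := hfp t ht
      exact mul_le_mul hk (hmax' t ht) this.le (by norm_num))) hT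
    have := (abs_le.1 this).2
    rw [hψ0] at this
    linarith
  have hM' : ∀ t ∈ Icc (0:ℝ) 1, ψ t ≤ 2 * f x := fun t ht => (hmax' t ht).trans hM
  have one : (1:ℝ) ∈ Icc (0:ℝ) 1 := by simp
  constructor
  · have := mvt01 hψd (C := 8 / s * ‖e‖ * (2 * f x)) (fun t ht => (hd1 t ht).trans (by
      have := hM' t ht; gcongr)) one
    rw [hψ0, hψ1] at this
    refine this.trans (le_of_eq (by ring))
  · have hd2 : ∀ t ∈ Icc (0:ℝ) 1, |wfh x0 n D s (x + t • e) e| ≤ 288 * (f x * wγ x0 n D s x * ‖e‖ ^ 2) := by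
      intro t ht
      have h1 := wfh_bound x0 n hn hs hD _ (hseg t ht) e
      have h2 : wγ x0 n D s (x + t • e) ≤ 4 * wγ x0 n D s x := by
        apply wγ_comp x0 n hn hs _ hx (hseg t ht)
        rw [add_sub_cancel_left, norm_smul, Real.norm_of_nonneg ht.1]
        have := norm_nonneg e
        nlinarith [ht.2]
      have h3 := wγ_pos x0 n D hs _ (hseg t ht)
      have h4 := hM' t ht
      have h5 := hfp t ht
      have h6 : 0 ≤ 2 * f x := h5.le.trans h4
      calc _ ≤ _ := h1
        _ ≤ 36 * ((2 * f x) * (4 * wγ x0 n D s x) * ‖e‖ ^ 2) := by gcongr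
        _ = _ := by ring
    have h1 : ∀ t ∈ Icc (0:ℝ) 1, |⟪wfg x0 n D s (x + t • e), e⟫ - ⟪wfg x0 n D s x, e⟫| ≤ 288 * (f x * wγ x0 n D s x * ‖e‖ ^ 2) := by
      intro t ht
      have := mvt01 hψd2 hd2 ht
      simpa using this
    have h2 : ∀ t, HasDerivAt (fun t => ψ t - t * ⟪wfg x0 n D s x, e⟫) (⟪wfg x0 n D s (x + t • e), e⟫ - ⟪wfg x0 n D s x, e⟫) t := by
      intro t
      have := (hψd t).sub ((hasDerivAt_id t).mul_const ⟪wfg x0 n D s x, e⟫)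
      exact this.congr_deriv (by simp)
    have := mvt01 h2 h1 one
    rw [hψ0, hψ1] at this
    simp only [one_mul, zero_mul, sub_zero] at this
    rwa [sub_right_comm] at this

def kD (D t : ℝ) : ℝ := (D ^ 2 + t ^ 2) ^ (-(5/8) : ℝ)
def kI : ℝ := ∫ t : ℝ, (1 + t ^ 2) ^ (-(5/8) : ℝ)

theorem kD_int {D : ℝ} (hD : 0 < D) : Integrable (kD D) ∧ ∫ t, kD D t = D ^ (-(1/4) : ℝ) * kI := by
  have h1 : Integrable (fun t : ℝ => (1 + t ^ 2) ^ (-(5/8) : ℝ)) := by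
    have := integrable_rpow_neg_one_add_norm_sq (E := ℝ) (μ := volume) (r := 5/4) (by norm_num)
    refine this.congr (Filter.Eventually.of_forall fun t => ?_)
    simp only [Real.norm_eq_abs, sq_abs]
    norm_num
  have h2 : kD D = fun t => D ^ (-(5/4) : ℝ) * (fun t : ℝ => (1 + t ^ 2) ^ (-(5/8) : ℝ)) (t / D) := by
    funext t
    have : D ^ 2 + t ^ 2 = D ^ 2 * (1 + (t / D) ^ 2) := by field_simp
    simp only [kD]
    rw [this, Real.mul_rpow (by positivity) (by positivity), ← Real.rpow_natCast D 2, ← Real.rpow_mul hD.le]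
    norm_num
  constructor
  · rw [h2]; exact (h1.comp_div hD.ne').const_mul _
  · rw [h2, integral_const_mul, Measure.integral_comp_div (fun t : ℝ => (1 + t ^ 2) ^ (-(5/8) : ℝ)) D, abs_of_pos hD, smul_eq_mul, ← kI, ← mul_assoc]
    congr 1
    nth_rewrite 2 [← Real.rpow_one D]
    rw [← Real.rpow_add hD]; norm_num

theorem exists_basis (n : E3) (hn : ‖n‖ = 1) : ∃ b : OrthonormalBasis (Fin 3) ℝ E3, b 0 = n := by
  have h1 : Orthonormal ℝ (({0} : Set (Fin 3)).domRestrict (fun _ : Fin 3 => n)) := by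
    constructor
    · intro i; exact hn
    · intro i j hij
      exact absurd (Subsingleton.elim i j) hij
  obtain ⟨b, hb⟩ := h1.exists_orthonormalBasis_extension_of_card_eq (by simp)
  exact ⟨b, hb 0 (by simp)⟩

theorem prod_int (b : OrthonormalBasis (Fin 3) ℝ E3) (x0 : E3) (F : Fin 3 → ℝ → ℝ) (hF : ∀ i, Integrable (F i)) :
    Integrable (fun x : E3 => ∏ i, F i ⟪b i, x - x0⟫) ∧ ∫ x : E3, ∏ i, F i ⟪b i, x - x0⟫ = ∏ i, ∫ t, F i t := by
  have m1 : MeasurePreserving (fun x : E3 => x - x0) volume volume := measurePreserving_sub_right volume x0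
  have m2 := b.measurePreserving_repr
  have m3 := EuclideanSpace.volume_preserving_symm_measurableEquiv_toLp (Fin 3)
  have e1 : (fun x : E3 => ∏ i, F i ⟪b i, x - x0⟫) = fun x => (fun y : E3 => (fun z : E3 => (fun w : Fin 3 → ℝ => ∏ i, F i (w i)) ((MeasurableEquiv.toLp 2 (Fin 3 → ℝ)).symm z)) (b.repr y)) (x - x0) := by
    funext x
    simp only [← b.repr_apply_apply]
    rfl
  have i0 : Integrable (fun w : Fin 3 → ℝ => ∏ i, F i (w i)) := Integrable.fintype_prod hF
  have i1 := m3.integrable_comp_of_integrable i0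
  have i2 := m2.integrable_comp_of_integrable i1
  have i3 := m1.integrable_comp_of_integrable i2
  constructor
  · rw [e1]; exact i3
  · rw [e1, integral_sub_right_eq_self (fun y : E3 => (fun z : E3 => (fun w : Fin 3 → ℝ => ∏ i, F i (w i)) ((MeasurableEquiv.toLp 2 (Fin 3 → ℝ)).symm z)) (b.repr y)) x0]
    have j1 := m2.integral_comp b.repr.toHomeomorph.measurableEmbedding (fun z : E3 => (fun w : Fin 3 → ℝ => ∏ i, F i (w i)) ((MeasurableEquiv.toLp 2 (Fin 3 → ℝ)).symm z))
    rw [j1, m3.integral_comp' (fun w : Fin 3 → ℝ => ∏ i, F i (w i))]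
    exact integral_fintype_prod_volume_eq_prod F

theorem kD_mul {D t1 t2 : ℝ} (hD : 0 < D) {P : ℝ} (hP : P = (D ^ 2 + t1 ^ 2 + t2 ^ 2) ^ (-(1/4) : ℝ)) :
    P ^ 5 ≤ kD D t1 * kD D t2 := by
  obtain ⟨R, hR⟩ : ∃ R, R = D ^ 2 + t1 ^ 2 + t2 ^ 2 := ⟨_, rfl⟩
  have hRp : 0 < R := by rw [hR]; positivity
  rw [← hR] at hP
  have e1 : P ^ 5 = R ^ (-(5/8) : ℝ) * R ^ (-(5/8) : ℝ) := by
    rw [hP, ← Real.rpow_natCast, ← Real.rpow_mul hRp.le, ← Real.rpow_add hRp]; norm_num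
  rw [e1]
  have m : ∀ t : ℝ, D ^ 2 + t ^ 2 ≤ R → R ^ (-(5/8) : ℝ) ≤ kD D t := fun t ht =>
    Real.rpow_le_rpow_of_nonpos (by positivity) ht (by norm_num)
  have p0 : 0 ≤ R ^ (-(5/8) : ℝ) := (Real.rpow_pos_of_pos hRp _).le
  have s1 := sq_nonneg t1
  have s2 := sq_nonneg t2
  exact mul_le_mul (m t1 (by rw [hR]; linarith)) (m t2 (by rw [hR]; linarith)) p0 (p0.trans (m t1 (by rw [hR]; linarith)))

set_option maxHeartbeats 1000000 in
theorem slab_pt (x0 n : E3) (b : OrthonormalBasis (Fin 3) ℝ E3) (hb : b 0 = n) (hn : ‖n‖ = 1) {D s : ℝ} (hs : 0 < s) (hD : s ≤ D) (x : E3)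
    (hl : s ≤ wl x0 n D x) (hl2 : wl x0 n D x ≤ 2 * s) :
    wf x0 n D s x ≤ 40 * s * D * wZ D * (kD D ⟪b 1, x - x0⟫ * kD D ⟪b 2, x - x0⟫) := by
  obtain ⟨X, hX⟩ : ∃ X, X = wX x0 s x := ⟨_, rfl⟩
  obtain ⟨Y, hY⟩ : ∃ Y, Y = wX (x0 + (2 * D) • n) s x := ⟨_, rfl⟩
  obtain ⟨Z, hZ⟩ : ∃ Z, Z = wZ D := ⟨_, rfl⟩
  obtain ⟨ℓ, hℓ⟩ : ∃ ℓ, ℓ = wl x0 n D x := ⟨_, rfl⟩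
  obtain ⟨W, hW⟩ : ∃ W, W = 4 * D * ℓ * X * Y ^ 4 := ⟨_, rfl⟩
  obtain ⟨hXp, hYp, hYX, hZp, hYZ, hWp, -⟩ := wcore x0 n hn hs hD x hl hX hY hZ hℓ hW
  obtain ⟨-, f2⟩ := wf_bounds x0 n hn hs hD x hl hX hY hZ hℓ hW
  have hDp : 0 < D := hs.trans_le hD
  have hX4 := wX_four x0 hs x
  have hY4 := wX_four (x0 + (2 * D) • n) hs x
  have hZ2 := wZ_two hDp
  rw [wQ_eq x0 n hn] at hY4
  rw [← hX] at hX4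
  rw [← hY, ← hℓ] at hY4
  rw [← hZ] at hZ2
  rw [← hℓ] at hl hl2
  have hl0 : 0 < ℓ := hs.trans_le hl
  set t1 := ⟪b 1, x - x0⟫ with ht1
  set t2 := ⟪b 2, x - x0⟫ with ht2
  have hq : ‖x - x0‖ ^ 2 = (D - ℓ) ^ 2 + t1 ^ 2 + t2 ^ 2 := by
    have h1 := b.sum_sq_inner_right (x - x0)
    rw [Fin.sum_univ_three, hb] at h1
    have h2 : ⟪n, x - x0⟫ = D - ℓ := by rw [hℓ, wl]; ring
    rw [← h1, h2]
  rw [hq] at hX4 hY4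
  set R := D ^ 2 + t1 ^ 2 + t2 ^ 2 with hR
  have hRp : 0 < R := by positivity
  obtain ⟨P, hP⟩ : ∃ P, P = R ^ (-(1/4) : ℝ) := ⟨_, rfl⟩
  have hPp : 0 < P := by rw [hP]; exact Real.rpow_pos_of_pos hRp _
  have hP4 : R * P ^ 4 = 1 := by
    have : P ^ 4 = R⁻¹ := by
      rw [hP, ← Real.rpow_natCast, ← Real.rpow_mul hRp.le]; norm_num [Real.rpow_neg_one]
    rw [this, mul_inv_cancel₀ hRp.ne']
  have pl : ∀ a b : ℝ, 0 ≤ a → 0 ≤ b → a ^ 4 ≤ b ^ 4 → a ≤ b := fun a b ha hb h => (pow_le_pow_iff_left₀ ha hb (by norm_num)).1 h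
  have hYP : Y ≤ P := by
    apply pl _ _ hYp.le hPp.le
    have h1 : R ≤ (D - ℓ) ^ 2 + t1 ^ 2 + t2 ^ 2 + 4 * D * ℓ + s ^ 2 := by
      rw [hR]; nlinarith [mul_pos hDp hl0]
    calc Y ^ 4 = R * P ^ 4 * Y ^ 4 := by rw [hP4, one_mul]
      _ = R * Y ^ 4 * P ^ 4 := by ring
      _ ≤ (((D - ℓ) ^ 2 + t1 ^ 2 + t2 ^ 2 + 4 * D * ℓ + s ^ 2) * Y ^ 4) * P ^ 4 := by
          exact mul_le_mul_of_nonneg_right (mul_le_mul_of_nonneg_right h1 (by positivity)) (by positivity)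
      _ = P ^ 4 := by rw [hY4, one_mul]
  have hX4P : X ^ 4 ≤ 9 * P ^ 4 := by
    have h1 : R ≤ 9 * ((D - ℓ) ^ 2 + t1 ^ 2 + t2 ^ 2 + s ^ 2) := by
      have h2 : D ^ 2 ≤ 2 * (D - ℓ) ^ 2 + 2 * ℓ ^ 2 := by nlinarith [sq_nonneg (D - 2 * ℓ)]
      have h3 : ℓ ^ 2 ≤ (2 * s) ^ 2 := pow_le_pow_left₀ hl0.le hl2 2
      rw [hR]; nlinarith [sq_nonneg t1, sq_nonneg t2, sq_nonneg (D - ℓ)]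
    calc X ^ 4 = R * P ^ 4 * X ^ 4 := by rw [hP4, one_mul]
      _ = R * X ^ 4 * P ^ 4 := by ring
      _ ≤ (9 * ((D - ℓ) ^ 2 + t1 ^ 2 + t2 ^ 2 + s ^ 2) * X ^ 4) * P ^ 4 := by
          exact mul_le_mul_of_nonneg_right (mul_le_mul_of_nonneg_right h1 (by positivity)) (by positivity)
      _ = 9 * (((D - ℓ) ^ 2 + t1 ^ 2 + t2 ^ 2 + s ^ 2) * X ^ 4) * P ^ 4 := by ring
      _ = 9 * P ^ 4 := by rw [hX4, mul_one]
  have hXP : X ≤ 2 * P := by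
    apply pl _ _ hXp.le (by positivity)
    have : 0 < P ^ 4 := by positivity
    calc X ^ 4 ≤ 9 * P ^ 4 := hX4P
      _ ≤ (2 * P) ^ 4 := by ring_nf; linarith
  have hX2P : X ^ 2 ≤ 3 * P ^ 2 := by
    apply (pow_le_pow_iff_left₀ (by positivity) (by positivity) (n := 2) (by norm_num)).1
    calc (X ^ 2) ^ 2 = X ^ 4 := by ring
      _ ≤ _ := hX4P
      _ = _ := by ring
  have hPZ : P ≤ Z := by
    apply pl _ _ hPp.le hZp.le
    have h1 : D ^ 2 * Z ^ 4 = 1 := by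
      have : D ^ 2 * Z ^ 4 = (D * Z ^ 2) ^ 2 := by ring
      rw [this, hZ2, one_pow]
    have h3 : D ^ 2 * P ^ 4 ≤ D ^ 2 * Z ^ 4 := by
      rw [h1, ← hP4]; exact mul_le_mul_of_nonneg_right (by rw [hR]; have := sq_nonneg t1; have := sq_nonneg t2; linarith) (by positivity)
    exact le_of_mul_le_mul_left h3 (by positivity)
  have hP5 : P ^ 5 ≤ kD D t1 * kD D t2 := kD_mul hDp hP
  rw [← hZ]
  calc _ ≤ _ := f2
    _ = 4 * D * ℓ * Y ^ 4 * (X ^ 2 + X * Z) := by rw [hW]; ring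
    _ ≤ 4 * D * (2 * s) * P ^ 4 * (3 * P ^ 2 + 2 * P * Z) := by gcongr
    _ = 8 * D * s * P ^ 4 * (3 * (P * P) + 2 * P * Z) := by ring
    _ ≤ 8 * D * s * P ^ 4 * (3 * (P * Z) + 2 * P * Z) := by gcongr
    _ = 40 * s * D * Z * P ^ 5 := by ring
    _ ≤ _ := by gcongr

theorem slab (x0 n : E3) (hn : ‖n‖ = 1) {D s h : ℝ} (hs : 0 < s) (hD : s ≤ D) (hh : 0 < h) (hhs : h ≤ s) :
    ∃ ψ : E3 → ℝ, Integrable ψ ∧ (∀ x, 0 ≤ ψ x) ∧ ∫ x, ψ x ≤ 40 * kI ^ 2 * (s * h) ∧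
      ∀ x, s ≤ wl x0 n D x → wl x0 n D x ≤ s + h → wf x0 n D s x ≤ ψ x := by
  obtain ⟨b, hb⟩ := exists_basis n hn
  have hDp : 0 < D := hs.trans_le hD
  have hZp := wZ_pos hDp
  have hk0 : ∀ t, 0 ≤ kD D t := fun t => Real.rpow_nonneg (by positivity) _
  set c := 40 * s * D * wZ D with hc
  have hc0 : 0 < c := by positivity
  set F : Fin 3 → ℝ → ℝ := ![(Icc (D - s - h) (D - s)).indicator 1, kD D, kD D] with hF
  have hFi : ∀ i, Integrable (F i) := by
    intro i
    fin_cases i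
    · exact (integrable_indicator_iff measurableSet_Icc).2 (by
        have : IntegrableOn (fun _ : ℝ => (1:ℝ)) (Icc (D - s - h) (D - s)) := integrableOn_const (by simp)
        exact this)
    · exact (kD_int hDp).1
    · exact (kD_int hDp).1
  have hF0 : ∀ i t, 0 ≤ F i t := by
    intro i t
    fin_cases i
    · exact Set.indicator_nonneg (fun _ _ => zero_le_one) t
    · exact hk0 t
    · exact hk0 t
  obtain ⟨i1, i2⟩ := prod_int b x0 F hFi
  refine ⟨fun x => c * ∏ i, F i ⟪b i, x - x0⟫, i1.const_mul c, ?_, ?_, ?_⟩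
  · intro x
    exact mul_nonneg hc0.le (Finset.prod_nonneg fun i _ => hF0 i _)
  · rw [integral_const_mul, i2, Fin.prod_univ_three]
    have e0 : ∫ t, F 0 t = h := by
      change ∫ t, (Icc (D - s - h) (D - s)).indicator (1 : ℝ → ℝ) t = h
      rw [integral_indicator_one measurableSet_Icc]
      simp [Measure.real, hh.le]
    have e1 : ∫ t, F 1 t = D ^ (-(1/4) : ℝ) * kI := (kD_int hDp).2
    have e2 : ∫ t, F 2 t = D ^ (-(1/4) : ℝ) * kI := (kD_int hDp).2
    rw [e0, e1, e2]
    have hZ : D ^ (-(1/4) : ℝ) * D ^ (-(1/4) : ℝ) = wZ D := by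
      rw [wZ, ← Real.rpow_add hDp]; norm_num
    have hZ2 := wZ_two hDp
    apply le_of_eq
    calc c * (h * (D ^ (-(1/4) : ℝ) * kI) * (D ^ (-(1/4) : ℝ) * kI)) = c * h * (D ^ (-(1/4) : ℝ) * D ^ (-(1/4) : ℝ)) * kI ^ 2 := by ring
      _ = 40 * kI ^ 2 * (s * h) * (D * wZ D ^ 2) := by rw [hZ, hc]; ring
      _ = _ := by rw [hZ2, mul_one]
  · intro x h1 h2
    have := slab_pt x0 n b hb hn hs hD x h1 (by linarith)
    refine this.trans (le_of_eq ?_)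
    change _ = c * ∏ i, F i ⟪b i, x - x0⟫
    rw [Fin.prod_univ_three]
    have e0 : F 0 ⟪b 0, x - x0⟫ = 1 := by
      change (Icc (D - s - h) (D - s)).indicator (1 : ℝ → ℝ) _ = 1
      rw [Set.indicator_of_mem]; rfl
      rw [hb]
      unfold wl at h1 h2
      constructor <;> linarith
    rw [e0, one_mul]
    rfl

section softmin
variable {ι : Type} [Fintype ι]

theorem jensen2 (μ z : ι → ℝ) (h0 : ∀ i, 0 ≤ μ i) (h1 : ∑ i, μ i = 1) : (∑ i, μ i * z i) ^ 2 ≤ ∑ i, μ i * z i ^ 2 :=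
  Real.pow_arith_mean_le_arith_mean_pow_of_even _ μ z (fun i _ => h0 i) h1 even_two

theorem variance_id (μ : ι → ℝ) (p : ι → E3) (h1 : ∑ i, μ i = 1) :
    ∑ i, μ i * ‖p i - ∑ j, μ j • p j‖ ^ 2 = ∑ i, μ i * ‖p i‖ ^ 2 - ‖∑ j, μ j • p j‖ ^ 2 := by
  set P := ∑ j, μ j • p j with hP
  have e : ∀ i, μ i * ‖p i - P‖ ^ 2 = μ i * ‖p i‖ ^ 2 - 2 * ⟪μ i • p i, P⟫ + μ i * ‖P‖ ^ 2 := by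
    intro i
    rw [norm_sub_sq_real, real_inner_smul_left]; ring
  simp_rw [e]
  rw [Finset.sum_add_distrib, Finset.sum_sub_distrib, ← Finset.sum_mul, h1, ← Finset.mul_sum, ← sum_inner, ← hP,
    real_inner_self_eq_norm_sq]
  ring

theorem harm_bound (μ ξ : ι → ℝ) (h0 : ∀ i, 0 ≤ μ i) (h1 : ∑ i, μ i = 1) (h2 : ∀ i, 1/2 ≤ ξ i) (h3 : ∀ i, ξ i ≤ 2) :
    |(∑ i, μ i * (ξ i)⁻¹)⁻¹ - ∑ i, μ i * ξ i| ≤ 8 * ∑ i, μ i * (ξ i - ∑ j, μ j * ξ j) ^ 2 := by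
  obtain ⟨m, hm⟩ : ∃ m, m = ∑ j, μ j * ξ j := ⟨_, rfl⟩
  obtain ⟨B, hB⟩ : ∃ B, B = ∑ j, μ j * (ξ j)⁻¹ := ⟨_, rfl⟩
  obtain ⟨V, hV⟩ : ∃ V, V = ∑ j, μ j * (ξ j - m) ^ 2 := ⟨_, rfl⟩
  rw [← hm, ← hB, ← hV]
  have hm2 : 1 / 2 ≤ m := by
    rw [hm, show (1/2:ℝ) = (1/2) * ∑ i, μ i by rw [h1, mul_one], Finset.mul_sum]
    exact Finset.sum_le_sum fun i _ => by rw [mul_comm]; exact mul_le_mul_of_nonneg_left (h2 i) (h0 i)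
  have hB2 : 1 / 2 ≤ B := by
    rw [hB, show (1/2:ℝ) = (1/2) * ∑ i, μ i by rw [h1, mul_one], Finset.mul_sum]
    refine Finset.sum_le_sum fun i _ => ?_
    rw [mul_comm]
    refine mul_le_mul_of_nonneg_left ?_ (h0 i)
    rw [one_div]; exact inv_anti₀ (by linarith [h2 i]) (h3 i)
  have key : m * B - 1 = ∑ i, μ i * ((ξ i - m) ^ 2 * (m * ξ i)⁻¹) := by
    have : ∀ i, μ i * ((ξ i - m) ^ 2 * (m * ξ i)⁻¹) = m⁻¹ * (μ i * ξ i) - 2 * μ i + m * (μ i * (ξ i)⁻¹) := by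
      intro i
      have := h2 i
      field_simp
      ring
    simp_rw [this]
    rw [Finset.sum_add_distrib, Finset.sum_sub_distrib, ← Finset.mul_sum, ← Finset.mul_sum, ← Finset.mul_sum, ← hm, ← hB, h1]
    field_simp; ring
  have hk0 : 0 ≤ m * B - 1 := by
    rw [key]
    exact Finset.sum_nonneg fun i _ => by have := h2 i; have := h0 i; positivity
  have hk1 : m * B - 1 ≤ 4 * V := by
    rw [key, hV, Finset.mul_sum]
    refine Finset.sum_le_sum fun i _ => ?_
    have a1 := h2 i
    have : (m * ξ i)⁻¹ ≤ 4 := by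
      rw [inv_le_comm₀ (by positivity) (by norm_num)]
      nlinarith
    calc μ i * ((ξ i - m) ^ 2 * (m * ξ i)⁻¹) ≤ μ i * ((ξ i - m) ^ 2 * 4) :=
          mul_le_mul_of_nonneg_left (mul_le_mul_of_nonneg_left this (sq_nonneg _)) (h0 i)
      _ = _ := by ring
  have hBi : B⁻¹ ≤ 2 := by rw [inv_le_comm₀ (by positivity) (by norm_num)]; linarith
  have hBi0 : 0 ≤ B⁻¹ := by positivity
  have e : B⁻¹ - m = -((m * B - 1) * B⁻¹) := by field_simp; ring
  rw [e, abs_neg, abs_of_nonneg (mul_nonneg hk0 hBi0)]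
  calc (m * B - 1) * B⁻¹ ≤ (4 * V) * 2 := mul_le_mul hk1 hBi hBi0 (hk0.trans hk1)
    _ = _ := by ring

theorem softmin_taylor (μ : ι → ℝ) (h0 : ∀ i, 0 ≤ μ i) (h1 : ∑ i, μ i = 1) (p : ι → E3) (γ η : ι → ℝ) (hγ : ∀ i, 0 ≤ γ i)
    (d : E3) {h κ : ℝ} (hh : 0 < h) (hκ : 64 ≤ κ) (hd : ‖d‖ ≤ h) (hη : ∀ i, |η i| ≤ 16 / κ)
    (hη2 : ∀ i, |η i - ⟪p i, d⟫| ≤ 288 * γ i * h ^ 2) :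
    ((∑ i, μ i * (1 + η i)⁻¹)⁻¹ - 1 - ⟪∑ i, μ i • p i, d⟫) ^ 2 ≤
      10 ^ 8 * (h ^ 2 / κ ^ 2 * ∑ i, μ i * ‖p i - ∑ j, μ j • p j‖ ^ 2 + h ^ 4 * ∑ i, μ i * γ i ^ 2) := by
  have hκ0 : 0 < κ := by linarith
  obtain ⟨P, hP⟩ : ∃ P, P = ∑ j, μ j • p j := ⟨_, rfl⟩
  rw [← hP]
  have hk : 16 / κ ≤ 1 / 4 := by rw [div_le_iff₀ hκ0]; linarith
  have hη' := fun i => abs_le.1 (hη i)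
  have hb := harm_bound μ (fun i => 1 + η i) h0 h1 (fun i => by linarith [hη' i]) (fun i => by linarith [hη' i])
  obtain ⟨B, hB⟩ : ∃ B, B = (∑ j, μ j * (1 + η j)⁻¹)⁻¹ := ⟨_, rfl⟩
  obtain ⟨m, hm⟩ : ∃ m, m = ∑ j, μ j * η j := ⟨_, rfl⟩
  have hm1 : ∑ j, μ j * (1 + η j) = 1 + m := by
    simp_rw [mul_add, mul_one]; rw [Finset.sum_add_distrib, h1, hm]
  simp only [hm1] at hb
  rw [← hB] at hb ⊢
  obtain ⟨S1, hS1⟩ : ∃ S, S = ∑ i, μ i * ‖p i - P‖ := ⟨_, rfl⟩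
  obtain ⟨S2, hS2⟩ : ∃ S, S = ∑ i, μ i * γ i := ⟨_, rfl⟩
  have j1 : S1 ^ 2 ≤ ∑ i, μ i * ‖p i - P‖ ^ 2 := by rw [hS1]; exact jensen2 μ _ h0 h1
  have j2 : S2 ^ 2 ≤ ∑ i, μ i * γ i ^ 2 := by rw [hS2]; exact jensen2 μ _ h0 h1
  have hS10 : 0 ≤ S1 := by rw [hS1]; exact Finset.sum_nonneg fun i _ => mul_nonneg (h0 i) (norm_nonneg _)
  have hS20 : 0 ≤ S2 := by rw [hS2]; exact Finset.sum_nonneg fun i _ => mul_nonneg (h0 i) (hγ i)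
  have hmP : |m - ⟪P, d⟫| ≤ 288 * h ^ 2 * S2 := by
    have e : m - ⟪P, d⟫ = ∑ i, μ i * (η i - ⟪p i, d⟫) := by
      rw [hm, hP, sum_inner, ← Finset.sum_sub_distrib]
      refine Finset.sum_congr rfl fun i _ => ?_
      rw [real_inner_smul_left]; ring
    rw [e, hS2, Finset.mul_sum]
    refine (Finset.abs_sum_le_sum_abs _ _).trans (Finset.sum_le_sum fun i _ => ?_)
    rw [abs_mul, abs_of_nonneg (h0 i)]
    calc _ ≤ _ := mul_le_mul_of_nonneg_left (hη2 i) (h0 i)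
      _ = _ := by ring
  have hmk : |m| ≤ 16 / κ := by
    rw [hm]
    refine (Finset.abs_sum_le_sum_abs _ _).trans ?_
    calc ∑ i, |μ i * η i| ≤ ∑ i, μ i * (16 / κ) := Finset.sum_le_sum fun i _ => by
          rw [abs_mul, abs_of_nonneg (h0 i)]; exact mul_le_mul_of_nonneg_left (hη i) (h0 i)
      _ = 16 / κ := by rw [← Finset.sum_mul, h1, one_mul]
  have hsq : ∑ i, μ i * (1 + η i - (1 + m)) ^ 2 ≤ 32 / κ * (h * S1 + 576 * h ^ 2 * S2) := by
    have e : 32 / κ * (h * S1 + 576 * h ^ 2 * S2) = ∑ i, μ i * (32 / κ * (h * ‖p i - P‖ + 288 * h ^ 2 * γ i + 288 * h ^ 2 * S2)) := by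
      have : ∀ i, μ i * (32 / κ * (h * ‖p i - P‖ + 288 * h ^ 2 * γ i + 288 * h ^ 2 * S2))
        = 32 / κ * (h * (μ i * ‖p i - P‖) + 288 * h ^ 2 * (μ i * γ i) + 288 * h ^ 2 * S2 * μ i) := fun i => by ring
      simp_rw [this]
      rw [← Finset.mul_sum, Finset.sum_add_distrib, Finset.sum_add_distrib, ← Finset.mul_sum, ← Finset.mul_sum, ← Finset.mul_sum,
        ← hS1, ← hS2, h1]
      ring
    rw [e]
    refine Finset.sum_le_sum fun i _ => mul_le_mul_of_nonneg_left ?_ (h0 i)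
    have a1 : |1 + η i - (1 + m)| ≤ 32 / κ := by
      have := abs_le.1 (hη i)
      have := abs_le.1 hmk
      have : 32 / κ = 16 / κ + 16 / κ := by ring
      rw [abs_le]; constructor <;> linarith
    have a2 : |1 + η i - (1 + m)| ≤ h * ‖p i - P‖ + 288 * h ^ 2 * γ i + 288 * h ^ 2 * S2 := by
      have b1 := abs_le.1 (hη2 i)
      have b2 := abs_le.1 hmP
      have b3 : |⟪p i, d⟫ - ⟪P, d⟫| ≤ h * ‖p i - P‖ := by
        rw [← inner_sub_left]
        calc _ ≤ _ := abs_real_inner_le_norm _ _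
          _ ≤ ‖p i - P‖ * h := mul_le_mul_of_nonneg_left hd (norm_nonneg _)
          _ = _ := by ring
      have b4 := abs_le.1 b3
      rw [abs_le]; constructor <;> linarith
    rw [← sq_abs, sq]
    exact mul_le_mul a1 a2 (abs_nonneg _) (by positivity)
  have hrem : |B - 1 - ⟪P, d⟫| ≤ 256 * (h / κ * S1) + 2592 * (h ^ 2 * S2) := by
    have c1 : |B - 1 - ⟪P, d⟫| ≤ 8 * (32 / κ * (h * S1 + 576 * h ^ 2 * S2)) + 288 * h ^ 2 * S2 := by
      have b1 := abs_le.1 hb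
      have b2 := abs_le.1 hmP
      rw [abs_le]; constructor <;> linarith
    have c2 : 8 * (32 / κ * (h * S1 + 576 * h ^ 2 * S2)) = 256 * (h / κ * S1) + 16 / κ * (9216 * (h ^ 2 * S2)) := by ring
    have c3 : 16 / κ * (9216 * (h ^ 2 * S2)) ≤ 1 / 4 * (9216 * (h ^ 2 * S2)) := mul_le_mul_of_nonneg_right hk (by positivity)
    linarith
  calc (B - 1 - ⟪P, d⟫) ^ 2 = |B - 1 - ⟪P, d⟫| ^ 2 := (sq_abs _).symm
    _ ≤ (256 * (h / κ * S1) + 2592 * (h ^ 2 * S2)) ^ 2 := pow_le_pow_left₀ (abs_nonneg _) hrem 2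
    _ ≤ 2 * (256 * (h / κ * S1)) ^ 2 + 2 * (2592 * (h ^ 2 * S2)) ^ 2 := by
        have := sq_nonneg (256 * (h / κ * S1) - 2592 * (h ^ 2 * S2)); linarith [add_sq (256 * (h / κ * S1)) (2592 * (h ^ 2 * S2)), sub_sq (256 * (h / κ * S1)) (2592 * (h ^ 2 * S2))]
    _ = 131072 * (h ^ 2 / κ ^ 2 * S1 ^ 2) + 13436928 * (h ^ 4 * S2 ^ 2) := by field_simp; ring
    _ ≤ 10 ^ 8 * (h ^ 2 / κ ^ 2 * S1 ^ 2) + 10 ^ 8 * (h ^ 4 * S2 ^ 2) := by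
        have u1 : 0 ≤ h ^ 2 / κ ^ 2 * S1 ^ 2 := by positivity
        have u2 : 0 ≤ h ^ 4 * S2 ^ 2 := by positivity
        linarith
    _ = 10 ^ 8 * (h ^ 2 / κ ^ 2 * S1 ^ 2 + h ^ 4 * S2 ^ 2) := by ring
    _ ≤ _ := by
        refine mul_le_mul_of_nonneg_left (add_le_add (mul_le_mul_of_nonneg_left j1 (by positivity)) (mul_le_mul_of_nonneg_left j2 (by positivity))) (by norm_num)

/-- softmin of positive functions -/
def smin (f : ι → ℝ) : ℝ := (∑ i, (f i)⁻¹)⁻¹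
def smG (f : ι → ℝ) (g : ι → E3) : E3 := (smin f) ^ 2 • ∑ i, ((f i)⁻¹ ^ 2) • g i
def smH (f g k : ι → ℝ) : ℝ :=
  2 * smin f ^ 3 * (∑ i, (f i)⁻¹ ^ 2 * g i) ^ 2 + smin f ^ 2 * ∑ i, ((f i)⁻¹ ^ 2 * k i - 2 * ((f i)⁻¹ ^ 3 * g i ^ 2))

theorem smG_inner (f : ι → ℝ) (g : ι → E3) (e : E3) : ⟪smG f g, e⟫ = smin f ^ 2 * ∑ i, (f i)⁻¹ ^ 2 * ⟪g i, e⟫ := by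
  rw [smG, real_inner_smul_left, sum_inner]
  simp_rw [real_inner_smul_left]

variable [Nonempty ι]

theorem smin_pos {f : ι → ℝ} (hf : ∀ i, 0 < f i) : 0 < smin f :=
  inv_pos.2 (Finset.sum_pos (fun i _ => inv_pos.2 (hf i)) Finset.univ_nonempty)

theorem smin_sum {f : ι → ℝ} (hf : ∀ i, 0 < f i) : ∑ i, smin f * (f i)⁻¹ = 1 := by
  rw [← Finset.mul_sum, smin, inv_mul_cancel₀]
  exact (Finset.sum_pos (fun i _ => inv_pos.2 (hf i)) Finset.univ_nonempty).ne'

theorem smin_le {f : ι → ℝ} (hf : ∀ i, 0 < f i) (i : ι) : smin f ≤ f i := by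
  rw [smin, inv_le_comm₀ (inv_pos.1 (smin_pos hf)) (hf i)]
  exact Finset.single_le_sum (f := fun i => (f i)⁻¹) (fun i _ => (inv_pos.2 (hf i)).le) (Finset.mem_univ i)

theorem le_smin {f : ι → ℝ} {m : ℝ} (hm : 0 < m) (hf : ∀ i, m ≤ f i) : m / Fintype.card ι ≤ smin f := by
  have hc : (0:ℝ) < Fintype.card ι := by exact_mod_cast Fintype.card_pos
  rw [smin, le_inv_comm₀ (by positivity) (Finset.sum_pos (fun i _ => inv_pos.2 (hm.trans_le (hf i))) Finset.univ_nonempty)]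
  calc ∑ i, (f i)⁻¹ ≤ ∑ i : ι, m⁻¹ := Finset.sum_le_sum fun i _ => inv_anti₀ hm (hf i)
    _ = _ := by simp [div_eq_mul_inv]

theorem smin_scale {f f' : ι → ℝ} (hf : ∀ i, 0 < f i) (hf' : ∀ i, 0 < f' i) :
    smin f' = smin f * (∑ i, (smin f * (f i)⁻¹) * (1 + (f' i - f i) / f i)⁻¹)⁻¹ := by
  have hp := smin_pos hf
  have e : ∑ i, (smin f * (f i)⁻¹) * (1 + (f' i - f i) / f i)⁻¹ = smin f * ∑ i, (f' i)⁻¹ := by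
    rw [Finset.mul_sum]
    refine Finset.sum_congr rfl fun i _ => ?_
    have := hf i; have := hf' i
    have e2 : 1 + (f' i - f i) / f i = f' i / f i := by field_simp; ring
    rw [e2]; field_simp
  rw [e, mul_inv, ← mul_assoc, mul_inv_cancel₀ hp.ne', one_mul]; rfl

theorem smin_deriv {f g : ι → ℝ → ℝ} {t : ℝ} (hf : ∀ i, 0 < f i t) (hd : ∀ i, HasDerivAt (f i) (g i t) t) :
    HasDerivAt (fun t => smin (fun i => f i t)) (smin (fun i => f i t) ^ 2 * ∑ i, (f i t)⁻¹ ^ 2 * g i t) t := by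
  have hp := smin_pos hf
  have h1 : HasDerivAt (fun t => ∑ i, (f i t)⁻¹) (∑ i, -(g i t) / (f i t) ^ 2) t :=
    HasDerivAt.fun_sum fun i _ => (hd i).fun_inv (hf i).ne'
  have h2 := h1.fun_inv (inv_pos.1 hp).ne'
  refine h2.congr_deriv ?_
  have e1 : ∑ i, -(g i t) / (f i t) ^ 2 = -∑ i, (f i t)⁻¹ ^ 2 * g i t := by
    rw [← Finset.sum_neg_distrib]
    refine Finset.sum_congr rfl fun i _ => ?_
    rw [inv_pow]; ring
  rw [e1, smin, neg_neg, inv_pow]; ring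

theorem smG_deriv {f g k : ι → ℝ → ℝ} {t : ℝ} (hf : ∀ i, 0 < f i t) (hd : ∀ i, HasDerivAt (f i) (g i t) t)
    (hd2 : ∀ i, HasDerivAt (g i) (k i t) t) :
    HasDerivAt (fun t => smin (fun i => f i t) ^ 2 * ∑ i, (f i t)⁻¹ ^ 2 * g i t)
      (smH (fun i => f i t) (fun i => g i t) (fun i => k i t)) t := by
  have h1 := (smin_deriv hf hd).fun_pow 2
  have h2 : HasDerivAt (fun t => ∑ i, (f i t)⁻¹ ^ 2 * g i t) (∑ i, ((f i t)⁻¹ ^ 2 * k i t - 2 * ((f i t)⁻¹ ^ 3 * g i t ^ 2))) t := by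
    refine HasDerivAt.fun_sum fun i _ => ?_
    refine ((((hd i).fun_inv (hf i).ne').fun_pow 2).fun_mul (hd2 i)).congr_deriv ?_
    have := hf i
    push_cast
    field_simp
    ring
  refine (h1.fun_mul h2).congr_deriv ?_
  rw [smH]; push_cast; ring

theorem smH_lap {f : ι → ℝ} (hf : ∀ i, 0 < f i) (g : ι → E3) (k : ι → Fin 3 → ℝ) :
    -∑ j, smH f (fun i => ⟪g i, ej j⟫) (fun i => k i j) =
      smin f * (∑ i, (smin f * (f i)⁻¹) * ((-∑ j, k i j) / f i)
        + 2 * ∑ i, (smin f * (f i)⁻¹) * ‖(f i)⁻¹ • g i - ∑ l, (smin f * (f l)⁻¹) • (f l)⁻¹ • g l‖ ^ 2) := by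
  rw [variance_id _ _ (smin_sum hf)]
  obtain ⟨φ, hφ⟩ : ∃ φ, φ = smin f := ⟨_, rfl⟩
  simp only [smH, ← hφ]
  have eV : ∑ l, (φ * (f l)⁻¹) • (f l)⁻¹ • g l = φ • ∑ l, (f l)⁻¹ ^ 2 • g l := by
    rw [Finset.smul_sum]
    refine Finset.sum_congr rfl fun l _ => ?_
    rw [smul_smul, smul_smul]; congr 1; ring
  have e1 : ∀ j, ∑ i, (f i)⁻¹ ^ 2 * ⟪g i, ej j⟫ = ⟪∑ l, (f l)⁻¹ ^ 2 • g l, ej j⟫ := by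
    intro j; rw [sum_inner]; simp_rw [real_inner_smul_left]
  simp_rw [e1]
  rw [eV, Finset.sum_add_distrib, ← Finset.mul_sum, ej_sum, ← Finset.mul_sum, Finset.sum_comm]
  have e2 : ∀ i, ∑ j, ((f i)⁻¹ ^ 2 * k i j - 2 * ((f i)⁻¹ ^ 3 * ⟪g i, ej j⟫ ^ 2)) = (f i)⁻¹ ^ 2 * ∑ j, k i j - 2 * ((f i)⁻¹ ^ 3 * ‖g i‖ ^ 2) := by
    intro i
    rw [Finset.sum_sub_distrib, ← Finset.mul_sum, ← Finset.mul_sum, ← Finset.mul_sum, ej_sum]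
  simp_rw [e2]
  rw [norm_smul, mul_pow, Real.norm_eq_abs, sq_abs, Finset.sum_sub_distrib]
  have e3 : ∑ i, φ * (f i)⁻¹ * ((-∑ j, k i j) / f i) = -φ * ∑ i, (f i)⁻¹ ^ 2 * ∑ j, k i j := by
    rw [Finset.mul_sum]
    refine Finset.sum_congr rfl fun i _ => ?_
    rw [div_eq_mul_inv]; ring
  have e4 : ∑ i, φ * (f i)⁻¹ * ‖(f i)⁻¹ • g i‖ ^ 2 = φ * ∑ i, (f i)⁻¹ ^ 3 * ‖g i‖ ^ 2 := by
    rw [Finset.mul_sum]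
    refine Finset.sum_congr rfl fun i _ => ?_
    rw [norm_smul, mul_pow, Real.norm_eq_abs, sq_abs]; ring
  rw [e3, e4, ← Finset.mul_sum]
  ring

end softmin

theorem wavg_le {ι : Type} [Fintype ι] {μ z : ι → ℝ} {m : ℝ} (h0 : ∀ i, 0 ≤ μ i) (h1 : ∑ i, μ i = 1) (h : ∀ i, m ≤ z i) :
    m ≤ ∑ i, μ i * z i := by
  calc m = ∑ i, μ i * m := by rw [← Finset.sum_mul, h1, one_mul]
    _ ≤ _ := Finset.sum_le_sum fun i _ => mul_le_mul_of_nonneg_left (h i) (h0 i)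

theorem le_wavg {ι : Type} [Fintype ι] {μ z : ι → ℝ} {m : ℝ} (h0 : ∀ i, 0 ≤ μ i) (h1 : ∑ i, μ i = 1) (h : ∀ i, z i ≤ m) :
    ∑ i, μ i * z i ≤ m := by
  calc _ ≤ ∑ i, μ i * m := Finset.sum_le_sum fun i _ => mul_le_mul_of_nonneg_left (h i) (h0 i)
    _ = m := by rw [← Finset.sum_mul, h1, one_mul]

theorem planes (Ω : Set E3) (hΩ : IsConvexPolyhedron Ω) (hne : Ω.Nonempty) :
    ∃ (ι : Type) (_ : Fintype ι) (_ : Nonempty ι) (n : ι → E3) (β : ι → ℝ), (∀ i, ‖n i‖ = 1) ∧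
      (∀ i, ∀ x ∈ closure Ω, ⟪n i, x⟫ ≤ β i) ∧ ∀ z ∈ frontier Ω, ∃ i, ⟪n i, z⟫ = β i := by
  classical
  obtain ⟨hO, hB, hC, S, hS⟩ := hΩ
  let Good : Finset E3 → Prop := fun S' => ∃ (n : E3) (β : ℝ), ‖n‖ = 1 ∧ (∀ x ∈ closure Ω, ⟪n, x⟫ ≤ β) ∧ ∀ s ∈ S', ⟪n, s⟫ = β
  let ι := {S' : Finset E3 // S' ∈ S.powerset ∧ Good S'}
  have hK : closure Ω = convexHull ℝ (S : Set E3) := by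
    have h1 : IsClosed (convexHull ℝ (S : Set E3)) := (Set.Finite.isCompact_convexHull ℝ S.finite_toSet).isClosed
    rw [hS, Convex.closure_interior_eq_closure_of_nonempty_interior (convex_convexHull ℝ _) (hS ▸ hne), h1.closure_eq]
  have key : ∀ z ∈ frontier Ω, ∃ i : ι, ∀ (n : E3) (β : ℝ), (∀ s ∈ i.1, ⟪n, s⟫ = β) → ⟪n, z⟫ = β := by
    intro z hz
    have hzO : z ∉ Ω := by rw [hO.frontier_eq] at hz; exact hz.2
    have hzc : z ∈ closure Ω := frontier_subset_closure hz
    obtain ⟨F, hF⟩ := geometric_hahn_banach_open_point hC hO hzO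
    obtain ⟨m, hm⟩ : ∃ m : E3, ∀ x, F x = ⟪m, x⟫ := ⟨(InnerProductSpace.toDual ℝ E3).symm F, fun x => by
      rw [InnerProductSpace.toDual_symm_apply]⟩
    have hm0 : m ≠ 0 := by
      rintro rfl
      obtain ⟨a, ha⟩ := hne
      have := hF a ha
      rw [hm, hm] at this; simp at this
    have hmp : 0 < ‖m‖ := norm_pos_iff.2 hm0
    have hle : ∀ x ∈ closure Ω, ⟪m, x⟫ ≤ ⟪m, z⟫ := by
      have : closure Ω ⊆ {x | ⟪m, x⟫ ≤ ⟪m, z⟫} := closure_minimal (fun x hx => by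
        have := hF x hx; rw [hm, hm] at this; exact this.le) (isClosed_le (by fun_prop) (by fun_prop))
      exact this
    rw [hK, Finset.mem_convexHull'] at hzc
    obtain ⟨w, hw0, hw1, hwz⟩ := hzc
    have hin : ∀ q : E3, ⟪q, z⟫ = ∑ y ∈ S, w y * ⟪q, y⟫ := by
      intro q; rw [← hwz, inner_sum]; simp_rw [real_inner_smul_right]
    have hz0 : ∀ y ∈ S, w y * (⟪m, z⟫ - ⟪m, y⟫) = 0 := by
      apply (Finset.sum_eq_zero_iff_of_nonneg _).1
      · simp_rw [mul_sub]
        rw [Finset.sum_sub_distrib, ← Finset.sum_mul, hw1, ← hin, one_mul, sub_self]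
      · intro y hy
        refine mul_nonneg (hw0 y hy) (sub_nonneg.2 (hle y ?_))
        rw [hK]; exact subset_convexHull ℝ _ hy
    refine ⟨⟨S.filter (fun y => w y ≠ 0), Finset.mem_powerset.2 (Finset.filter_subset _ _), (‖m‖⁻¹) • m, ‖m‖⁻¹ * ⟪m, z⟫, ?_, ?_, ?_⟩, ?_⟩
    · rw [norm_smul, norm_inv, norm_norm, inv_mul_cancel₀ hmp.ne']
    · intro x hx
      rw [real_inner_smul_left]
      exact mul_le_mul_of_nonneg_left (hle x hx) (by positivity)
    · intro s hs
      rw [Finset.mem_filter] at hs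
      have := (mul_eq_zero.1 (hz0 s hs.1)).resolve_left hs.2
      rw [real_inner_smul_left, sub_eq_zero.1 this]
    · intro n β hn
      rw [hin]
      calc ∑ y ∈ S, w y * ⟪n, y⟫ = ∑ y ∈ S, w y * β := by
            refine Finset.sum_congr rfl fun y hy => ?_
            by_cases h : w y = 0
            · rw [h, zero_mul, zero_mul]
            · rw [hn y (Finset.mem_filter.2 ⟨hy, h⟩)]
        _ = β := by rw [← Finset.sum_mul, hw1, one_mul]
  have hfin : Finite ι := Set.Finite.to_subtype (S.powerset.finite_toSet.subset fun x hx => hx.1)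
  have hfr : (frontier Ω).Nonempty := by
    rw [nonempty_frontier_iff]
    refine ⟨hne, ?_⟩
    rintro rfl
    exact NormedSpace.unbounded_univ ℝ E3 hB
  obtain ⟨z0, hz0⟩ := hfr
  choose n β h1 h2 h3 using fun i : ι => i.2.2
  refine ⟨ι, Fintype.ofFinite ι, ⟨(key z0 hz0).choose⟩, n, β, h1, h2, ?_⟩
  intro z hz
  obtain ⟨i, hi⟩ := key z hz
  exact ⟨i, hi _ _ (h3 i)⟩

structure IsWt (Ω : Set E3) (A h κ : ℝ) (x0 : E3) (φ : E3 → ℝ) (G : E3 → E3) (Λ : E3 → ℝ) : Prop where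
  pos : ∀ x ∈ closure Ω, 0 < φ x
  cont : ContinuousOn φ (closure Ω)
  contG : ContinuousOn G (closure Ω)
  lip : ∀ j, ∃ K, LipschitzOnWith K (fun x => ⟪G x, ej j⟫) (closure Ω)
  dv : ∃ L : Fin 3 → E3 → ℝ, (∀ j, ContinuousOn (L j) (closure Ω)) ∧ (∀ x, Λ x = ∑ j, L j x) ∧
    ∀ j, ∀ x ∈ Ω, HasLineDerivAt ℝ (fun x => ⟪G x, ej j⟫) (-(L j x)) x (ej j)
  nonneg : ∀ x ∈ closure Ω, 0 ≤ Λ x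
  osc : ∀ x ∈ closure Ω, ∀ a ∈ closure Ω, ‖a - x‖ ≤ h → |φ a - φ x| ≤ A / κ * φ x
  taylor : ∀ x ∈ closure Ω, ∀ a ∈ closure Ω, ‖a - x‖ ≤ h → (φ a - φ x - ⟪G x, a - x⟫) ^ 2 ≤ A / κ ^ 2 * h ^ 2 * (φ x * Λ x)
  near : ∀ x ∈ closure Ω, ‖x - x0‖ ≤ κ * h / 2 → 1 / (A * (κ * h) ^ 3) ≤ Λ x
  strip : ∃ ψ : E3 → ℝ, Integrable ψ ∧ (∀ x, 0 ≤ ψ x) ∧ ∫ x, ψ x ≤ A * κ * h ^ 2 ∧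
    ∀ x ∈ closure Ω, (∃ z ∈ frontier Ω, ‖x - z‖ ≤ h) → φ x ≤ ψ x

set_option maxHeartbeats 1000000 in
theorem weight (Ω : Set E3) (hΩ : IsConvexPolyhedron Ω) (hne : Ω.Nonempty) :
    ∃ A : ℝ, 64 ≤ A ∧ ∀ h κ : ℝ, 0 < h → 64 ≤ κ → ∀ x0 ∈ closure Ω, ∃ φ G Λ, IsWt Ω A h κ x0 φ G Λ := by
  obtain ⟨ι, _, _, n, β, hn, hle, hcov⟩ := planes Ω hΩ hne
  obtain ⟨hO, hB, hC, -⟩ := hΩ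
  obtain ⟨N, hN⟩ : ∃ N : ℝ, N = Fintype.card ι := ⟨_, rfl⟩
  have hN0 : 0 < N := by rw [hN]; exact_mod_cast Fintype.card_pos
  obtain ⟨A, hA⟩ : ∃ A : ℝ, A = 25 * 10 ^ 8 + 768 * N + 40 * N * kI ^ 2 := ⟨_, rfl⟩
  have hkI : 0 ≤ kI ^ 2 := sq_nonneg _
  have hNk : 0 ≤ N * kI ^ 2 := by positivity
  have hA1 : 25 * 10 ^ 8 ≤ A := by rw [hA]; linarith
  have hA2 : 768 * N ≤ A := by rw [hA]; linarith
  have hA3 : 40 * N * kI ^ 2 ≤ A := by rw [hA]; linarith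
  refine ⟨A, by linarith, ?_⟩
  intro h κ hh hκ x0 hx0
  have hκ0 : 0 < κ := by linarith
  obtain ⟨s, hs⟩ : ∃ s, s = κ * h := ⟨_, rfl⟩
  have hsp : 0 < s := by rw [hs]; positivity
  have hhs : h ≤ s / 16 := by rw [hs]; nlinarith
  have hhs' : h ≤ s := by linarith
  set D : ι → ℝ := fun i => β i + s - ⟪n i, x0⟫ with hDdef
  have hD : ∀ i, s ≤ D i := fun i => by have := hle i x0 hx0; simp only [hDdef]; linarith
  have hwl : ∀ i x, wl x0 (n i) (D i) x = β i + s - ⟪n i, x⟫ := fun i x => by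
    simp only [wl, hDdef, inner_sub_right]; ring
  have hl : ∀ i, ∀ x ∈ closure Ω, s ≤ wl x0 (n i) (D i) x := fun i x hx => by
    rw [hwl]; have := hle i x hx; linarith
  set f : E3 → ι → ℝ := fun x i => wf x0 (n i) (D i) s x with hf
  set g : E3 → ι → E3 := fun x i => wfg x0 (n i) (D i) s x with hg
  set k : E3 → E3 → ι → ℝ := fun x e i => wfh x0 (n i) (D i) s x e with hk
  set γ : E3 → ι → ℝ := fun x i => wγ x0 (n i) (D i) s x with hγ
  have fpos : ∀ x ∈ closure Ω, ∀ i, 0 < f x i := fun x hx i => wf_pos x0 (n i) (hn i) hsp (hD i) x (hl i x hx)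
  have fC : ∀ i, ContDiff ℝ 2 (fun x => f x i) := fun i => (wU_contDiff x0 hsp _).sub (wU_contDiff _ hsp _)
  have gC : ∀ i, ContDiff ℝ 2 (fun x => g x i) := fun i => (wUg_contDiff x0 hsp _).sub (wUg_contDiff _ hsp _)
  have kC : ∀ e i, Continuous (fun x => k x e i) := fun e i => (wUh_cont x0 hsp _ e).sub (wUh_cont _ hsp _ e)
  have iC : ∀ i, ContDiffOn ℝ 2 (fun x => (f x i)⁻¹) (closure Ω) := fun i =>
    (fC i).contDiffOn.inv fun x hx => (fpos x hx i).ne'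
  have sC : ContDiffOn ℝ 2 (fun x => smin (f x)) (closure Ω) := by
    refine ContDiffOn.inv (ContDiffOn.sum fun i _ => iC i) fun x hx => ?_
    exact (inv_pos.1 (smin_pos (fpos x hx))).ne'
  have GC : ContDiffOn ℝ 2 (fun x => smG (f x) (g x)) (closure Ω) := by
    refine (sC.pow 2).smul (ContDiffOn.sum fun i _ => ((iC i).pow 2).smul (gC i).contDiffOn)
  have hcomp : IsCompact (closure Ω) := hB.isCompact_closure
  set L : Fin 3 → E3 → ℝ := fun j x => -(smH (f x) (fun i => ⟪g x i, ej j⟫) (k x (ej j))) with hL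
  have hΛ : ∀ x ∈ closure Ω, ∑ j, L j x = smin (f x) * (∑ i, (smin (f x) * (f x i)⁻¹) * ((-∑ j, k x (ej j) i) / f x i)
        + 2 * ∑ i, (smin (f x) * (f x i)⁻¹) * ‖(f x i)⁻¹ • g x i - ∑ l, (smin (f x) * (f x l)⁻¹) • (f x l)⁻¹ • g x l‖ ^ 2) := by
    intro x hx
    rw [← smH_lap (fpos x hx) (g x) (fun i j => k x (ej j) i), ← Finset.sum_neg_distrib]
  have hlap : ∀ x ∈ closure Ω, ∀ i, s ^ 2 / 24 * γ x i ^ 2 ≤ (-∑ j, k x (ej j) i) / f x i := by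
    intro x hx i
    rw [le_div_iff₀ (fpos x hx i)]
    have := wf_lap x0 (n i) (hn i) hsp (hD i) x (hl i x hx)
    linarith
  have hμ0 : ∀ x ∈ closure Ω, ∀ i, 0 ≤ smin (f x) * (f x i)⁻¹ := fun x hx i =>
    mul_nonneg (smin_pos (fpos x hx)).le (inv_nonneg.2 (fpos x hx i).le)
  have hQV : ∀ x ∈ closure Ω, smin (f x) * (s ^ 2 / 24 * (∑ i, (smin (f x) * (f x i)⁻¹) * γ x i ^ 2)
        + 2 * ∑ i, (smin (f x) * (f x i)⁻¹) * ‖(f x i)⁻¹ • g x i - ∑ l, (smin (f x) * (f x l)⁻¹) • (f x l)⁻¹ • g x l‖ ^ 2) ≤ ∑ j, L j x := by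
    intro x hx
    rw [hΛ x hx]
    refine mul_le_mul_of_nonneg_left (add_le_add_left ?_ _) (smin_pos (fpos x hx)).le
    rw [Finset.mul_sum]
    refine Finset.sum_le_sum fun i _ => ?_
    calc _ = (smin (f x) * (f x i)⁻¹) * (s ^ 2 / 24 * γ x i ^ 2) := by ring
      _ ≤ _ := mul_le_mul_of_nonneg_left (hlap x hx i) (hμ0 x hx i)
  have hQ0 : ∀ x ∈ closure Ω, 0 ≤ ∑ i, (smin (f x) * (f x i)⁻¹) * γ x i ^ 2 := fun x hx =>
    Finset.sum_nonneg fun i _ => mul_nonneg (hμ0 x hx i) (sq_nonneg _)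
  have hV0 : ∀ x ∈ closure Ω, 0 ≤ ∑ i, (smin (f x) * (f x i)⁻¹) * ‖(f x i)⁻¹ • g x i - ∑ l, (smin (f x) * (f x l)⁻¹) • (f x l)⁻¹ • g x l‖ ^ 2 := fun x hx =>
    Finset.sum_nonneg fun i _ => mul_nonneg (hμ0 x hx i) (sq_nonneg _)
  have hη : ∀ x ∈ closure Ω, ∀ a ∈ closure Ω, ‖a - x‖ ≤ h → ∀ i, |(f a i - f x i) / f x i| ≤ 16 / κ := by
    intro x hx a ha hax i
    have h1 := (wf_taylor x0 (n i) (hn i) hsp (hD i) (hl i x hx) (hl i a ha) (hax.trans hhs)).1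
    have fp := fpos x hx i
    rw [abs_div, abs_of_pos fp, div_le_iff₀ fp]
    refine h1.trans (mul_le_mul_of_nonneg_right ?_ fp.le)
    calc 16 / s * ‖a - x‖ ≤ 16 / s * h := mul_le_mul_of_nonneg_left hax (by positivity)
      _ = 16 / κ := by rw [hs]; field_simp
  refine ⟨fun x => smin (f x), fun x => smG (f x) (g x), fun x => ∑ j, L j x, ?_⟩
  constructor
  · exact fun x hx => smin_pos (fpos x hx)
  · exact sC.continuousOn
  · exact GC.continuousOn
  · intro j
    have : ContDiffOn ℝ 2 (fun x => ⟪smG (f x) (g x), ej j⟫) (closure Ω) := GC.inner ℝ contDiffOn_const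
    exact this.exists_lipschitzOnWith two_ne_zero hC.closure hcomp
  · refine ⟨L, ?_, fun x => rfl, ?_⟩
    · intro j
      have c1 : ∀ i, ContinuousOn (fun x => (f x i)⁻¹) (closure Ω) := fun i => (iC i).continuousOn
      have c2 : ∀ i, Continuous (fun x => ⟪g x i, ej j⟫) := fun i => (gC i).continuous.inner continuous_const
      have c3 := sC.continuousOn
      refine ContinuousOn.neg (ContinuousOn.add ?_ ?_)
      · exact ((c3.pow 3).const_mul 2 |>.congr fun x _ => rfl).mul
          ((continuousOn_finsetSum _ fun i _ => ((c1 i).pow 2).mul (c2 i).continuousOn).pow 2)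
      · refine (c3.pow 2).mul (continuousOn_finsetSum _ fun i _ => ?_)
        exact (((c1 i).pow 2).mul (kC (ej j) i).continuousOn).sub
          ((((c1 i).pow 3).mul ((c2 i).continuousOn.pow 2)).const_mul 2)
    · intro j x hx
      have hxc := subset_closure hx
      have := smG_deriv (ι := ι) (f := fun i t => f (x + t • ej j) i) (g := fun i t => ⟪g (x + t • ej j) i, ej j⟫)
        (k := fun i t => k (x + t • ej j) (ej j) i) (t := 0) (fun i => by simpa using fpos x hxc i)
        (fun i => wf_deriv x0 (n i) hsp x (ej j) 0) (fun i => wf_deriv2 x0 (n i) hsp x (ej j) 0)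
      simp only [← smG_inner] at this
      refine HasDerivAt.congr_deriv this ?_
      simp only [hL, neg_neg, zero_smul, add_zero]
  · intro x hx
    refine le_trans ?_ (hQV x hx)
    have := hQ0 x hx
    have := hV0 x hx
    have := smin_pos (fpos x hx)
    positivity
  · intro x hx a ha hax
    have fp := smin_pos (fpos x hx)
    have hk1 : 16 / κ ≤ 1 / 4 := by rw [div_le_iff₀ hκ0]; linarith
    rw [smin_scale (fpos x hx) (fpos a ha)]
    have hμ1 := smin_sum (fpos x hx)
    have h1 := hη x hx a ha hax
    have hμ := hμ0 x hx
    obtain ⟨B, hB⟩ : ∃ B, B = ∑ i, smin (f x) * (f x i)⁻¹ * (1 + (f a i - f x i) / f x i)⁻¹ := ⟨_, rfl⟩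
    rw [← hB]
    obtain ⟨q, hq⟩ : ∃ q, q = 16 / κ := ⟨_, rfl⟩
    rw [← hq] at hk1 h1
    have hq0 : 0 < q := by rw [hq]; positivity
    have lo : (1 + q)⁻¹ ≤ B := by
      rw [hB]
      refine wavg_le hμ hμ1 fun i => ?_
      have := abs_le.1 (h1 i)
      exact inv_anti₀ (by linarith) (by linarith)
    have hi : B ≤ (1 - q)⁻¹ := by
      rw [hB]
      refine le_wavg hμ hμ1 fun i => ?_
      have := abs_le.1 (h1 i)
      exact inv_anti₀ (by linarith) (by linarith)
    have hBp : 0 < B := lt_of_lt_of_le (by positivity) lo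
    have lo' : B⁻¹ ≤ 1 + q := inv_le_of_inv_le₀ (by positivity) lo
    have hi' : 1 - q ≤ B⁻¹ := (le_inv_comm₀ hBp (by linarith)).1 hi
    have e : smin (f x) * B⁻¹ - smin (f x) = (B⁻¹ - 1) * smin (f x) := by ring
    rw [e, abs_mul, abs_of_pos fp]
    refine mul_le_mul_of_nonneg_right ?_ fp.le
    have : q ≤ A / κ := by rw [hq]; exact div_le_div_of_nonneg_right (by linarith) hκ0.le
    rw [abs_le]; constructor <;> linarith
  · intro x hx a ha hax
    have fp := smin_pos (fpos x hx)
    have st := softmin_taylor (fun i => smin (f x) * (f x i)⁻¹) (hμ0 x hx) (smin_sum (fpos x hx)) (fun i => (f x i)⁻¹ • g x i)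
      (γ x) (fun i => (f a i - f x i) / f x i) (fun i => (wγ_pos x0 (n i) (D i) hsp x (hl i x hx)).le) (a - x) hh hκ hax (hη x hx a ha hax) (by
        intro i
        have h2 := (wf_taylor x0 (n i) (hn i) hsp (hD i) (hl i x hx) (hl i a ha) (hax.trans hhs)).2
        have fpi := fpos x hx i
        have e : (f a i - f x i) / f x i - ⟪(f x i)⁻¹ • g x i, a - x⟫ = (f a i - f x i - ⟪g x i, a - x⟫) / f x i := by
          rw [real_inner_smul_left]; field_simp
        rw [e, abs_div, abs_of_pos fpi, div_le_iff₀ fpi]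
        refine h2.trans ?_
        have g0 := (wγ_pos x0 (n i) (D i) hsp x (hl i x hx)).le
        have : ‖a - x‖ ^ 2 ≤ h ^ 2 := pow_le_pow_left₀ (norm_nonneg _) hax 2
        calc _ = 288 * γ x i * ‖a - x‖ ^ 2 * f x i := by simp only [hf, hγ]; ring
          _ ≤ 288 * γ x i * h ^ 2 * f x i := by
            exact mul_le_mul_of_nonneg_right (mul_le_mul_of_nonneg_left this (by positivity)) fpi.le)
    have hq := hQV x hx
    have hq0 := hQ0 x hx
    have hv0 := hV0 x hx
    have eG : smG (f x) (g x) = smin (f x) • ∑ i, (smin (f x) * (f x i)⁻¹) • (f x i)⁻¹ • g x i := by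
      rw [smG, Finset.smul_sum, Finset.smul_sum]
      refine Finset.sum_congr rfl fun l _ => ?_
      simp only [smul_smul]; congr 1; ring
    rw [smin_scale (fpos x hx) (fpos a ha), eG, real_inner_smul_left]
    obtain ⟨Q, hQ⟩ : ∃ Q, Q = ∑ i, (smin (f x) * (f x i)⁻¹) * γ x i ^ 2 := ⟨_, rfl⟩
    obtain ⟨V, hV⟩ : ∃ V, V = ∑ i, (smin (f x) * (f x i)⁻¹) * ‖(f x i)⁻¹ • g x i - ∑ l, (smin (f x) * (f x l)⁻¹) • (f x l)⁻¹ • g x l‖ ^ 2 := ⟨_, rfl⟩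
    obtain ⟨M, hM⟩ : ∃ M, M = ∑ j, L j x := ⟨_, rfl⟩
    rw [← hQ, ← hV] at st hq
    rw [← hQ] at hq0
    rw [← hV] at hv0
    rw [← hM] at hq ⊢
    obtain ⟨φ, hφ⟩ : ∃ φ, φ = smin (f x) := ⟨_, rfl⟩
    rw [← hφ] at st hq fp ⊢
    obtain ⟨B, hB⟩ : ∃ B, B = (∑ i, φ * (f x i)⁻¹ * (1 + (f a i - f x i) / f x i)⁻¹)⁻¹ := ⟨_, rfl⟩
    obtain ⟨I, hI⟩ : ∃ I, I = ⟪∑ i, (φ * (f x i)⁻¹) • (f x i)⁻¹ • g x i, a - x⟫ := ⟨_, rfl⟩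
    rw [← hB, ← hI] at st ⊢
    have e1 : φ * B - φ - φ * I = φ * (B - 1 - I) := by ring
    rw [e1, mul_pow]
    have hc0 : 0 ≤ h ^ 2 / κ ^ 2 := by positivity
    have hM1 : φ * V + φ * (κ ^ 2 * h ^ 2 * Q) ≤ 25 * M := by
      rw [hs] at hq
      have t1 : 0 ≤ φ * V := by positivity
      have t2 : 0 ≤ φ * (κ ^ 2 * h ^ 2 * Q) := by positivity
      have t3 : φ * ((κ * h) ^ 2 / 24 * Q + 2 * V) = φ * (κ ^ 2 * h ^ 2 * Q) / 24 + 2 * (φ * V) := by ring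
      rw [t3] at hq
      linarith
    calc φ ^ 2 * (B - 1 - I) ^ 2 ≤ φ ^ 2 * (10 ^ 8 * (h ^ 2 / κ ^ 2 * V + h ^ 4 * Q)) := mul_le_mul_of_nonneg_left st (sq_nonneg _)
      _ = 10 ^ 8 * (h ^ 2 / κ ^ 2) * φ * (φ * V + φ * (κ ^ 2 * h ^ 2 * Q)) := by field_simp
      _ ≤ 10 ^ 8 * (h ^ 2 / κ ^ 2) * φ * (25 * M) := mul_le_mul_of_nonneg_left hM1 (by positivity)
      _ = 25 * 10 ^ 8 * (h ^ 2 / κ ^ 2 * (φ * M)) := by ring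
      _ ≤ A * (h ^ 2 / κ ^ 2 * (φ * M)) := by
          refine mul_le_mul_of_nonneg_right hA1 (mul_nonneg hc0 (mul_nonneg fp.le ?_))
          have : 0 ≤ φ * V + φ * (κ ^ 2 * h ^ 2 * Q) := by positivity
          linarith
      _ = _ := by ring
  · intro x hx hxx
    rw [← hs] at hxx ⊢
    have hnr := fun i => wf_near x0 (n i) (hn i) hsp (hD i) x (hl i x hx) hxx
    have fp := smin_pos (fpos x hx)
    have hφ : 1 / (8 * s) / N ≤ smin (f x) := by
      rw [hN]; exact le_smin (by positivity) fun i => (hnr i).1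
    have hq := hQV x hx
    have hv0 := hV0 x hx
    have hQ : 1 / (4 * s ^ 4) ≤ ∑ i, (smin (f x) * (f x i)⁻¹) * γ x i ^ 2 := by
      refine wavg_le (hμ0 x hx) (smin_sum (fpos x hx)) fun i => ?_
      rw [div_le_iff₀ (by positivity)]
      have := pow_le_pow_left₀ (by norm_num) (hnr i).2 2
      have e : (s ^ 2 * wγ x0 (n i) (D i) s x) ^ 2 = γ x i ^ 2 * (4 * s ^ 4) / 4 := by simp only [hγ]; ring
      rw [e] at this; linarith
    calc 1 / (A * s ^ 3) ≤ 1 / (768 * N * s ^ 3) := one_div_le_one_div_of_le (by positivity) (mul_le_mul_of_nonneg_right hA2 (by positivity))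
      _ = (1 / (8 * s) / N) * (s ^ 2 / 24 * (1 / (4 * s ^ 4))) := by field_simp; norm_num
      _ ≤ smin (f x) * (s ^ 2 / 24 * ∑ i, (smin (f x) * (f x i)⁻¹) * γ x i ^ 2) := by
          refine mul_le_mul hφ (mul_le_mul_of_nonneg_left hQ (by positivity)) (by positivity) fp.le
      _ ≤ _ := by
          refine le_trans (mul_le_mul_of_nonneg_left ?_ fp.le) hq
          linarith
  · choose ψ p1 p2 p3 p4 using fun i => slab x0 (n i) (hn i) hsp (hD i) hh hhs'
    refine ⟨fun x => ∑ i, ψ i x, integrable_finsetSum _ fun i _ => p1 i, fun x => Finset.sum_nonneg fun i _ => p2 i x, ?_, ?_⟩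
    · rw [integral_finsetSum _ fun i _ => p1 i]
      calc ∑ i, ∫ x, ψ i x ≤ ∑ i : ι, 40 * kI ^ 2 * (s * h) := Finset.sum_le_sum fun i _ => p3 i
        _ = 40 * N * kI ^ 2 * (κ * h ^ 2) := by
            rw [Finset.sum_const, nsmul_eq_mul, Finset.card_univ, ← hN, hs]; ring
        _ ≤ A * (κ * h ^ 2) := mul_le_mul_of_nonneg_right hA3 (by positivity)
        _ = _ := by ring
    · rintro x hx ⟨z, hz, hxz⟩
      obtain ⟨i, hi⟩ := hcov z hz
      have h1 : wl x0 (n i) (D i) x ≤ s + h := by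
        rw [hwl]
        have : ⟪n i, z - x⟫ ≤ h := by
          calc _ ≤ ‖n i‖ * ‖z - x‖ := real_inner_le_norm _ _
            _ ≤ h := by rw [hn, one_mul, norm_sub_rev]; exact hxz
        rw [inner_sub_right] at this
        linarith
      calc smin (f x) ≤ f x i := smin_le (fpos x hx) i
        _ ≤ ψ i x := p4 i x (hl i x hx) h1
        _ ≤ _ := Finset.single_le_sum (f := fun i => ψ i x) (fun i _ => p2 i x) (Finset.mem_univ i)

def B0 (r : ℕ) (c A : ℝ) : ℝ := A + 2 * Ci r c * A + 2 * A / c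
def B1 (r : ℕ) (c : ℝ) : ℝ := 2 + 4 / c + 2 * Ci r c

theorem sum_smul_le {κ : ℝ} (z : Fin 4 → ℝ) (g : Fin 4 → E3) {b : ℝ} (hz : ∀ a, |z a| ≤ κ) (hg : ∀ a, ‖g a‖ ≤ b) :
    ‖∑ a, z a • g a‖ ≤ 4 * (κ * b) := by
  have hκ : 0 ≤ κ := (abs_nonneg _).trans (hz 0)
  calc _ ≤ ∑ a : Fin 4, κ * b := norm_sum_le_of_le _ fun a _ => by
        rw [norm_smul]; exact mul_le_mul (hz a) (hg a) (norm_nonneg _) hκ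
    _ = _ := by simp

set_option maxHeartbeats 1000000 in
theorem pt_est (r : ℕ) (hr : 1 ≤ r) {Ω : Set E3} {A h κ c : ℝ} (hh : 0 < h) (hc : 0 < c) (hA : 64 ≤ A) (hκ : A ≤ κ) {x0 : E3} {φ : E3 → ℝ}
    {G : E3 → E3} {Λ : E3 → ℝ} (W : IsWt Ω A h κ x0 φ G Λ) {v : Fin 4 → E3} (H : Elt h c v) (hsub : tet v ⊆ closure Ω)
    {q : E3 → ℝ} (hq : q ∈ PP r) (m : ℝ) (hm : ∀ y ∈ tet v, ‖gradient q y‖ ≤ m) {x : E3} (hx : x ∈ tet v) {X : E3}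
    (hX : X = gradient (bern r v (fun ω => cf r q (v ∘ ω) * φ (v (ω ⟨0, hr⟩)))) x) :
    φ x * ‖gradient q x‖ ^ 2 + q x * ⟪gradient q x, G x⟫ - B0 r c A / κ * (φ x * m ^ 2 + q x ^ 2 * Λ x) ≤ ⟪gradient q x, X⟫ ∧
    ((∃ a, q (v a) = 0) → ‖X‖ ≤ B1 r c * (φ x * m)) := by
  have hxc := hsub hx
  have hvc : ∀ a, v a ∈ closure Ω := fun a => hsub (vert_mem v a)
  have hd : ∀ a, ‖v a - x‖ ≤ h := fun a => tet_dist H (vert_mem v a) hx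
  have hosc := fun a => W.osc x hxc (v a) (hvc a) (hd a)
  have htay := fun a => W.taylor x hxc (v a) (hvc a) (hd a)
  have hφ := W.pos x hxc
  have hΛ := W.nonneg x hxc
  have hlm := (mem_tet_iff H.1 x).1 hx
  have hlm1 := lam_sum H.1 x
  have hgx := hm x hx
  have hκ0 : 0 < κ := by linarith
  have hCi := Ci_nonneg r hc
  have hκ1 : A / κ ≤ 1 := by rw [div_le_one hκ0]; exact hκ
  have hAκ : 0 < A / κ := by have : 0 < A := by linarith
                             positivity
  obtain ⟨φ1, hφ1⟩ : ∃ φ1, φ1 = ∑ b, φ (v b) * lam v b x := ⟨_, rfl⟩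
  obtain ⟨gφ, hgφ⟩ : ∃ gφ, gφ = ∑ a, φ (v a) • glam v a := ⟨_, rfl⟩
  have h1 : |φ1 - φ x| ≤ A / κ * φ x := by
    have e : φ1 - φ x = ∑ b, lam v b x * (φ (v b) - φ x) := by
      simp_rw [mul_sub]
      rw [Finset.sum_sub_distrib, ← Finset.sum_mul, hlm1, one_mul, hφ1]
      congr 1; exact Finset.sum_congr rfl fun b _ => mul_comm _ _
    rw [e, abs_le]
    exact ⟨wavg_le hlm hlm1 fun i => (abs_le.1 (hosc i)).1, le_wavg hlm hlm1 fun i => (abs_le.1 (hosc i)).2⟩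
  have ho : ∀ a, |φ (v a) - ∑ b, φ (v b) * lam v b x| ≤ 2 * (A / κ) * φ x := by
    intro a
    rw [← hφ1]
    have := abs_le.1 (hosc a)
    have := abs_le.1 h1
    rw [abs_le]; constructor <;> linarith
  have key := key_local r hr hh hc H hq (fun a => φ (v a)) (2 * (A / κ) * φ x) m hx ho hm
  rw [← hX, ← hφ1, ← hgφ] at key
  obtain ⟨g, hg⟩ : ∃ g, g = gradient q x := ⟨_, rfl⟩
  obtain ⟨w, hw⟩ : ∃ w, w = q x := ⟨_, rfl⟩
  rw [← hg] at key hgx ⊢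
  rw [← hw] at key ⊢
  have hm0 : 0 ≤ m := (norm_nonneg _).trans hgx
  obtain ⟨R, hR⟩ : ∃ R, R = X - φ1 • g - w • gφ := ⟨_, rfl⟩
  rw [← hR] at key
  have eX : X = φ1 • g + w • gφ + R := by rw [hR]; abel
  constructor
  · have hGd : ‖gφ - G x‖ ≤ 4 * (A / κ) / c * (√(φ x) * √(Λ x)) := by
      have e : gφ - G x = ∑ a, (φ (v a) - φ x - ⟪G x, v a - x⟫) • glam v a := by
        simp_rw [sub_smul]
        rw [Finset.sum_sub_distrib, Finset.sum_sub_distrib, glam_repr H.1, ← Finset.smul_sum, glam_sum H.1, smul_zero, sub_zero, hgφ]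
      have hz : ∀ a, |φ (v a) - φ x - ⟪G x, v a - x⟫| ≤ A / κ * h * (√(φ x) * √(Λ x)) := by
        intro a
        apply abs_le_of_sq_le_sq _ (by positivity)
        refine (htay a).trans ?_
        rw [mul_pow, mul_pow, mul_pow, Real.sq_sqrt hφ.le, Real.sq_sqrt hΛ]
        have : A / κ ^ 2 ≤ (A / κ) ^ 2 := by
          rw [div_pow]; exact div_le_div_of_nonneg_right (by nlinarith) (by positivity)
        exact mul_le_mul_of_nonneg_right (mul_le_mul_of_nonneg_right this (by positivity)) (mul_nonneg hφ.le hΛ)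
      rw [e]
      refine (sum_smul_le _ _ hz (fun a => glam_norm hh hc H a)).trans (le_of_eq ?_)
      field_simp
    have t0 : ⟪g, X⟫ = φ1 * ‖g‖ ^ 2 + w * ⟪g, G x⟫ + w * ⟪g, gφ - G x⟫ + ⟪g, R⟫ := by
      rw [eX, inner_add_right, inner_add_right, real_inner_smul_right, real_inner_smul_right, inner_sub_right, real_inner_self_eq_norm_sq]
      ring
    have g2 : ‖g‖ ^ 2 ≤ m ^ 2 := pow_le_pow_left₀ (norm_nonneg _) hgx 2
    have t1 : φ x * ‖g‖ ^ 2 - A / κ * (φ x * m ^ 2) ≤ φ1 * ‖g‖ ^ 2 := by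
      have a1 := (abs_le.1 h1).1
      have a2 : (φ x - A / κ * φ x) * ‖g‖ ^ 2 ≤ φ1 * ‖g‖ ^ 2 := mul_le_mul_of_nonneg_right (by linarith) (sq_nonneg _)
      have a3 : A / κ * φ x * ‖g‖ ^ 2 ≤ A / κ * φ x * m ^ 2 := mul_le_mul_of_nonneg_left g2 (by positivity)
      linarith
    have t2 : |w * ⟪g, gφ - G x⟫| ≤ 2 * (A / κ) / c * (φ x * m ^ 2 + w ^ 2 * Λ x) := by
      rw [abs_mul]
      have b1 : |⟪g, gφ - G x⟫| ≤ m * (4 * (A / κ) / c * (√(φ x) * √(Λ x))) :=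
        (abs_real_inner_le_norm _ _).trans (mul_le_mul hgx hGd (norm_nonneg _) hm0)
      have b2 : 2 * ((√(φ x) * m) * (√(Λ x) * |w|)) ≤ φ x * m ^ 2 + w ^ 2 * Λ x := by
        have := two_mul_le_add_sq (√(φ x) * m) (√(Λ x) * |w|)
        rw [mul_pow, mul_pow, Real.sq_sqrt hφ.le, Real.sq_sqrt hΛ, sq_abs] at this
        linarith
      calc |w| * |⟪g, gφ - G x⟫| ≤ |w| * (m * (4 * (A / κ) / c * (√(φ x) * √(Λ x)))) := mul_le_mul_of_nonneg_left b1 (abs_nonneg _)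
        _ = 2 * (A / κ) / c * (2 * ((√(φ x) * m) * (√(Λ x) * |w|))) := by ring
        _ ≤ _ := mul_le_mul_of_nonneg_left b2 (by positivity)
    have t3 : |⟪g, R⟫| ≤ 2 * Ci r c * (A / κ) * (φ x * m ^ 2) := by
      calc _ ≤ ‖g‖ * ‖R‖ := abs_real_inner_le_norm _ _
        _ ≤ m * (Ci r c * (2 * (A / κ) * φ x) * m) := mul_le_mul hgx key (norm_nonneg _) hm0
        _ = _ := by ring
    have t2' := (abs_le.1 t2).1
    have t3' := (abs_le.1 t3).1
    have eB : B0 r c A / κ * (φ x * m ^ 2 + w ^ 2 * Λ x) = A / κ * (φ x * m ^ 2) + 2 * Ci r c * (A / κ) * (φ x * m ^ 2)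
        + 2 * (A / κ) / c * (φ x * m ^ 2 + w ^ 2 * Λ x) + (A / κ + 2 * Ci r c * (A / κ)) * (w ^ 2 * Λ x) := by
      rw [B0]; ring
    have eB2 : 0 ≤ (A / κ + 2 * Ci r c * (A / κ)) * (w ^ 2 * Λ x) := by positivity
    rw [t0, eB]
    linarith
  · rintro ⟨a, ha⟩
    have hwm : |w| ≤ m * h := by
      have := mean_val hq (tet_convex v) m hm (vert_mem v a) hx
      rw [ha, sub_zero, ← hw] at this
      refine this.trans (mul_le_mul_of_nonneg_left ?_ hm0)
      exact tet_dist H hx (vert_mem v a)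
    have hgn : ‖gφ‖ ≤ 4 * (φ x * (1 / (c * h))) := by
      have e : gφ = ∑ a, (φ (v a) - φ x) • glam v a := by
        simp_rw [sub_smul]
        rw [Finset.sum_sub_distrib, ← Finset.smul_sum, glam_sum H.1, smul_zero, sub_zero, hgφ]
      rw [e]
      refine sum_smul_le _ _ (fun a => (hosc a).trans ?_) (fun a => glam_norm hh hc H a)
      calc _ ≤ 1 * φ x := mul_le_mul_of_nonneg_right hκ1 hφ.le
        _ = _ := one_mul _
    have n1 : ‖φ1 • g‖ ≤ 2 * φ x * m := by
      rw [norm_smul, Real.norm_eq_abs]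
      refine mul_le_mul ?_ hgx (norm_nonneg _) (by positivity)
      have a1 := abs_le.1 h1
      have a2 : A / κ * φ x ≤ 1 * φ x := mul_le_mul_of_nonneg_right hκ1 hφ.le
      rw [abs_le]; constructor <;> linarith
    have n2 : ‖w • gφ‖ ≤ 4 / c * (φ x * m) := by
      rw [norm_smul, Real.norm_eq_abs]
      calc _ ≤ (m * h) * (4 * (φ x * (1 / (c * h)))) := mul_le_mul hwm hgn (norm_nonneg _) (by positivity)
        _ = _ := by field_simp
    have n3 : ‖R‖ ≤ 2 * Ci r c * (φ x * m) := by
      refine key.trans ?_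
      calc Ci r c * (2 * (A / κ) * φ x) * m = A / κ * (2 * Ci r c * (φ x * m)) := by ring
        _ ≤ 1 * (2 * Ci r c * (φ x * m)) := mul_le_mul_of_nonneg_right hκ1 (by positivity)
        _ = _ := one_mul _
    rw [eX]
    refine (norm_add₃_le).trans ?_
    rw [B1]
    linarith

set_option maxHeartbeats 1000000 in
theorem pt_est2 (r : ℕ) (hr : 1 ≤ r) {Ω : Set E3} {A h κ c : ℝ} (hh : 0 < h) (hc : 0 < c) (hA : 64 ≤ A) (hκ : A ≤ κ) {x0 : E3} {φ : E3 → ℝ}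
    {G : E3 → E3} {Λ : E3 → ℝ} (W : IsWt Ω A h κ x0 φ G Λ) {v : Fin 4 → E3} (H : Elt h c v) (hsub : tet v ⊆ closure Ω)
    {q pu : E3 → ℝ} (hq : q ∈ PP r) (hpu : pu ∈ PP r) (m : ℝ) (hm : ∀ y ∈ tet v, ‖gradient q y‖ ≤ m) {δ : ℝ}
    (hδ : ∀ x ∈ tet v, ‖gradient (fun y => pu y - q y) x‖ ≤ Ci r c * δ / h) {ψ : E3 → ℝ} (hψ0 : ∀ x, 0 ≤ ψ x)
    (hψ : ∀ x ∈ closure Ω, (∃ z ∈ frontier Ω, ‖x - z‖ ≤ h) → φ x ≤ ψ x)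
    (hb : (∃ a, v a ∈ frontier Ω ∧ q (v a) = 0) ∨ pu = q) {x : E3} (hx : x ∈ tet v) :
    φ x * ‖gradient q x‖ ^ 2 + q x * ⟪gradient q x, G x⟫ - (B0 r c A + 1) / κ * (φ x * m ^ 2 + q x ^ 2 * Λ x)
      - κ * (Ci r c * B1 r c) ^ 2 * (δ ^ 2 / h ^ 2) * ψ x
      ≤ ⟪gradient pu x, gradient (bern r v (fun ω => cf r q (v ∘ ω) * φ (v (ω ⟨0, hr⟩)))) x⟫ := by
  obtain ⟨X, hX⟩ : ∃ X, X = gradient (bern r v (fun ω => cf r q (v ∘ ω) * φ (v (ω ⟨0, hr⟩)))) x := ⟨_, rfl⟩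
  obtain ⟨e1, e2⟩ := pt_est r hr hh hc hA hκ W H hsub hq m hm hx hX
  rw [← hX]
  have hxc := hsub hx
  have hφ := W.pos x hxc
  have hΛ := W.nonneg x hxc
  have hκ0 : 0 < κ := by linarith
  have hex : 0 ≤ 1 / κ * (φ x * m ^ 2 + q x ^ 2 * Λ x) := by positivity
  have hsp : (B0 r c A + 1) / κ * (φ x * m ^ 2 + q x ^ 2 * Λ x) = B0 r c A / κ * (φ x * m ^ 2 + q x ^ 2 * Λ x) + 1 / κ * (φ x * m ^ 2 + q x ^ 2 * Λ x) := by ring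
  have hps : 0 ≤ κ * (Ci r c * B1 r c) ^ 2 * (δ ^ 2 / h ^ 2) * ψ x := by have := hψ0 x; positivity
  rw [hsp]
  rcases hb with ⟨a, ha, ha0⟩ | rfl
  · have hX2 := e2 ⟨a, ha0⟩
    have hφψ := hψ x hxc ⟨v a, ha, tet_dist H hx (vert_mem v a)⟩
    have hgd : gradient (fun y => pu y - q y) x = gradient pu x - gradient q x := by
      apply ext_inner_right ℝ
      intro e
      rw [grad_inner, inner_sub_left, grad_inner, grad_inner, fderiv_fun_sub (PP_diff hpu x) (PP_diff hq x)]
      rfl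
    have hd := hδ x hx
    rw [hgd] at hd
    have sp : ⟪gradient pu x, X⟫ = ⟪gradient q x, X⟫ + ⟪gradient pu x - gradient q x, X⟫ := by
      rw [inner_sub_left (gradient pu x)]; ring
    have hl : |⟪gradient pu x - gradient q x, X⟫| ≤ 1 / κ * (φ x * m ^ 2) + κ * (Ci r c * B1 r c) ^ 2 * (δ ^ 2 / h ^ 2) * ψ x := by
      have hd0 : 0 ≤ Ci r c * δ / h := (norm_nonneg _).trans hd
      calc _ ≤ _ := abs_real_inner_le_norm _ _
        _ ≤ (Ci r c * δ / h) * (B1 r c * (φ x * m)) := mul_le_mul hd hX2 (norm_nonneg _) hd0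
        _ = φ x * ((Ci r c * B1 r c * (δ / h)) * m) := by ring
        _ ≤ φ x * (1 / κ * m ^ 2 + κ * (Ci r c * B1 r c * (δ / h)) ^ 2) := by
            refine mul_le_mul_of_nonneg_left ?_ hφ.le
            obtain ⟨y, hy⟩ : ∃ y, y = Ci r c * B1 r c * (δ / h) := ⟨_, rfl⟩
            rw [← hy]
            have s1 : 1 / κ * (m - κ * y) ^ 2 = 1 / κ * m ^ 2 - 2 * (y * m) + κ * y ^ 2 := by field_simp; ring
            have s2 : 1 / κ * (m + κ * y) ^ 2 = 1 / κ * m ^ 2 + 2 * (y * m) + κ * y ^ 2 := by field_simp; ring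
            have s3 : 0 ≤ 1 / κ * (m - κ * y) ^ 2 := by positivity
            have s4 : 0 ≤ 1 / κ * (m + κ * y) ^ 2 := by positivity
            linarith
        _ = 1 / κ * (φ x * m ^ 2) + κ * (Ci r c * B1 r c) ^ 2 * (δ ^ 2 / h ^ 2) * φ x := by ring
        _ ≤ _ := by
            have := mul_le_mul_of_nonneg_left hφψ (show 0 ≤ κ * (Ci r c * B1 r c) ^ 2 * (δ ^ 2 / h ^ 2) by positivity)
            linarith
    have hl' := (abs_le.1 hl).1
    have hqq : 0 ≤ 1 / κ * (q x ^ 2 * Λ x) := by positivity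
    rw [sp]
    linarith
  · linarith

theorem ae_tet {v : Fin 4 → E3} {F f : E3 → ℝ} (hF : ∀ x ∈ interior (tet v), F x = f x) :
    F =ᵐ[volume.restrict (tet v)] f := by
  have h1 : ∀ᵐ x : E3, x ∉ frontier (tet v) :=
    measure_eq_zero_iff_ae_notMem.1 ((tet_convex v).addHaar_frontier volume)
  filter_upwards [ae_restrict_of_ae h1, ae_restrict_mem (tet_compact v).measurableSet] with x hx hx2
  exact hF x (int_of_not_frontier hx2 hx)

theorem IsWt.contL {Ω : Set E3} {A h κ : ℝ} {x0 : E3} {φ : E3 → ℝ}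
    {G : E3 → E3} {Λ : E3 → ℝ} (W : IsWt Ω A h κ x0 φ G Λ) : ContinuousOn Λ (closure Ω) := by
  obtain ⟨L, hL, hs, -⟩ := W.dv
  have : Λ = fun x => ∑ j, L j x := funext hs
  rw [this]
  exact continuousOn_finsetSum _ fun j _ => hL j

set_option maxHeartbeats 1000000 in
theorem elt_est (r : ℕ) (hr : 1 ≤ r) {Ω : Set E3} {A h κ c : ℝ} (hh : 0 < h) (hc : 0 < c) (hA : 64 ≤ A) (hκ : A ≤ κ)
    (hκ2 : (B0 r c A + 1) * (4 * (32 * (Ci r c + 1) ^ 3) + 4) ≤ κ) {x0 : E3} {φ : E3 → ℝ}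
    {G : E3 → E3} {Λ : E3 → ℝ} (W : IsWt Ω A h κ x0 φ G Λ) {v : Fin 4 → E3} (H : Elt h c v) (hsub : tet v ⊆ closure Ω)
    {q pu : E3 → ℝ} (hq : q ∈ PP r) (hpu : pu ∈ PP r) {δ : ℝ}
    (hδ : ∀ x ∈ tet v, ‖gradient (fun y => pu y - q y) x‖ ≤ Ci r c * δ / h) {ψ : E3 → ℝ} (hψi : Integrable ψ) (hψ0 : ∀ x, 0 ≤ ψ x)
    (hψ : ∀ x ∈ closure Ω, (∃ z ∈ frontier Ω, ‖x - z‖ ≤ h) → φ x ≤ ψ x)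
    (hb : (∃ a, v a ∈ frontier Ω ∧ q (v a) = 0) ∨ pu = q) :
    (∫ x in tet v, q x * ⟪gradient q x, G x⟫) - 1 / 4 * (∫ x in tet v, q x ^ 2 * Λ x)
      - κ * (Ci r c * B1 r c) ^ 2 * (δ ^ 2 / h ^ 2) * (∫ x in tet v, ψ x)
      ≤ ∫ x in tet v, ⟪gradient pu x, gradient (bern r v (fun ω => cf r q (v ∘ ω) * φ (v (ω ⟨0, hr⟩)))) x⟫ := by
  have hcp := tet_compact v
  have hms := hcp.measurableSet
  have hgq := grad_cont hq
  have hqc : Continuous q := (PP_diff hq).continuous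
  have hφc := W.cont.mono hsub
  have hGc := W.contG.mono hsub
  have hΛc := W.contL.mono hsub
  have hκ0 : 0 < κ := by linarith
  have hCi := Ci_nonneg r hc
  obtain ⟨y, hy, hym⟩ := hcp.exists_isMaxOn ⟨v 0, vert_mem v 0⟩ (hgq.norm.continuousOn)
  obtain ⟨m, hmd⟩ : ∃ m, m = ‖gradient q y‖ := ⟨_, rfl⟩
  have hm : ∀ z ∈ tet v, ‖gradient q z‖ ≤ m := fun z hz => hmd ▸ hym hz
  have hpt := fun x (hx : x ∈ tet v) => pt_est2 r hr hh hc hA hκ W H hsub hq hpu m hm hδ hψ0 hψ hb hx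
  have hsup := sup_avg_grad r hr hh hc H hq hy
  rw [← hmd] at hsup
  obtain ⟨C3, hC3⟩ : ∃ C3, C3 = 32 * (Ci r c + 1) ^ 3 := ⟨_, rfl⟩
  have hC30 : 0 ≤ C3 := by rw [hC3]; positivity
  rw [← hC3] at hsup hκ2
  have hB0 : 0 ≤ B0 r c A := by rw [B0]; positivity
  have hX : Continuous (gradient (bern r v (fun ω => cf r q (v ∘ ω) * φ (v (ω ⟨0, hr⟩))))) := grad_cont (bern_PP r v _)
  obtain ⟨X, hXd⟩ : ∃ X, X = gradient (bern r v (fun ω => cf r q (v ∘ ω) * φ (v (ω ⟨0, hr⟩)))) := ⟨_, rfl⟩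
  rw [← hXd] at hX hpt ⊢
  have i1 : IntegrableOn (fun x => φ x * ‖gradient q x‖ ^ 2) (tet v) :=
    (hφc.mul ((hgq.norm.pow 2).continuousOn)).integrableOn_compact hcp
  have i2 : IntegrableOn (fun x => q x * ⟪gradient q x, G x⟫) (tet v) :=
    (hqc.continuousOn.mul (hgq.continuousOn.inner hGc)).integrableOn_compact hcp
  have i3 : IntegrableOn (fun x => φ x * m ^ 2) (tet v) := (hφc.mul continuousOn_const).integrableOn_compact hcp
  have i4 : IntegrableOn (fun x => q x ^ 2 * Λ x) (tet v) := ((hqc.pow 2).continuousOn.mul hΛc).integrableOn_compact hcp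
  have i5 : IntegrableOn ψ (tet v) := hψi.integrableOn
  have i6 : IntegrableOn (fun x => ⟪gradient pu x, X x⟫) (tet v) :=
    ((grad_cont hpu).inner hX).continuousOn.integrableOn_compact hcp
  have i7 : IntegrableOn (fun x => ‖gradient q x‖ ^ 2) (tet v) := (hgq.norm.pow 2).continuousOn.integrableOn_compact hcp
  obtain ⟨k1, hk1⟩ : ∃ k1, k1 = (B0 r c A + 1) / κ := ⟨_, rfl⟩
  obtain ⟨k2, hk2⟩ : ∃ k2, k2 = κ * (Ci r c * B1 r c) ^ 2 * (δ ^ 2 / h ^ 2) := ⟨_, rfl⟩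
  rw [← hk1, ← hk2] at hpt
  rw [← hk2]
  have hk10 : 0 ≤ k1 := by rw [hk1]; positivity
  have hk14 : k1 ≤ 1 / 4 := by
    rw [hk1, div_le_iff₀ hκ0]
    have : 0 ≤ (B0 r c A + 1) * C3 := by positivity
    linarith
  have hk1C : k1 * (4 * C3) ≤ 1 := by
    rw [hk1, div_mul_eq_mul_div, div_le_one hκ0]
    linarith
  have hI := setIntegral_mono_on ((((i1.add i2).sub ((i3.add i4).const_mul k1)).sub (i5.const_mul k2))) i6 hms hpt
  have e1 := integral_sub ((i1.add i2).sub ((i3.add i4).const_mul k1)) (i5.const_mul k2)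
  have e2 := integral_sub (i1.add i2) ((i3.add i4).const_mul k1)
  have e3 := integral_add i1 i2
  have e4 := integral_add i3 i4
  have e5 := integral_const_mul (μ := volume.restrict (tet v)) k1 (fun x => φ x * m ^ 2 + q x ^ 2 * Λ x)
  have e6 := integral_const_mul (μ := volume.restrict (tet v)) k2 ψ
  have hosc : ∀ x ∈ tet v, φ x ≤ 2 * φ (v 0) ∧ φ (v 0) ≤ 2 * φ x := by
    intro x hx
    have hv0 := vert_mem v 0
    have hκ1 : A / κ ≤ 1 := by rw [div_le_one hκ0]; exact hκ
    have a1 := abs_le.1 (W.osc x (hsub hx) _ (hsub hv0) (tet_dist H hv0 hx))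
    have a2 := abs_le.1 (W.osc _ (hsub hv0) x (hsub hx) (tet_dist H hx hv0))
    have b1 := mul_le_mul_of_nonneg_right hκ1 (W.pos x (hsub hx)).le
    have b2 := mul_le_mul_of_nonneg_right hκ1 (W.pos _ (hsub hv0)).le
    constructor <;> linarith
  have hφ0 := W.pos _ (hsub (vert_mem v 0))
  have j1 : ∫ x in tet v, φ x * m ^ 2 ≤ 2 * φ (v 0) * (m ^ 2 * volume.real (tet v)) := by
    have := setIntegral_mono_on i3 (g := fun _ => 2 * φ (v 0) * m ^ 2) (integrableOn_const hcp.measure_lt_top.ne) hms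
      (fun x hx => mul_le_mul_of_nonneg_right (hosc x hx).1 (sq_nonneg m))
    rw [setIntegral_const, smul_eq_mul] at this
    linarith
  have j2 : φ (v 0) * ∫ x in tet v, ‖gradient q x‖ ^ 2 ≤ 2 * ∫ x in tet v, φ x * ‖gradient q x‖ ^ 2 := by
    rw [← integral_const_mul, ← integral_const_mul]
    refine setIntegral_mono_on (i7.const_mul _) (i1.const_mul _) hms fun x hx => ?_
    have := mul_le_mul_of_nonneg_right (hosc x hx).2 (sq_nonneg ‖gradient q x‖)
    linarith
  have j3 : ∫ x in tet v, φ x * m ^ 2 ≤ 4 * C3 * ∫ x in tet v, φ x * ‖gradient q x‖ ^ 2 := by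
    have := mul_le_mul_of_nonneg_left hsup (show 0 ≤ 2 * φ (v 0) by positivity)
    have := mul_le_mul_of_nonneg_left j2 hC30
    linarith
  have n1 : 0 ≤ ∫ x in tet v, φ x * ‖gradient q x‖ ^ 2 :=
    setIntegral_nonneg hms fun x hx => mul_nonneg (W.pos x (hsub hx)).le (sq_nonneg _)
  have n4 : 0 ≤ ∫ x in tet v, q x ^ 2 * Λ x :=
    setIntegral_nonneg hms fun x hx => mul_nonneg (sq_nonneg _) (W.nonneg x (hsub hx))
  have j4 := mul_le_mul_of_nonneg_left j3 hk10
  have j5 := mul_le_mul_of_nonneg_right hk1C n1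
  have j6 := mul_le_mul_of_nonneg_right hk14 n4
  simp only [Pi.add_apply, Pi.sub_apply] at hI e1 e2 e3 e4 e5 e6
  have f1 : k1 * ∫ x in tet v, (φ x * m ^ 2 + q x ^ 2 * Λ x) = k1 * (∫ x in tet v, φ x * m ^ 2) + k1 * ∫ x in tet v, q x ^ 2 * Λ x := by
    rw [e4]; ring
  linarith

set_option maxHeartbeats 2000000 in
theorem main_est (r : ℕ) (hr : 1 ≤ r) {Ω : Set E3} (hO : IsOpen Ω) (hC : Convex ℝ Ω) (hB : Bornology.IsBounded Ω) {T : Finset (Fin 4 → E3)}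
    {A h κ c : ℝ} (hh : 0 < h) (hc : 0 < c) (hP : IsTetPartition Ω T h c) (hinj : Set.InjOn tet (T : Set (Fin 4 → E3)))
    (hA : 64 ≤ A) (hκ : A ≤ κ)
    (hκ2 : (B0 r c A + 1) * (4 * (32 * (Ci r c + 1) ^ 3) + 4) ≤ κ) {x0 : E3} (hx0 : x0 ∈ closure Ω) {φ : E3 → ℝ}
    {G : E3 → E3} {Λ : E3 → ℝ} (W : IsWt Ω A h κ x0 φ G Λ) (u : E3 → ℝ) (hu : MemSh Ω T r u) (δ : ℝ) (hδ0 : 0 ≤ δ)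
    (hδ : ∀ x ∈ frontier Ω, |u x| ≤ δ)
    (hharm : ∀ χ : E3 → ℝ, MemSh0 Ω T r χ → ∫ x in Ω, ⟪gradient u x, gradient χ x⟫ = 0) :
    |u x0| ≤ (√((32 * (Ci r c + 1) ^ 3) * (A * κ ^ 3) / c ^ 3 * (4 * (κ * (Ci r c * B1 r c) ^ 2 * (A * κ)))) + CR r) * δ := by
  obtain ⟨w, χ, hχ, hwc, hw0, huw, hloc⟩ := fe_setup r hr hO hC hh hc hP hinj u hu δ hδ0 hδ φ
  obtain ⟨ψ, hψi, hψ0, hψI, hψ⟩ := W.strip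
  have hE : ∀ v ∈ T, Elt h c v := fun v hv => ⟨hP.1 v hv, hP.2.2.2.2.1 v hv, hP.2.2.2.2.2 v hv⟩
  have hκ0 : 0 < κ := by linarith
  have hcl : IsCompact (closure Ω) := hB.isCompact_closure
  have hs : ∀ v ∈ T, tet v ⊆ closure Ω := fun v hv => tet_sub hP hv
  -- local facts
  have hlocI : ∀ v ∈ T, IntegrableOn (fun x => ⟪gradient u x, gradient χ x⟫) (tet v) ∧
      IntegrableOn (fun x => w x * ⟪gradient w x, G x⟫) (tet v) ∧
      (∀ j, IntegrableOn (fun x => 2 * w x * fderiv ℝ w x (ej j) * ⟪G x, ej j⟫) (tet v)) ∧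
      (∫ x in tet v, w x * ⟪gradient w x, G x⟫) - 1 / 4 * (∫ x in tet v, w x ^ 2 * Λ x)
      - κ * (Ci r c * B1 r c) ^ 2 * (δ ^ 2 / h ^ 2) * (∫ x in tet v, ψ x)
      ≤ ∫ x in tet v, ⟪gradient u x, gradient χ x⟫ := by
    intro v hv
    obtain ⟨pu, hpu, q, hq, hup, hwq, hχb, hgd, hbd⟩ := hloc v hv
    have hcp := tet_compact v
    have hGc := W.contG.mono (hs v hv)
    have a1 := ae_tet (v := v) (F := fun x => ⟪gradient u x, gradient χ x⟫)
      (f := fun x => ⟪gradient pu x, gradient (bern r v (fun ω => cf r q (v ∘ ω) * φ (v (ω ⟨0, hr⟩)))) x⟫)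
      (fun x hx => by rw [(grad_congr_int hup hx).2, (grad_congr_int hχb hx).2])
    have a2 := ae_tet (v := v) (F := fun x => w x * ⟪gradient w x, G x⟫) (f := fun x => q x * ⟪gradient q x, G x⟫)
      (fun x hx => by rw [(grad_congr_int hwq hx).2, hwq x (interior_subset hx)])
    have a3 := fun j => ae_tet (v := v) (F := fun x => 2 * w x * fderiv ℝ w x (ej j) * ⟪G x, ej j⟫)
      (f := fun x => 2 * q x * fderiv ℝ q x (ej j) * ⟪G x, ej j⟫)
      (fun x hx => by rw [(grad_congr_int hwq hx).1, hwq x (interior_subset hx)])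
    have a4 := ae_tet (v := v) (F := fun x => w x ^ 2 * Λ x) (f := fun x => q x ^ 2 * Λ x)
      (fun x hx => by rw [hwq x (interior_subset hx)])
    have hqc : Continuous q := (PP_diff hq).continuous
    refine ⟨?_, ?_, ?_, ?_⟩
    · exact IntegrableOn.congr_fun_ae (((grad_cont hpu).inner (grad_cont (bern_PP r v _))).continuousOn.integrableOn_compact hcp) a1.symm
    · exact IntegrableOn.congr_fun_ae ((hqc.continuousOn.mul ((grad_cont hq).continuousOn.inner hGc)).integrableOn_compact hcp) a2.symm
    · intro j
      refine IntegrableOn.congr_fun_ae (ContinuousOn.integrableOn_compact hcp ?_) (a3 j).symm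
      have : Continuous fun x => fderiv ℝ q x (ej j) := (PP_diff ((PP_deriv r q hq).2 (ej j))).continuous
      exact ((continuous_const.mul hqc).mul this).continuousOn.mul (hGc.inner continuousOn_const)
    · rw [integral_congr_ae a1, integral_congr_ae a2, integral_congr_ae a4]
      refine elt_est r hr hh hc hA hκ hκ2 W (hE v hv) (hs v hv) hq hpu hgd hψi hψ0 hψ ?_
      rcases hbd with ⟨a, ha⟩ | hbd
      · exact Or.inl ⟨a, ha, by rw [← hwq _ (vert_mem v a)]; exact hw0 _ ha⟩
      · exact Or.inr hbd
  have iΛ : IntegrableOn (fun x => w x ^ 2 * Λ x) (closure Ω) := ((hwc.pow 2).mul W.contL).integrableOn_compact hcl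
  obtain ⟨-, s1⟩ := integral_split hO hC hP hinj _ (fun v hv => (hlocI v hv).1)
  obtain ⟨-, s2⟩ := integral_split hO hC hP hinj _ (fun v hv => (hlocI v hv).2.1)
  obtain ⟨-, s3⟩ := integral_split hO hC hP hinj _ (fun v hv => iΛ.mono_set (hs v hv))
  obtain ⟨-, s4⟩ := integral_split hO hC hP hinj ψ (fun v hv => hψi.integrableOn)
  have s5 := fun j => (integral_split hO hC hP hinj _ (fun v hv => (hlocI v hv).2.2.1 j)).1
  have hz := hharm χ hχ
  obtain ⟨k2, hk2⟩ : ∃ k2, k2 = κ * (Ci r c * B1 r c) ^ 2 * (δ ^ 2 / h ^ 2) := ⟨_, rfl⟩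
  have hk20 : 0 ≤ k2 := by rw [hk2]; positivity
  have hsum : (∫ x in Ω, w x * ⟪gradient w x, G x⟫) - 1 / 4 * (∫ x in Ω, w x ^ 2 * Λ x) - k2 * (∫ x in Ω, ψ x) ≤ 0 := by
    rw [← hz, s1, s2, s3, s4, Finset.mul_sum, Finset.mul_sum, ← Finset.sum_sub_distrib, ← Finset.sum_sub_distrib, hk2]
    exact Finset.sum_le_sum fun v hv => (hlocI v hv).2.2.2
  have hψΩ : ∫ x in Ω, ψ x ≤ A * κ * h ^ 2 :=
    (setIntegral_le_integral hψi (Filter.Eventually.of_forall hψ0)).trans hψI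
  have hibp : 2 * ∫ x in Ω, w x * ⟪gradient w x, G x⟫ = ∫ x in Ω, w x ^ 2 * Λ x := by
    obtain ⟨L, hL, hLs, hLd⟩ := W.dv
    have hj : ∀ j, ∫ x in Ω, 2 * w x * fderiv ℝ w x (ej j) * ⟪G x, ej j⟫ = ∫ x in Ω, w x ^ 2 * L j x := by
      intro j
      obtain ⟨K, hK⟩ := W.lip j
      rw [ibp r hO hC hB hP w hwc hw0 (fun v hv => by
        obtain ⟨pu, hpu, q, hq, hup, hwq, -⟩ := hloc v hv
        exact ⟨q, hq, hwq⟩) (fun x => ⟪G x, ej j⟫) (fun x => -(L j x)) K hK (ej j) (hLd j), ← integral_neg]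
      exact integral_congr_ae (Filter.Eventually.of_forall fun x => by simp only; ring)
    have t1 : ∫ x in Ω, w x ^ 2 * Λ x = ∑ j, ∫ x in Ω, w x ^ 2 * L j x := by
      rw [← integral_finsetSum]
      · exact integral_congr_ae (Filter.Eventually.of_forall fun x => by simp only; rw [hLs, Finset.mul_sum])
      · intro j _
        exact (((hwc.pow 2).mul (hL j)).integrableOn_compact hcl).mono_set subset_closure
    rw [t1, ← integral_const_mul]
    simp_rw [← hj]
    rw [← integral_finsetSum _ (fun j _ => s5 j)]
    refine integral_congr_ae (Filter.Eventually.of_forall fun x => ?_)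
    have : ⟪gradient w x, G x⟫ = ∑ j, fderiv ℝ w x (ej j) * ⟪G x, ej j⟫ := by
      simp_rw [← grad_inner]
      rw [PiLp.inner_apply]
      have e : ∀ (y : E3) (j : Fin 3), ⟪y, ej j⟫ = y j := fun y j => by simp [ej, EuclideanSpace.inner_single_right]
      exact Finset.sum_congr rfl fun j _ => by rw [e, e]; exact mul_comm _ _
    simp only
    rw [this, Finset.mul_sum, Finset.mul_sum]
    exact Finset.sum_congr rfl fun j _ => by ring
  have hmain : ∫ x in Ω, w x ^ 2 * Λ x ≤ 4 * (κ * (Ci r c * B1 r c) ^ 2 * (A * κ)) * δ ^ 2 := by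
    have e : k2 * (A * κ * h ^ 2) = (κ * (Ci r c * B1 r c) ^ 2 * (A * κ)) * δ ^ 2 := by rw [hk2]; field_simp
    have := mul_le_mul_of_nonneg_left hψΩ hk20
    linarith
  obtain ⟨D, hD⟩ : ∃ D, D = 4 * (κ * (Ci r c * B1 r c) ^ 2 * (A * κ)) := ⟨_, rfl⟩
  rw [← hD] at hmain ⊢
  obtain ⟨C3, hC3⟩ : ∃ C3, C3 = 32 * (Ci r c + 1) ^ 3 := ⟨_, rfl⟩
  have hC30 : 0 ≤ C3 := by have := Ci_nonneg r hc; rw [hC3]; positivity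
  rw [← hC3]
  have hA0 : 0 < A := by linarith
  -- pointwise
  have hw2 : w x0 ^ 2 ≤ C3 * (A * κ ^ 3) / c ^ 3 * D * δ ^ 2 := by
    have hx := hx0
    rw [← hP.2.1] at hx
    simp only [mem_iUnion] at hx
    obtain ⟨v, hv, hxv⟩ := hx
    obtain ⟨pu, hpu, q, hq, hup, hwq, -⟩ := hloc v hv
    have h1 := sup_avg r hr hh hc (hE v hv) hq hxv
    have h2 := vol_pos hh hc (hE v hv)
    rw [← hwq x0 hxv, ← hC3] at h1
    have hcp := tet_compact v
    have h3 : ∫ y in tet v, q y ^ 2 ≤ A * (κ * h) ^ 3 * ∫ y in tet v, w y ^ 2 * Λ y := by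
      rw [← integral_const_mul]
      refine setIntegral_mono_on (((PP_diff hq).continuous.pow 2).continuousOn.integrableOn_compact hcp)
        ((iΛ.mono_set (hs v hv)).const_mul _) hcp.measurableSet fun y hy => ?_
      rw [← hwq y hy]
      have n := W.near y (hs v hv hy) ((tet_dist (hE v hv) hy hxv).trans (by nlinarith))
      rw [div_le_iff₀ (by positivity)] at n
      have := mul_le_mul_of_nonneg_left n (sq_nonneg (w y))
      linarith
    have h4 : ∫ y in tet v, w y ^ 2 * Λ y ≤ ∫ x in Ω, w x ^ 2 * Λ x := by
      rw [setIntegral_congr_set (ae_closure hO hC)]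
      refine setIntegral_mono_set iΛ ?_ (LE.le.eventuallyLE (hs v hv))
      filter_upwards [ae_restrict_mem hcl.measurableSet] with y hy
      exact mul_nonneg (sq_nonneg _) (W.nonneg y hy)
    have h5 := (h3.trans (mul_le_mul_of_nonneg_left (h4.trans hmain) (by positivity)))
    have h6 := mul_le_mul_of_nonneg_left h5 hC30
    have h7 := mul_le_mul_of_nonneg_left h2 (sq_nonneg (w x0))
    have h8 : w x0 ^ 2 * (c * h) ^ 3 ≤ C3 * (A * (κ * h) ^ 3 * (D * δ ^ 2)) := by linarith
    rw [← le_div_iff₀ (by positivity)] at h8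
    refine h8.trans (le_of_eq ?_)
    field_simp
  have hw3 : |w x0| ≤ √(C3 * (A * κ ^ 3) / c ^ 3 * D) * δ := by
    have hD0 : 0 ≤ D := by rw [hD]; positivity
    apply abs_le_of_sq_le_sq _ (by positivity)
    rw [mul_pow, Real.sq_sqrt (by positivity)]
    exact hw2
  have := huw x0 hx0
  have t := abs_sub_abs_le_abs_sub (u x0) (w x0)
  linarith

theorem exists_inj (T : Finset (Fin 4 → E3)) : ∃ T' : Finset (Fin 4 → E3), T' ⊆ T ∧ Set.InjOn tet (T' : Set (Fin 4 → E3)) ∧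
    ∀ v ∈ T, ∃ w ∈ T', tet w = tet v := by
  classical
  obtain ⟨s, hs, hb⟩ := (Set.surjOn_image tet (T : Set (Fin 4 → E3))).exists_bijOn_subset
  have hf : s.Finite := T.finite_toSet.subset hs
  refine ⟨hf.toFinset, ?_, ?_, ?_⟩
  · intro v hv; exact hs (by simpa using hv)
  · simpa using hb.injOn
  · intro v hv
    obtain ⟨w, hw, e⟩ := hb.surjOn ⟨v, hv, rfl⟩
    exact ⟨w, by simpa using hw, e⟩

/-- **Weak maximum principle for finite element functions (Theorem 1).** -/
theorem weak_maximum_principle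
    (Ω : Set E3) (hΩ : IsConvexPolyhedron Ω)
    (c : ℝ) (hc : 0 < c) (r : ℕ) (hr : 1 ≤ r) :
    ∃ C : ℝ, ∀ h : ℝ, 0 < h → ∀ T : Finset (Fin 4 → E3), IsTetPartition Ω T h c →
      ∀ u_h : E3 → ℝ, MemSh Ω T r u_h →
        (∀ χ : E3 → ℝ, MemSh0 Ω T r χ → ∫ x in Ω, ⟪gradient u_h x, gradient χ x⟫ = 0) →
        (⨆ x ∈ Ω, |u_h x|) ≤ C * ⨆ x ∈ frontier Ω, |u_h x| := by
  rcases Ω.eq_empty_or_nonempty with rfl | hne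
  · exact ⟨0, fun h _ T _ u _ _ => by simp⟩
  obtain ⟨A, hA, hW⟩ := weight Ω hΩ hne
  obtain ⟨hO, hB, hC, -⟩ := hΩ
  obtain ⟨κ, hκd⟩ : ∃ κ, κ = max A ((B0 r c A + 1) * (4 * (32 * (Ci r c + 1) ^ 3) + 4)) := ⟨_, rfl⟩
  have hκ : A ≤ κ := hκd ▸ le_max_left _ _
  have hκ2 : (B0 r c A + 1) * (4 * (32 * (Ci r c + 1) ^ 3) + 4) ≤ κ := hκd ▸ le_max_right _ _
  refine ⟨√((32 * (Ci r c + 1) ^ 3) * (A * κ ^ 3) / c ^ 3 * (4 * (κ * (Ci r c * B1 r c) ^ 2 * (A * κ)))) + CR r, ?_⟩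
  intro h hh T hP u hu hharm
  obtain ⟨T', hT, hinj, hrep⟩ := exists_inj T
  have hP' : IsTetPartition Ω T' h c := by
    obtain ⟨p1, p2, p3, p4, p5, p6⟩ := hP
    refine ⟨fun v hv => p1 v (hT hv), ?_, fun v hv w hw => p3 v (hT hv) w (hT hw), fun v hv w hw => p4 v (hT hv) w (hT hw),
      fun v hv => p5 v (hT hv), fun v hv => p6 v (hT hv)⟩
    rw [← p2]
    ext x
    simp only [mem_iUnion]
    constructor
    · rintro ⟨v, hv, hx⟩; exact ⟨v, hT hv, hx⟩
    · rintro ⟨v, hv, hx⟩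
      obtain ⟨w, hw, e⟩ := hrep v hv
      exact ⟨w, hw, e ▸ hx⟩
  have hu' : MemSh Ω T' r u := ⟨hu.1, fun v hv => hu.2 v (hT hv)⟩
  have hharm' : ∀ χ : E3 → ℝ, MemSh0 Ω T' r χ → ∫ x in Ω, ⟪gradient u x, gradient χ x⟫ = 0 := by
    intro χ hχ
    refine hharm χ ⟨⟨hχ.1.1, fun v hv => ?_⟩, hχ.2⟩
    obtain ⟨w, hw, e⟩ := hrep v hv
    rw [← e]
    exact hχ.1.2 w hw
  have hfc : IsCompact (frontier Ω) := hB.isCompact_closure.of_isClosed_subset isClosed_frontier frontier_subset_closure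
  obtain ⟨M, hM⟩ := hfc.exists_bound_of_continuousOn (hu.1.mono frontier_subset_closure)
  have hin : ∀ x, (⨆ _ : x ∈ frontier Ω, |u x|) ≤ max M 0 := fun x =>
    Real.iSup_le (fun hx => (hM x hx).trans (le_max_left _ _)) (le_max_right _ _)
  have hδ : ∀ x ∈ frontier Ω, |u x| ≤ ⨆ x ∈ frontier Ω, |u x| := by
    intro x hx
    have h1 : |u x| = ⨆ _ : x ∈ frontier Ω, |u x| := by
      have : Nonempty (x ∈ frontier Ω) := ⟨hx⟩
      rw [ciSup_const]
    rw [h1]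
    exact le_ciSup (f := fun x => ⨆ _ : x ∈ frontier Ω, |u x|) ⟨max M 0, by rintro _ ⟨y, rfl⟩; exact hin y⟩ x
  have hδ0 : 0 ≤ ⨆ x ∈ frontier Ω, |u x| := Real.iSup_nonneg fun x => Real.iSup_nonneg fun _ => abs_nonneg _
  have hpt : ∀ x ∈ Ω, |u x| ≤ (√((32 * (Ci r c + 1) ^ 3) * (A * κ ^ 3) / c ^ 3 * (4 * (κ * (Ci r c * B1 r c) ^ 2 * (A * κ)))) + CR r)
      * ⨆ x ∈ frontier Ω, |u x| := by
    intro x hx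
    obtain ⟨φ, G, Λ, W⟩ := hW h κ hh (hA.trans hκ) x (subset_closure hx)
    exact main_est r hr hO hC hB hh hc hP' hinj hA hκ hκ2 (subset_closure hx) W u hu' _ hδ0 hδ hharm'
  have hR0 := mul_nonneg (add_nonneg (Real.sqrt_nonneg ((32 * (Ci r c + 1) ^ 3) * (A * κ ^ 3) / c ^ 3 * (4 * (κ * (Ci r c * B1 r c) ^ 2 * (A * κ))))) (CR_nonneg r)) hδ0
  exact Real.iSup_le (fun x => Real.iSup_le (fun hx => hpt x hx) hR0) hR0
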